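/- arXiv:1106.1513 — 3 statements merged into one kernel-verified Lean document; each statement's English description precedes it below -/
import Mathlib

section
/- Let X be a complex Banach space and let T : X → X be a Ritt operator. Then there exists an angle γ ∈ (0, π/2) such that the spectrum of T satisfies σ(T) ⊆ B_γ ∪ {1}, and the set {(λ − 1)(λ I − T)^{-1} : λ ∈ ℂ \ B_γ, λ ≠ 1} is bounded in operator norm. -/
/-- The Stolz type domain `B_γ`: the interior of the convex hull of `1` and the open disc
`D(0, sin γ)` in `ℂ`. -/
def BStolz (γ : ℝ) : Set ℂ :=
  interior (convexHull ℝ ({1} ∪ Metric.ball (0 : ℂ) (Real.sin γ)))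

section RittHelpers

variable {A : Type*} [NormedRing A] [NormedAlgebra ℂ A] [CompleteSpace A]

/-- Existence of the inverse of `1 - qT` for power bounded `T` and `|q| < 1`. -/
theorem ritt_isUnit (T : A) (C : ℝ) (hC : ∀ n : ℕ, ‖T ^ n‖ ≤ C) (q : ℂ) (hq : ‖q‖ < 1) :
    IsUnit (1 - q • T) := by
  have hlim : Filter.Tendsto (fun n : ℕ => ‖q‖ ^ n * C) Filter.atTop (nhds 0) := by
    simpa using (tendsto_pow_atTop_nhds_zero_of_lt_one (norm_nonneg q) hq).mul_const C
  obtain ⟨n, hn⟩ := (hlim.eventually (gt_mem_nhds zero_lt_one)).exists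
  have hlt : ‖(q • T) ^ n‖ < 1 := by
    rw [smul_pow, norm_smul, norm_pow]
    exact lt_of_le_of_lt (mul_le_mul_of_nonneg_left (hC n) (by positivity)) hn
  have hu := isUnit_one_sub_of_norm_lt_one hlt
  rw [← mul_neg_geom_sum] at hu
  refine (Commute.isUnit_mul_iff ?_).1 hu |>.1
  refine Commute.sum_right _ _ _ fun i _ => ?_
  exact (Commute.one_left _).sub_left ((Commute.refl _).pow_right _)

theorem ritt_sq_bound (T : A) (C2 : ℝ)
    (h2 : ∀ n : ℕ, ((n : ℝ) + 1) * ‖T ^ n * (T - 1)‖ ≤ C2) (n : ℕ) :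
    ‖T ^ n * (T - 1) ^ 2‖ ≤ 4 * C2 ^ 2 / ((n : ℝ) + 1) ^ 2 := by
  obtain ⟨a, b, hab, ha, hb⟩ : ∃ a b : ℕ, n = a + b ∧ n + 1 ≤ 2 * (a + 1) ∧ n + 1 ≤ 2 * (b + 1) :=
    ⟨n / 2, n - n / 2, by omega, by omega, by omega⟩
  have e : T ^ n * (T - 1) ^ 2 = (T ^ a * (T - 1)) * (T ^ b * (T - 1)) := by
    have hc : Commute (T - 1) (T ^ b) :=
      ((Commute.refl T).sub_left (Commute.one_left T)).pow_right b
    rw [hab, pow_add, pow_two, mul_assoc, mul_assoc, ← mul_assoc (T - 1) (T ^ b), hc.eq]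
    simp only [mul_assoc]
  rw [e, le_div_iff₀ (by positivity)]
  have ha' : (n : ℝ) + 1 ≤ 2 * (a + 1) := by exact_mod_cast ha
  have hb' : (n : ℝ) + 1 ≤ 2 * (b + 1) := by exact_mod_cast hb
  have hA := h2 a
  have hB := h2 b
  have h0 : 0 ≤ C2 := le_trans (by positivity) hA
  set x := ‖T ^ a * (T - 1)‖
  set y := ‖T ^ b * (T - 1)‖
  have hx : 0 ≤ x := norm_nonneg _
  have hy : 0 ≤ y := norm_nonneg _
  calc ‖(T ^ a * (T - 1)) * (T ^ b * (T - 1))‖ * ((n : ℝ) + 1) ^ 2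
      ≤ (x * y) * ((2 * (a + 1)) * (2 * (b + 1))) := by
        rw [pow_two]
        gcongr
        exact norm_mul_le _ _
    _ = 4 * (((a + 1) * x) * ((b + 1) * y)) := by ring
    _ ≤ 4 * (C2 * C2) := by gcongr
    _ = 4 * C2 ^ 2 := by ring

theorem ritt_expand (T G : A) (q : ℂ) (hG : (1 - q • T) * G = 1) (K : ℕ) :
    G = ∑ n ∈ Finset.range K, (q • T) ^ n + (q • T) ^ K * G := by
  have h := geom_sum_mul_neg (q • T) K
  have h3 : (∑ n ∈ Finset.range K, (q • T) ^ n) * ((1 - q • T) * G) = (1 - (q • T) ^ K) * G := by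
    rw [← mul_assoc, h]
  rw [hG, mul_one] at h3
  rw [h3]; noncomm_ring

theorem ritt_tele (D : ℝ) (hD : 0 ≤ D) (N : ℕ) (hN : 1 ≤ N) (K : ℕ) :
    ∑ n ∈ Finset.range K, D / (((N + n : ℕ) : ℝ) + 1) ^ 2 ≤ D / N - D / ((N + K : ℕ) : ℝ) := by
  have hN' : (1 : ℝ) ≤ N := by exact_mod_cast hN
  induction K with
  | zero => simp
  | succ K ih =>
    rw [Finset.sum_range_succ]
    have hp : (0 : ℝ) < N + K := by positivity
    have : D / (((N + K : ℕ) : ℝ) + 1) ^ 2 ≤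
        D / ((N + K : ℕ) : ℝ) - D / ((N + (K + 1) : ℕ) : ℝ) := by
      push_cast
      have e : D / ((N : ℝ) + K) - D / (N + (K + 1)) = D / ((N + K) * (N + K + 1)) := by
        field_simp; ring
      rw [e]
      apply div_le_div_of_nonneg_left hD (by positivity)
      nlinarith
    linarith

theorem ritt_tail (T G : A) (C2 : ℝ)
    (h2 : ∀ n : ℕ, ((n : ℝ) + 1) * ‖T ^ n * (T - 1)‖ ≤ C2) (q : ℂ) (hq : ‖q‖ < 1)
    (hG : (1 - q • T) * G = 1) (N : ℕ) (hN : 1 ≤ N) :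
    ‖T ^ N * (T - 1) ^ 2 * G‖ ≤ 4 * C2 ^ 2 / N := by
  have hN' : (1 : ℝ) ≤ N := by exact_mod_cast hN
  set D := 4 * C2 ^ 2 with hDdef
  have hD : 0 ≤ D := by positivity
  have hb : ∀ K : ℕ, ‖T ^ N * (T - 1) ^ 2 * G‖ ≤ D / N + ‖q‖ ^ K * (D * ‖G‖) := by
    intro K
    have key : ∀ n : ℕ, ‖T ^ N * (T - 1) ^ 2 * (q • T) ^ n‖ ≤
        ‖q‖ ^ n * (D / (((N + n : ℕ) : ℝ) + 1) ^ 2) := by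
      intro n
      have hc : Commute ((T - 1) ^ 2) (T ^ n) :=
        (((Commute.refl T).sub_left (Commute.one_left T)).pow_right n).pow_left 2
      rw [smul_pow, mul_smul_comm, norm_smul, norm_pow, mul_assoc, hc.eq, ← mul_assoc, ← pow_add]
      exact mul_le_mul_of_nonneg_left (ritt_sq_bound T C2 h2 _) (by positivity)
    have e : T ^ N * (T - 1) ^ 2 * G =
        ∑ n ∈ Finset.range K, T ^ N * (T - 1) ^ 2 * (q • T) ^ n
          + T ^ N * (T - 1) ^ 2 * (q • T) ^ K * G := by
      conv_lhs => rw [ritt_expand T G q hG K]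
      rw [mul_add, Finset.mul_sum, mul_assoc _ _ G]
    rw [e]
    refine (norm_add_le _ _).trans (add_le_add ?_ ?_)
    · calc _ ≤ ∑ n ∈ Finset.range K, D / (((N + n : ℕ) : ℝ) + 1) ^ 2 := by
            refine norm_sum_le_of_le _ fun n _ => (key n).trans ?_
            exact mul_le_of_le_one_left (by positivity) (pow_le_one₀ (norm_nonneg _) hq.le)
        _ ≤ D / N - D / ((N + K : ℕ) : ℝ) := ritt_tele D hD N hN K
        _ ≤ D / N := by
            have : 0 ≤ D / ((N + K : ℕ) : ℝ) := by positivity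
            linarith
    · refine (norm_mul_le _ _).trans ?_
      rw [← mul_assoc]
      refine mul_le_mul_of_nonneg_right ((key K).trans ?_) (norm_nonneg _)
      refine mul_le_mul_of_nonneg_left ?_ (by positivity)
      apply div_le_self hD
      have : (0 : ℝ) ≤ ((N + K : ℕ) : ℝ) := by positivity
      nlinarith
  have hlim : Filter.Tendsto (fun K : ℕ => D / N + ‖q‖ ^ K * (D * ‖G‖)) Filter.atTop
      (nhds (D / N)) := by
    simpa using ((tendsto_pow_atTop_nhds_zero_of_lt_one (norm_nonneg q) hq).mul_const
      (D * ‖G‖)).const_add (D / N)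
  exact ge_of_tendsto' hlim hb

theorem ritt_G_bound (T G : A) (C C2 : ℝ) (hC : ∀ n : ℕ, ‖T ^ n‖ ≤ C)
    (h2 : ∀ n : ℕ, ((n : ℝ) + 1) * ‖T ^ n * (T - 1)‖ ≤ C2) (q : ℂ) (hq : ‖q‖ < 1)
    (hG : (1 - q • T) * G = 1) :
    ‖1 - q‖ * ‖G‖ ≤ 4 * C + C2 + 4 * C2 ^ 2 := by
  have hq1 : 1 - q ≠ 0 := by
    intro h
    have : q = 1 := by linear_combination -h
    simp [this] at hq
  have hd : 0 < ‖1 - q‖ := norm_pos_iff.2 hq1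
  have hd2 : ‖1 - q‖ ≤ 2 := (norm_sub_le _ _).trans (by simp; linarith)
  have hC0 : 0 ≤ C := (norm_nonneg _).trans (hC 0)
  have hC20 : 0 ≤ C2 := le_trans (by positivity) (h2 0)
  set N := ⌈1 / ‖1 - q‖⌉₊ with hNdef
  have hN1 : 1 / ‖1 - q‖ ≤ N := Nat.le_ceil _
  have hN2 : (N : ℝ) < 1 / ‖1 - q‖ + 1 := Nat.ceil_lt_add_one (by positivity)
  have hNpos : 0 < N := Nat.ceil_pos.2 (by positivity)
  have hNr : (0 : ℝ) < N := by exact_mod_cast hNpos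
  have hN1' : 1 ≤ ‖1 - q‖ * N := by
    rw [div_le_iff₀ hd] at hN1; linarith
  have hN2' : ‖1 - q‖ * N ≤ 3 := by
    have := mul_lt_mul_of_pos_left hN2 hd
    rw [mul_add, mul_one_div_cancel hd.ne'] at this
    linarith
  have base : (1 - q) • G = 1 + q • ((T - 1) * G) := by
    have : (1 - q) • G = (1 - q • T) * G + q • ((T - 1) * G) := by
      simp only [sub_mul, sub_smul, one_smul, one_mul, smul_sub, smul_mul_assoc]
      abel
    rw [this, hG]
  have e1 : (1 - q) • (T ^ N * G) = T ^ N + q • (T ^ N * (T - 1) * G) := by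
    rw [← mul_smul_comm, base, mul_add, mul_one, mul_smul_comm, mul_assoc]
  have e2 : (1 - q) • (T ^ N * (T - 1) * G) =
      T ^ N * (T - 1) + q • (T ^ N * (T - 1) ^ 2 * G) := by
    rw [← mul_smul_comm, base, mul_add, mul_one, mul_smul_comm, pow_two]
    simp only [mul_assoc]
  have hS : ‖∑ n ∈ Finset.range N, (q • T) ^ n‖ ≤ N * C := by
    have : ‖∑ n ∈ Finset.range N, (q • T) ^ n‖ ≤ ∑ n ∈ Finset.range N, C := by
      refine norm_sum_le_of_le _ fun n _ => ?_
      rw [smul_pow, norm_smul, norm_pow]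
      exact (mul_le_of_le_one_left (norm_nonneg _) (pow_le_one₀ (norm_nonneg _) hq.le)).trans (hC n)
    simpa using this
  have b2 : ‖T ^ N * (T - 1) * G‖ ≤ C2 + 4 * C2 ^ 2 := by
    have h3 : ‖1 - q‖ * ‖T ^ N * (T - 1) * G‖ ≤ C2 / N + 4 * C2 ^ 2 / N := by
      rw [← norm_smul, e2]
      refine (norm_add_le _ _).trans (add_le_add ?_ ?_)
      · rw [le_div_iff₀ hNr]
        have := h2 N
        nlinarith [norm_nonneg (T ^ N * (T - 1))]
      · rw [norm_smul]
        exact (mul_le_of_le_one_left (norm_nonneg _) hq.le).trans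
          (ritt_tail T G C2 h2 q hq hG N hNpos)
    rw [← add_div, le_div_iff₀ hNr] at h3
    nlinarith [norm_nonneg (T ^ N * (T - 1) * G)]
  have b1 : ‖1 - q‖ * ‖T ^ N * G‖ ≤ C + (C2 + 4 * C2 ^ 2) := by
    rw [← norm_smul, e1]
    refine (norm_add_le _ _).trans (add_le_add (hC N) ?_)
    rw [norm_smul]
    exact (mul_le_of_le_one_left (norm_nonneg _) hq.le).trans b2
  have hGle : ‖G‖ ≤ N * C + ‖T ^ N * G‖ := by
    conv_lhs => rw [ritt_expand T G q hG N]
    refine (norm_add_le _ _).trans (add_le_add hS ?_)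
    rw [smul_pow, smul_mul_assoc, norm_smul, norm_pow]
    exact mul_le_of_le_one_left (norm_nonneg _) (pow_le_one₀ (norm_nonneg _) hq.le)
  have := mul_le_mul_of_nonneg_left hGle hd.le
  nlinarith

/-- The Ritt resolvent condition outside the closed unit disc. -/
theorem ritt_resolvent (T : A) (C C2 : ℝ) (hC : ∀ n : ℕ, ‖T ^ n‖ ≤ C)
    (h2 : ∀ n : ℕ, ((n : ℝ) + 1) * ‖T ^ n * (T - 1)‖ ≤ C2) (l : ℂ) (hl : 1 < ‖l‖) :
    ∃ R : A, (algebraMap ℂ A l - T) * R = 1 ∧ R * (algebraMap ℂ A l - T) = 1 ∧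
      ‖l - 1‖ * ‖R‖ ≤ 4 * C + C2 + 4 * C2 ^ 2 := by
  have hl0 : l ≠ 0 := by rintro rfl; simp at hl; linarith
  have hq : ‖l⁻¹‖ < 1 := by rw [norm_inv]; exact inv_lt_one_of_one_lt₀ hl
  obtain ⟨u, hu⟩ := ritt_isUnit T C hC l⁻¹ hq
  have hG : (1 - l⁻¹ • T) * (↑u⁻¹ : A) = 1 := by rw [← hu]; exact u.mul_inv
  have hG' : (↑u⁻¹ : A) * (1 - l⁻¹ • T) = 1 := by rw [← hu]; exact u.inv_mul
  have hb := ritt_G_bound T _ C C2 hC h2 l⁻¹ hq hG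
  have e : algebraMap ℂ A l - T = l • (1 - l⁻¹ • T) := by
    rw [smul_sub, smul_smul, mul_inv_cancel₀ hl0, one_smul, Algebra.algebraMap_eq_smul_one]
  refine ⟨l⁻¹ • (↑u⁻¹ : A), ?_, ?_, ?_⟩
  · rw [e, smul_mul_smul_comm, hG, mul_inv_cancel₀ hl0, one_smul]
  · rw [e, smul_mul_smul_comm, hG', inv_mul_cancel₀ hl0, one_smul]
  · rw [norm_smul, ← mul_assoc, ← norm_mul]
    have : (l - 1) * l⁻¹ = 1 - l⁻¹ := by field_simp
    rwa [this]

theorem ritt_perturb (T R : A) (l m : ℂ) (h1 : (algebraMap ℂ A l - T) * R = 1)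
    (h2 : R * (algebraMap ℂ A l - T) = 1) (h : ‖l - m‖ * ‖R‖ ≤ 1 / 2) :
    IsUnit (algebraMap ℂ A m - T) ∧ ‖Ring.inverse (algebraMap ℂ A m - T)‖ ≤ 2 * ‖R‖ := by
  have hlt : ‖(l - m) • R‖ < 1 := by rw [norm_smul]; linarith
  have hu := isUnit_one_sub_of_norm_lt_one hlt
  have e : algebraMap ℂ A m - T = (algebraMap ℂ A l - T) * (1 - (l - m) • R) := by
    rw [mul_sub, mul_smul_comm, h1, mul_one, ← Algebra.algebraMap_eq_smul_one, map_sub]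
    abel
  have hul : IsUnit (algebraMap ℂ A l - T) := ⟨⟨_, R, h1, h2⟩, rfl⟩
  have hum : IsUnit (algebraMap ℂ A m - T) := by rw [e]; exact hul.mul hu
  refine ⟨hum, ?_⟩
  have hS := Ring.mul_inverse_cancel _ hum
  set S := Ring.inverse (algebraMap ℂ A m - T)
  have hS2 : S = R + ((l - m) • R) * S := by
    have h3 : (1 - (l - m) • R) * S = R := by
      rw [e] at hS
      calc (1 - (l - m) • R) * S = (R * (algebraMap ℂ A l - T)) * ((1 - (l - m) • R) * S) := by
            rw [h2, one_mul]
        _ = R * ((algebraMap ℂ A l - T) * (1 - (l - m) • R) * S) := by simp only [mul_assoc]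
        _ = R := by rw [hS, mul_one]
    rw [sub_mul, one_mul] at h3
    exact sub_eq_iff_eq_add.1 h3
  have : ‖S‖ ≤ ‖R‖ + (‖l - m‖ * ‖R‖) * ‖S‖ := by
    calc ‖S‖ = ‖R + ((l - m) • R) * S‖ := by rw [← hS2]
      _ ≤ ‖R‖ + ‖((l - m) • R) * S‖ := norm_add_le _ _
      _ ≤ _ := by
        gcongr
        refine (norm_mul_le _ _).trans ?_
        rw [norm_smul]
  nlinarith [norm_nonneg S]

end RittHelpers

theorem stolz_mem (γ : ℝ) (m : ℂ) (u : ℝ) (hu0 : 0 < u) (hu1 : u ≤ 1)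
    (h : ‖m - ((1 - u : ℝ) : ℂ)‖ < u * Real.sin γ) : m ∈ BStolz γ := by
  refine mem_interior.2 ⟨Metric.ball ((1 - u : ℝ) : ℂ) (u * Real.sin γ), ?_, Metric.isOpen_ball, ?_⟩
  · intro z hz
    rw [Metric.mem_ball, dist_eq_norm] at hz
    have hu : (u : ℂ) ≠ 0 := by exact_mod_cast hu0.ne'
    have hw : (z - ((1 - u : ℝ) : ℂ)) / u ∈ Metric.ball (0 : ℂ) (Real.sin γ) := by
      rw [mem_ball_zero_iff, norm_div, Complex.norm_real, Real.norm_of_nonneg hu0.le,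
        div_lt_iff₀ hu0]
      linarith
    have hc := convex_convexHull ℝ ({1} ∪ Metric.ball (0 : ℂ) (Real.sin γ))
    have := hc (subset_convexHull ℝ _ (Or.inl rfl : (1 : ℂ) ∈ _))
      (subset_convexHull ℝ _ (Or.inr hw)) (by linarith : 0 ≤ 1 - u) hu0.le (by ring)
    convert this using 1
    simp only [Complex.real_smul]
    field_simp
    ring
  · rw [Metric.mem_ball, dist_eq_norm]; exact h

theorem stolz_geo (γ : ℝ) (hγ : γ ∈ Set.Ioo (0 : ℝ) (Real.pi / 2)) (m : ℂ) (hm : m ∉ BStolz γ) :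
    ∃ l : ℂ, 1 ≤ ‖l‖ ∧ ‖l - m‖ ≤ Real.cos γ * ‖m - 1‖ := by
  have hc : 0 < Real.cos γ := Real.cos_pos_of_mem_Ioo ⟨by linarith [hγ.1, Real.pi_pos], hγ.2⟩
  have hs : 0 < Real.sin γ := Real.sin_pos_of_pos_of_lt_pi hγ.1 (by linarith [hγ.2, Real.pi_pos])
  have hsc := Real.sin_sq_add_cos_sq γ
  set c := Real.cos γ
  by_cases h1 : 1 ≤ ‖m‖
  · exact ⟨m, h1, by simp; positivity⟩
  push Not at h1
  have hm1 : m ≠ 1 := by rintro rfl; simp at h1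
  have hr : 0 < ‖m - 1‖ := norm_pos_iff.2 (sub_ne_zero.2 hm1)
  have key : ∀ u : ℝ, 0 < u → u ≤ 1 → u * Real.sin γ ≤ ‖m - ((1 - u : ℝ) : ℂ)‖ := by
    intro u h0 h1
    by_contra h
    exact hm (stolz_mem γ m u h0 h1 (not_le.1 h))
  have nsq : ∀ z : ℂ, ‖z‖ ^ 2 = z.re ^ 2 + z.im ^ 2 := fun z => by
    rw [← Complex.normSq_eq_norm_sq, Complex.normSq_apply]; ring
  have key2 : ∀ u : ℝ, 0 < u → u ≤ 1 → 2 * u * (1 - m.re) ≤ ‖m - 1‖ ^ 2 + u ^ 2 * c ^ 2 := by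
    intro u h0 h1
    have h := pow_le_pow_left₀ (by positivity) (key u h0 h1) 2
    rw [nsq] at h ⊢
    simp only [Complex.sub_re, Complex.sub_im, Complex.ofReal_re, Complex.ofReal_im,
      Complex.one_re, Complex.one_im] at h ⊢
    have e : Real.sin γ ^ 2 = 1 - c ^ 2 := by linarith
    rw [mul_pow, e] at h
    nlinarith
  have hre : m.re < 1 := lt_of_le_of_lt ((le_abs_self _).trans (Complex.abs_re_le_norm m)) h1
  by_cases hw : ‖m - 1‖ ≤ c
  · have h := key2 (‖m - 1‖ / c) (by positivity) ((div_le_one hc).2 hw)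
    have h' : 1 - m.re ≤ c * ‖m - 1‖ := by
      have e : (‖m - 1‖ / c) ^ 2 * c ^ 2 = ‖m - 1‖ ^ 2 := by field_simp
      rw [e] at h
      have h3 : 2 * (‖m - 1‖ / c) * (1 - m.re) * c = 2 * ‖m - 1‖ * (1 - m.re) := by field_simp
      have h4 := mul_le_mul_of_nonneg_right h hc.le
      rw [h3] at h4
      have : ‖m - 1‖ * (1 - m.re) ≤ ‖m - 1‖ * (c * ‖m - 1‖) := by nlinarith
      exact le_of_mul_le_mul_left this hr
    refine ⟨⟨1, m.im⟩, ?_, ?_⟩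
    · exact (le_abs_self _).trans (Complex.abs_re_le_norm (⟨1, m.im⟩ : ℂ))
    · have e : (⟨1, m.im⟩ : ℂ) - m = ((1 - m.re : ℝ) : ℂ) := by
        apply Complex.ext <;> simp
      rw [e, Complex.norm_real, Real.norm_of_nonneg (by linarith)]
      exact h'
  · push Not at hw
    have h := key 1 one_pos le_rfl
    simp at h
    have hmp : 0 < ‖m‖ := hs.trans_le h
    have hm0 : (‖m‖ : ℂ) ≠ 0 := by exact_mod_cast hmp.ne'
    refine ⟨m / ‖m‖, ?_, ?_⟩
    · rw [norm_div, Complex.norm_real, norm_norm, div_self hmp.ne']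
    · have e : m / ‖m‖ - m = (m / ‖m‖) * ((1 - ‖m‖ : ℝ) : ℂ) := by
        push_cast; field_simp
      rw [e, norm_mul, norm_div, Complex.norm_real, norm_norm, div_self hmp.ne', one_mul,
        Complex.norm_real, Real.norm_of_nonneg (by linarith)]
      have : Real.sin γ ^ 2 ≤ ‖m‖ ^ 2 := pow_le_pow_left₀ hs.le h 2
      nlinarith

theorem stolz_geo' (γ : ℝ) (hγ : γ ∈ Set.Ioo (0 : ℝ) (Real.pi / 2)) (m : ℂ) (hm : m ∉ BStolz γ)
    (hm1 : m ≠ 1) :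
    ∃ l : ℂ, 1 < ‖l‖ ∧ ‖l - m‖ ≤ 2 * Real.cos γ * ‖m - 1‖ := by
  have hc : 0 < Real.cos γ := Real.cos_pos_of_mem_Ioo ⟨by linarith [hγ.1, Real.pi_pos], hγ.2⟩
  have hr : 0 < ‖m - 1‖ := norm_pos_iff.2 (sub_ne_zero.2 hm1)
  obtain ⟨l, hl, hlm⟩ := stolz_geo γ hγ m hm
  have hlp : 0 < ‖l‖ := by linarith
  set d := Real.cos γ * ‖m - 1‖ / ‖l‖ with hd
  have hdp : 0 < d := by positivity
  refine ⟨((1 + d : ℝ) : ℂ) * l, ?_, ?_⟩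
  · rw [norm_mul, Complex.norm_real, Real.norm_of_nonneg (by positivity)]
    nlinarith
  · have e : ((1 + d : ℝ) : ℂ) * l - m = (l - m) + (d : ℂ) * l := by push_cast; ring
    rw [e]
    refine (norm_add_le _ _).trans ?_
    rw [norm_mul, Complex.norm_real, Real.norm_of_nonneg hdp.le, hd, div_mul_cancel₀ _ hlp.ne']
    linarith

/-- a Ritt operator `T` on a complex Banach space `X` satisfies, for some
`γ ∈ (0, π/2)`, the spectral inclusion `σ(T) ⊆ B_γ ∪ {1}` together with the boundedness of
`{(λ-1)(λ-T)^{-1} : λ ∉ B_γ, λ ≠ 1}`. -/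
theorem stmt_3 {X : Type*} [NormedAddCommGroup X] [NormedSpace ℂ X] [CompleteSpace X]
    (T : X →L[ℂ] X)
    (h1 : ∃ C : ℝ, ∀ n : ℕ, ‖T ^ n‖ ≤ C)
    (h2 : ∃ C : ℝ, ∀ n : ℕ, 1 ≤ n → (n : ℝ) * ‖T ^ n - T ^ (n - 1)‖ ≤ C) :
    ∃ γ ∈ Set.Ioo (0 : ℝ) (Real.pi / 2),
      spectrum ℂ T ⊆ BStolz γ ∪ {1} ∧
      ∃ M : ℝ, ∀ lam : ℂ, lam ∉ BStolz γ → lam ≠ 1 →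
        ‖(lam - 1) • Ring.inverse (algebraMap ℂ (X →L[ℂ] X) lam - T)‖ ≤ M := by
  obtain ⟨C, hC⟩ := h1
  obtain ⟨C2, hC2⟩ := h2
  have h2 : ∀ n : ℕ, ((n : ℝ) + 1) * ‖T ^ n * (T - 1)‖ ≤ C2 := by
    intro n
    have := hC2 (n + 1) (by omega)
    rw [Nat.add_sub_cancel] at this
    rw [mul_sub, mul_one, ← pow_succ]
    exact_mod_cast this
  have hC0 : 0 ≤ C := (norm_nonneg _).trans (hC 0)
  have hC20 : 0 ≤ C2 := le_trans (by positivity) (h2 0)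
  set M := 4 * C + C2 + 4 * C2 ^ 2 with hM
  have hM0 : 0 ≤ M := by positivity
  obtain ⟨γ, hγ, hcos⟩ : ∃ γ ∈ Set.Ioo (0 : ℝ) (Real.pi / 2),
      Real.cos γ * (8 * M + 8) ≤ 1 := by
    have ht : 1 / (8 * M + 8) < 1 := by rw [div_lt_one (by positivity)]; linarith
    have ht0 : 0 < 1 / (8 * M + 8) := by positivity
    refine ⟨Real.arccos (1 / (8 * M + 8)), ⟨Real.arccos_pos.2 ht, Real.arccos_lt_pi_div_two.2 ht0⟩, ?_⟩
    rw [Real.cos_arccos (by linarith) ht.le, one_div_mul_cancel (by positivity)]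
  have hc : 0 < Real.cos γ := Real.cos_pos_of_mem_Ioo ⟨by linarith [hγ.1, Real.pi_pos], hγ.2⟩
  have main : ∀ m : ℂ, m ∉ BStolz γ → m ≠ 1 → IsUnit (algebraMap ℂ (X →L[ℂ] X) m - T) ∧
      ‖(m - 1) • Ring.inverse (algebraMap ℂ (X →L[ℂ] X) m - T)‖ ≤ 4 * M := by
    intro m hm hm1
    have hr : 0 < ‖m - 1‖ := norm_pos_iff.2 (sub_ne_zero.2 hm1)
    obtain ⟨l, hl, hlm⟩ := stolz_geo' γ hγ m hm hm1
    obtain ⟨R, hR1, hR2, hR⟩ := ritt_resolvent T C C2 hC h2 l hl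
    have hcM : 0 ≤ Real.cos γ * M := by positivity
    have htri : ‖m - 1‖ ≤ ‖l - 1‖ + ‖l - m‖ := by
      have : m - 1 = (l - 1) - (l - m) := by ring
      rw [this]; exact norm_sub_le _ _
    have hhalf : ‖m - 1‖ ≤ 2 * ‖l - 1‖ := by nlinarith
    have hR' : ‖m - 1‖ * ‖R‖ ≤ 2 * M := by
      have := mul_le_mul_of_nonneg_right hhalf (norm_nonneg R)
      linarith
    have hsmall : ‖l - m‖ * ‖R‖ ≤ 1 / 2 := by
      have h3 := mul_le_mul_of_nonneg_right hlm (norm_nonneg R)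
      have h4 := mul_le_mul_of_nonneg_left hR' (by positivity : 0 ≤ 2 * Real.cos γ)
      linarith
    obtain ⟨hu, hb⟩ := ritt_perturb T R l m hR1 hR2 hsmall
    refine ⟨hu, ?_⟩
    rw [norm_smul]
    have := mul_le_mul_of_nonneg_left hb hr.le
    linarith
  refine ⟨γ, hγ, ?_, 4 * M, fun m hm hm1 => (main m hm hm1).2⟩
  intro m hm
  by_contra hcon
  rw [Set.mem_union, not_or] at hcon
  exact (spectrum.mem_iff.1 hm) (main m hcon.1 hcon.2).1
end

section
/- Let H be a complex Hilbert space and T : H → H a bounded operator. The following are equivalent: (a) there exist a complex Hilbert space K, bounded operators J : H → K and Q : K → H, and an invertible bounded operator U : K → K with sup_{n ∈ ℤ} ‖U^n‖ < ∞, such that T^n = Q U^n J for every integer n ≥ 0; (b) T is similar to a contraction, i.e. there exists an invertible bounded operator V on H such that ‖V^{-1} T V‖ ≤ 1. -/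
open Filter Topology

lemma exists_sqrt_equiv {E : Type} [NormedAddCommGroup E] [InnerProductSpace ℂ E] [CompleteSpace E]
    (A : E →L[ℂ] E) (hA : A.IsPositive) (c : ℝ) (hc : 0 < c)
    (h : ∀ x, c * ‖x‖ ^ 2 ≤ (inner ℂ (A x) x).re) :
    ∃ S : E ≃L[ℂ] E, ∀ x, ‖S x‖ ^ 2 = (inner ℂ (A x) x).re := by
  have hu : IsUnit A := by
    refine ContinuousLinearMap.isUnit_of_forall_le_norm_inner_map A (c := ⟨c, hc.le⟩) hc ?_
    intro x
    have := (h x).trans (Complex.re_le_norm _)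
    rw [mul_comm] at this
    exact this
  have h0 : 0 ≤ A := (ContinuousLinearMap.nonneg_iff_isPositive A).2 hA
  have hu' : IsUnit (CFC.sqrt A) := (CFC.isUnit_sqrt_iff A h0).2 hu
  obtain ⟨u, hu'⟩ := hu'
  refine ⟨ContinuousLinearEquiv.unitsEquiv ℂ E u, fun x => ?_⟩
  rw [ContinuousLinearEquiv.unitsEquiv_apply, hu']
  have hs : (CFC.sqrt A).IsPositive :=
    (ContinuousLinearMap.nonneg_iff_isPositive _).1 (CFC.sqrt_nonneg A)
  have h2 : A x = CFC.sqrt A (CFC.sqrt A x) := by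
    conv_lhs => rw [← CFC.sqrt_mul_sqrt_self A h0]
    rfl
  have h3 : inner ℂ (CFC.sqrt A (CFC.sqrt A x)) x = inner ℂ (CFC.sqrt A x) (CFC.sqrt A x) :=
    hs.isSymmetric _ _
  rw [h2, h3]
  exact (inner_self_eq_norm_sq (𝕜 := ℂ) _).symm

lemma contraction_case {H K : Type} [NormedAddCommGroup H] [InnerProductSpace ℂ H] [CompleteSpace H]
    [NormedAddCommGroup K] [InnerProductSpace ℂ K] [CompleteSpace K]
    (T : H →L[ℂ] H) (J : H →L[ℂ] K) (Q : K →L[ℂ] H) (L : K →L[ℂ] K)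
    (hL : ∀ x, ‖L x‖ ≤ ‖x‖) (h : ∀ (n : ℕ) x, (T ^ n) x = Q ((L ^ n) (J x))) :
    ∃ V : H ≃L[ℂ] H, ∀ x, ‖V.symm (T (V x))‖ ≤ ‖x‖ := by
  let N : Submodule ℂ K := ⨅ n : ℕ, (Q.comp (L ^ n)).ker
  have hN : ∀ x, x ∈ N ↔ ∀ n : ℕ, Q ((L ^ n) x) = 0 := by
    intro x
    simp only [N, Submodule.mem_iInf]
    exact Iff.rfl
  have hNc : IsClosed (N : Set K) := by
    have : (N : Set K) = ⋂ n : ℕ, {x | Q ((L ^ n) x) = 0} := by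
      ext x; simp [hN]
    rw [this]
    exact isClosed_iInter fun n => isClosed_eq (by fun_prop) continuous_const
  have : CompleteSpace N := hNc.completeSpace_coe
  let P : K →L[ℂ] K := Nᗮ.starProjection
  have hP0 : ∀ x ∈ N, P x = 0 := by
    intro x hx
    simp only [P]
    rw [Submodule.starProjection_apply_eq_zero_iff]
    exact N.le_orthogonal_orthogonal hx
  have hP1 : ∀ x, x - P x ∈ N := by
    intro x
    have := Nᗮ.sub_starProjection_mem_orthogonal x
    rwa [Submodule.orthogonal_orthogonal] at this
  have hPn : ∀ x, ‖P x‖ ≤ ‖x‖ := fun x => Nᗮ.norm_starProjection_apply_le x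
  have hQP : ∀ x, Q (P x) = Q x := by
    intro x
    have := (hN _).1 (hP1 x) 0
    simp [sub_eq_zero] at this
    exact this.symm
  have hLN : ∀ x ∈ N, L x ∈ N := by
    intro x hx
    rw [hN] at hx ⊢
    intro n
    have := hx (n+1)
    rwa [pow_succ] at this
  let X : H →L[ℂ] K := P.comp J
  have hXT : ∀ x, ‖X (T x)‖ ≤ ‖X x‖ := by
    intro x
    have e1 : P (L (J x)) = P (J (T x)) := by
      rw [← sub_eq_zero, ← map_sub]
      apply hP0
      rw [hN]
      intro n
      have a1 := h (n+1) x
      have a2 := h n (T x)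
      rw [pow_succ, pow_succ] at a1
      simp only [map_sub]
      change (T ^ n) (T x) = Q ((L ^ n) (L (J x))) at a1
      rw [← a1, ← a2, sub_self]
    have e2 : P (L (J x)) = P (L (P (J x))) := by
      rw [← sub_eq_zero, ← map_sub, ← map_sub]
      exact hP0 _ (hLN _ (hP1 _))
    change ‖P (J (T x))‖ ≤ ‖P (J x)‖
    rw [← e1, e2]
    exact (hPn _).trans (hL _)
  have hQX : ∀ x, Q (X x) = x := by
    intro x
    have := h 0 x
    simp at this
    change Q (P (J x)) = x
    rw [hQP, ← this]
  let q : ℝ := ‖Q‖ + 1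
  have hq : 0 < q := by positivity
  have hlow : ∀ x, ‖x‖ ≤ q * ‖X x‖ := by
    intro x
    calc ‖x‖ = ‖Q (X x)‖ := by rw [hQX]
      _ ≤ ‖Q‖ * ‖X x‖ := Q.le_opNorm _
      _ ≤ q * ‖X x‖ := by gcongr; simp [q]
  have hAi : ∀ x, (inner ℂ ((X.adjoint.comp X) x) x).re = ‖X x‖ ^ 2 := by
    intro x
    simp only [ContinuousLinearMap.comp_apply, ContinuousLinearMap.adjoint_inner_left]
    exact inner_self_eq_norm_sq (𝕜 := ℂ) _
  obtain ⟨S, hS⟩ := exists_sqrt_equiv (X.adjoint.comp X) X.isPositive_adjoint_comp_self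
    ((q ^ 2)⁻¹) (by positivity) (by
      intro x
      rw [hAi, inv_mul_le_iff₀ (by positivity), ← mul_pow]
      exact pow_le_pow_left₀ (norm_nonneg _) (hlow x) 2)
  have hS' : ∀ x, ‖S x‖ = ‖X x‖ := by
    intro x
    have := hS x
    rw [hAi] at this
    exact (sq_eq_sq₀ (norm_nonneg _) (norm_nonneg _)).1 this
  refine ⟨S.symm, fun x => ?_⟩
  rw [ContinuousLinearEquiv.symm_symm, hS']
  refine (hXT _).trans ?_
  rw [← hS']
  simp

lemma power_bounded_case {K : Type}
    [NormedAddCommGroup K] [InnerProductSpace ℂ K] [CompleteSpace K]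
    (L : K →L[ℂ] K) (M : ℝ) (hM : 0 < M)
    (hb : ∀ (n : ℕ) x, ‖(L ^ n) x‖ ≤ M * ‖x‖) (hl : ∀ (n : ℕ) x, ‖x‖ ≤ M * ‖(L ^ n) x‖) :
    ∃ S : K ≃L[ℂ] K, ∀ x, ‖S (L x)‖ = ‖S x‖ := by
  let a : ℕ → K → K → ℂ := fun n x y =>
    ((n : ℂ) + 1)⁻¹ * ∑ k ∈ Finset.range (n+1), inner ℂ ((L ^ k) x) ((L ^ k) y)
  have hn0 : ∀ n : ℕ, ((n : ℂ) + 1) ≠ 0 := fun n => by exact_mod_cast n.succ_ne_zero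
  have hnn : ∀ n : ℕ, ‖((n : ℂ) + 1)‖ = (n : ℝ) + 1 := fun n => by
    have : ((n : ℂ) + 1) = ((n + 1 : ℕ) : ℂ) := by push_cast; rfl
    rw [this, Complex.norm_natCast]; push_cast; rfl
  have hin : ∀ (k : ℕ) x y, ‖inner ℂ ((L ^ k) x) ((L ^ k) y)‖ ≤ M ^ 2 * ‖x‖ * ‖y‖ := by
    intro k x y
    calc _ ≤ ‖(L ^ k) x‖ * ‖(L ^ k) y‖ := norm_inner_le_norm _ _
      _ ≤ (M * ‖x‖) * (M * ‖y‖) := by gcongr <;> apply hb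
      _ = _ := by ring
  have ha : ∀ n x y, ‖a n x y‖ ≤ M ^ 2 * ‖x‖ * ‖y‖ := by
    intro n x y
    simp only [a, norm_mul, norm_inv, hnn]
    rw [inv_mul_le_iff₀ (by positivity)]
    refine (norm_sum_le_of_le _ (fun k _ => hin k x y)).trans ?_
    simp
  let F : Filter ℕ := (hyperfilter ℕ : Filter ℕ)
  have hF : F ≤ atTop := Nat.hyperfilter_le_atTop
  have hex : ∀ x y, ∃ l, Tendsto (fun n => a n x y) F (𝓝 l) := by
    intro x y
    obtain ⟨l, -, hl⟩ := (isCompact_closedBall (0 : ℂ) (M ^ 2 * ‖x‖ * ‖y‖)).ultrafilter_le_nhds'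
      ((hyperfilter ℕ).map (fun n => a n x y)) (by
        rw [Ultrafilter.mem_map]
        exact Filter.univ_mem' fun n => by simpa using ha n x y)
    exact ⟨l, hl⟩
  choose b hb' using hex
  have hbn : ∀ x y, ‖b x y‖ ≤ M ^ 2 * ‖x‖ * ‖y‖ := fun x y =>
    le_of_tendsto (hb' x y).norm (Eventually.of_forall fun n => ha n x y)
  let B₀ : K →ₗ⋆[ℂ] K →ₗ[ℂ] ℂ := LinearMap.mk₂'ₛₗ (starRingEnd ℂ) (RingHom.id ℂ) b
    (fun x y z => tendsto_nhds_unique (hb' _ _) (by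
      refine ((hb' x z).add (hb' y z)).congr fun n => ?_
      simp only [a, map_add, inner_add_left, Finset.sum_add_distrib, mul_add]))
    (fun c x z => tendsto_nhds_unique (hb' _ _) (by
      refine ((hb' x z).const_mul ((starRingEnd ℂ) c)).congr fun n => ?_
      simp only [a, map_smul, inner_smul_left, ← Finset.mul_sum]; ring))
    (fun x y z => tendsto_nhds_unique (hb' _ _) (by
      refine ((hb' x y).add (hb' x z)).congr fun n => ?_
      simp only [a, map_add, inner_add_right, Finset.sum_add_distrib, mul_add]))
    (fun c x z => tendsto_nhds_unique (hb' _ _) (by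
      refine ((hb' x z).const_mul c).congr fun n => ?_
      simp only [a, map_smul, inner_smul_right, ← Finset.mul_sum]; ring))
  let B : K →L⋆[ℂ] K →L[ℂ] ℂ := LinearMap.mkContinuous₂ B₀ (M ^ 2) (fun x y => hbn x y)
  let A := InnerProductSpace.continuousLinearMapOfBilin B
  have hA : ∀ x y, inner ℂ (A x) y = b x y := fun x y => by
    simp only [A, InnerProductSpace.continuousLinearMapOfBilin_apply]; rfl
  have hre : ∀ n x, a n x x =
      (((n : ℝ) + 1)⁻¹ * ∑ k ∈ Finset.range (n+1), ‖(L ^ k) x‖ ^ 2 : ℝ) := by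
    intro n x
    simp only [a, inner_self_eq_norm_sq_to_K]
    push_cast; rfl
  have hlow : ∀ n x, (M ^ 2)⁻¹ * ‖x‖ ^ 2 ≤ (a n x x).re := by
    intro n x
    rw [hre, Complex.ofReal_re, le_inv_mul_iff₀ (by positivity)]
    calc _ = ∑ k ∈ Finset.range (n+1), (M ^ 2)⁻¹ * ‖x‖ ^ 2 := by simp
      _ ≤ _ := by
        apply Finset.sum_le_sum
        intro k _
        rw [inv_mul_le_iff₀ (by positivity), ← mul_pow]
        exact pow_le_pow_left₀ (norm_nonneg _) (hl k x) 2
  have hlb : ∀ x, (M ^ 2)⁻¹ * ‖x‖ ^ 2 ≤ (b x x).re := fun x =>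
    ge_of_tendsto ((Complex.continuous_re.tendsto _).comp (hb' x x))
      (Eventually.of_forall fun n => hlow n x)
  have him : ∀ x, (b x x).im = 0 := fun x => by
    refine tendsto_nhds_unique ((Complex.continuous_im.tendsto _).comp (hb' x x)) ?_
    refine tendsto_const_nhds.congr fun n => ?_
    simp only [Function.comp, hre, Complex.ofReal_im]
  have hpos : A.IsPositive := by
    rw [ContinuousLinearMap.isPositive_iff_complex]
    intro x
    rw [hA]
    refine ⟨Complex.ext (by simp) (by simp [him]), ?_⟩
    exact le_trans (by positivity) (hlb x)
  have hinv : ∀ x, b (L x) (L x) = b x x := by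
    intro x
    rw [← sub_eq_zero]
    refine tendsto_nhds_unique ((hb' (L x) (L x)).sub (hb' x x)) ?_
    refine Tendsto.mono_left ?_ hF
    have hd : ∀ n, a n (L x) (L x) - a n x x = ((n : ℂ) + 1)⁻¹ *
        (inner ℂ ((L ^ (n+1)) x) ((L ^ (n+1)) x) - inner ℂ x x) := by
      intro n
      simp only [a]
      rw [← mul_sub, ← Finset.sum_sub_distrib]
      congr 1
      have := Finset.sum_range_sub (fun k => inner ℂ ((L ^ k) x) ((L ^ k) x)) (n+1)
      simp only [pow_succ L, pow_zero] at this ⊢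
      exact this
    have hz : Tendsto (fun n : ℕ => (2 * (M ^ 2 * ‖x‖ * ‖x‖) + ‖x‖ ^ 2) * (1 / ((n : ℝ) + 1)))
        atTop (𝓝 0) := by
      simpa using (tendsto_one_div_add_atTop_nhds_zero_nat (𝕜 := ℝ)).const_mul
        (2 * (M ^ 2 * ‖x‖ * ‖x‖) + ‖x‖ ^ 2)
    refine squeeze_zero_norm (fun n => ?_) hz
    rw [hd, norm_mul, norm_inv, hnn, one_div, mul_comm]
    gcongr
    refine (norm_sub_le _ _).trans ?_
    have h1 := hin (n+1) x x
    have h2 := hin 0 x x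
    simp only [pow_zero, one_apply_eq_self] at h2
    nlinarith [sq_nonneg ‖x‖]
  obtain ⟨S, hS⟩ := exists_sqrt_equiv A hpos (M ^ 2)⁻¹ (by positivity)
    (fun x => by rw [hA]; exact hlb x)
  refine ⟨S, fun x => ?_⟩
  rw [← sq_eq_sq₀ (norm_nonneg _) (norm_nonneg _), hS, hS, hA, hA, hinv]

lemma sqrt_intertwine {E : Type} [NormedAddCommGroup E] [InnerProductSpace ℂ E] [CompleteSpace E]
    (X a b : E →L[ℂ] E) (ha : 0 ≤ a) (hb : 0 ≤ b) (h : X * (a * a) = (b * b) * X) :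
    X * a = b * X := by
  have sa : star a = a := (IsSelfAdjoint.of_nonneg ha).star_eq
  have sb : star b = b := (IsSelfAdjoint.of_nonneg hb).star_eq
  set Y := X * a - b * X with hY
  have h1 : b * Y = -(Y * a) := by
    rw [hY]; simp only [mul_sub, sub_mul, mul_assoc] at h ⊢
    rw [h]; abel
  have h1s : star Y * b = -(a * star Y) := by
    have := congrArg star h1
    simpa [sa, sb] using this
  have p1 : 0 ≤ star Y * b * Y := star_left_conjugate_nonneg hb Y
  have p2 : 0 ≤ star Y * Y := star_mul_self_nonneg Y
  have e1 : star Y * b * Y = -(star Y * Y * a) := by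
    rw [mul_assoc, h1, mul_neg, mul_assoc]
  have e2 : star Y * b * Y = -(a * (star Y * Y)) := by
    rw [h1s, neg_mul, mul_assoc]
  have hc : Commute (star Y * Y) a := by
    have := e1.symm.trans e2
    exact neg_injective this
  have p3 : 0 ≤ star Y * Y * a := hc.mul_nonneg p2 ha
  have z : star Y * Y * a = 0 := by
    apply le_antisymm _ p3
    rw [e1] at p1
    exact neg_nonneg.1 p1
  have z1 : Y * a = 0 := by
    have : star (Y * a) * (Y * a) = 0 := by
      rw [star_mul, mul_assoc, ← mul_assoc (star Y), z, mul_zero]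
    exact CStarRing.star_mul_self_eq_zero_iff _ |>.1 this
  have z2 : star Y * b = 0 := by
    have : star (Y * a) = 0 := by rw [z1, star_zero]
    rw [star_mul, sa] at this
    rw [h1s, this, neg_zero]
  have z3 : star Y * Y = star Y * X * a := by
    conv_lhs => rw [hY, mul_sub, ← mul_assoc, ← mul_assoc]
    rw [← hY, z2, zero_mul, sub_zero]
  have z4 : star Y * Y = a * (star X * Y) := by
    have := congrArg star z3
    simpa [sa] using this
  have z5 : Y * (star Y * Y) = 0 := by
    rw [z4, ← mul_assoc, z1, zero_mul]
  have z6 : star Y * Y = 0 := by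
    have : star (star Y * Y) * (star Y * Y) = 0 := by
      rw [star_mul, star_star, mul_assoc, z5, mul_zero]
    exact CStarRing.star_mul_self_eq_zero_iff _ |>.1 this
  have z7 : Y = 0 := CStarRing.star_mul_self_eq_zero_iff _ |>.1 z6
  exact sub_eq_zero.1 z7

lemma exists_root {E : Type} [NormedAddCommGroup E] [InnerProductSpace ℂ E] [CompleteSpace E]
    (a : E →L[ℂ] E) (ha : 0 ≤ a) : ∃ s : E →L[ℂ] E, 0 ≤ s ∧ s * s = a :=
  ⟨CFC.sqrt a, CFC.sqrt_nonneg _, CFC.sqrt_mul_sqrt_self _ ha⟩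

lemma exists_defects {E : Type} [NormedAddCommGroup E] [InnerProductSpace ℂ E] [CompleteSpace E]
    (C : E →L[ℂ] E) (hC : ‖C‖ ≤ 1) :
    ∃ D D' : E →L[ℂ] E, star D = D ∧ star D' = D' ∧ D * D = 1 - star C * C ∧
      D' * D' = 1 - C * star C ∧ D' * C = C * D ∧ star C * D' = D * star C := by
  have key : ∀ B : E →L[ℂ] E, ‖B‖ ≤ 1 → 0 ≤ 1 - star B * B := by
    intro B hB
    rw [sub_nonneg, ← CStarAlgebra.norm_le_one_iff_of_nonneg _ (star_mul_self_nonneg B),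
      CStarRing.norm_star_mul_self]
    exact mul_le_one₀ hB (norm_nonneg _) hB
  have k1 := key C hC
  have k2 : 0 ≤ 1 - C * star C := by
    have := key (star C) (by rwa [norm_star])
    rwa [star_star] at this
  obtain ⟨D, d0, s1⟩ := exists_root _ k1
  obtain ⟨D', d0', s2⟩ := exists_root _ k2
  refine ⟨D, D', (IsSelfAdjoint.of_nonneg d0).star_eq, (IsSelfAdjoint.of_nonneg d0').star_eq,
    s1, s2, ?_, ?_⟩
  · symm
    apply sqrt_intertwine _ _ _ d0 d0'
    rw [s1, s2, mul_sub, sub_mul, mul_one, one_mul, mul_assoc]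
  · apply sqrt_intertwine _ _ _ d0' d0
    rw [s1, s2, mul_sub, sub_mul, mul_one, one_mul, mul_assoc]

section dil
set_option linter.unusedSectionVars false
variable {H : Type} [NormedAddCommGroup H] [InnerProductSpace ℂ H] [CompleteSpace H]

/-- the bilateral shift by `m` -/
noncomputable def zShift (m : ℤ) :
    lp (fun _ : ℤ => H) 2 →ₗᵢ[ℂ] lp (fun _ : ℤ => H) 2 where
  toFun x := ⟨fun i => x (i + m), by
    have h := lp.memℓp x
    change Memℓp (fun i => x (i + m)) 2
    rw [memℓp_gen_iff (by simp)] at h ⊢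
    exact (Equiv.addRight m).summable_iff.2 h⟩
  map_add' x y := by ext i; rfl
  map_smul' c x := by ext i; rfl
  norm_map' x := by
    change ‖(_ : lp (fun _ : ℤ => H) 2)‖ = _
    rw [lp.norm_eq_tsum_rpow (by simp), lp.norm_eq_tsum_rpow (by simp)]
    congr 1
    exact (Equiv.addRight m).tsum_eq (fun i => ‖x i‖ ^ _)

lemma zShift_apply (m : ℤ) (x : lp (fun _ : ℤ => H) 2) (i : ℤ) : zShift m x i = x (i + m) := rfl

/-- two-coordinate block operator -/
noncomputable def blk (a b c d : H →L[ℂ] H) :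
    lp (fun _ : ℤ => H) 2 →ₗ[ℂ] lp (fun _ : ℤ => H) 2 where
  toFun x := x + lp.single 2 (-1) (a (x (-1)) + b (x 0) - x (-1)) +
    lp.single 2 0 (c (x (-1)) + d (x 0) - x 0)
  map_add' x y := by
    simp only [lp.coeFn_add, Pi.add_apply, map_add, lp.single_add, lp.single_sub]; abel
  map_smul' r x := by
    simp only [lp.coeFn_smul, Pi.smul_apply, map_smul, lp.single_add, lp.single_sub,
      lp.single_smul, RingHom.id_apply, smul_add, smul_sub]

lemma blk_neg (a b c d : H →L[ℂ] H) (x : lp (fun _ : ℤ => H) 2) :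
    blk a b c d x (-1) = a (x (-1)) + b (x 0) := by
  simp [blk]

lemma blk_zero (a b c d : H →L[ℂ] H) (x : lp (fun _ : ℤ => H) 2) :
    blk a b c d x 0 = c (x (-1)) + d (x 0) := by
  simp [blk]

lemma blk_other (a b c d : H →L[ℂ] H) (x : lp (fun _ : ℤ => H) 2) (i : ℤ) (h1 : i ≠ -1)
    (h0 : i ≠ 0) : blk a b c d x i = x i := by
  simp [blk, h1, h0]

lemma blk_blk (a b c d a' b' c' d' : H →L[ℂ] H)
    (h1 : a' * a + b' * c = 1) (h2 : a' * b + b' * d = 0)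
    (h3 : c' * a + d' * c = 0) (h4 : c' * b + d' * d = 1) (x : lp (fun _ : ℤ => H) 2) :
    blk a' b' c' d' (blk a b c d x) = x := by
  have e1 := fun v => DFunLike.congr_fun h1 v
  have e2 := fun v => DFunLike.congr_fun h2 v
  have e3 := fun v => DFunLike.congr_fun h3 v
  have e4 := fun v => DFunLike.congr_fun h4 v
  simp only [add_apply, mul_apply_eq_comp,
    one_apply_eq_self, zero_apply] at e1 e2 e3 e4
  ext i
  by_cases i1 : i = -1
  · subst i1
    rw [blk_neg, blk_neg, blk_zero]
    simp only [map_add]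
    rw [add_add_add_comm, e1, e2, add_zero]
  by_cases i0 : i = 0
  · subst i0
    rw [blk_zero, blk_neg, blk_zero]
    simp only [map_add]
    rw [add_add_add_comm, e3, e4, zero_add]
  rw [blk_other _ _ _ _ _ _ i1 i0, blk_other _ _ _ _ _ _ i1 i0]

lemma blk_inner (a b c d : H →L[ℂ] H) (x y : lp (fun _ : ℤ => H) 2) :
    inner ℂ (blk a b c d x) y = inner ℂ x (blk (star a) (star c) (star b) (star d) y) := by
  simp only [blk, LinearMap.coe_mk, AddHom.coe_mk, inner_add_left, inner_add_right,
    lp.inner_single_left, lp.inner_single_right, inner_sub_left, inner_sub_right,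
    ContinuousLinearMap.star_eq_adjoint, ContinuousLinearMap.adjoint_inner_right]
  ring

lemma exists_dilation (C : H →L[ℂ] H) (hC : ‖C‖ ≤ 1) :
    ∃ U : lp (fun _ : ℤ => H) 2 ≃L[ℂ] lp (fun _ : ℤ => H) 2, (∀ x, ‖U x‖ = ‖x‖) ∧
      (∀ x : lp (fun _ : ℤ => H) 2, (∀ i < 0, x i = 0) →
        (∀ i < 0, U x i = 0) ∧ U x 0 = C (x 0)) := by
  obtain ⟨D, D', hD, hD', h1, h2, h3, h4⟩ := exists_defects C hC
  have hR : ∀ x, blk D' (-C) (star C) D (blk D' C (-star C) D x) = x := by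
    refine blk_blk _ _ _ _ _ _ _ _ ?_ ?_ ?_ ?_
    · rw [h2]; noncomm_ring
    · rw [h3]; noncomm_ring
    · rw [h4]; noncomm_ring
    · rw [h1]; noncomm_ring
  have hR' : ∀ x, blk D' C (-star C) D (blk D' (-C) (star C) D x) = x := by
    refine blk_blk _ _ _ _ _ _ _ _ ?_ ?_ ?_ ?_
    · rw [h2]; noncomm_ring
    · rw [mul_neg, h3]; abel
    · rw [neg_mul, h4]; abel
    · rw [h1]; noncomm_ring
  have hn : ∀ x : lp (fun _ : ℤ => H) 2, ‖blk D' C (-star C) D x‖ = ‖x‖ := by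
    intro x
    rw [← sq_eq_sq₀ (norm_nonneg _) (norm_nonneg _), ← inner_self_eq_norm_sq (𝕜 := ℂ),
      ← inner_self_eq_norm_sq (𝕜 := ℂ), blk_inner, hD, hD', star_neg, star_star, hR]
  let e : lp (fun _ : ℤ => H) 2 ≃ₗ[ℂ] lp (fun _ : ℤ => H) 2 :=
    LinearEquiv.ofLinearMap ((zShift (-1)).toLinearMap.comp (blk D' C (-star C) D))
      ((blk D' (-C) (star C) D).comp (zShift 1).toLinearMap)
      (by
        ext1 x
        change zShift (-1) (blk D' C (-star C) D (blk D' (-C) (star C) D (zShift 1 x))) = x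
        rw [hR']
        ext i
        simp [zShift_apply])
      (by
        ext1 x
        change (blk D' (-C) (star C) D (zShift 1 (zShift (-1) (blk D' C (-star C) D x)))) = x
        conv_rhs => rw [← hR x]
        congr 1
        ext i
        simp [zShift_apply])
  have he : ∀ x, e x = zShift (-1) (blk D' C (-star C) D x) := fun x => rfl
  let e' : lp (fun _ : ℤ => H) 2 ≃ₗᵢ[ℂ] lp (fun _ : ℤ => H) 2 :=
    ⟨e, fun x => by rw [he, LinearIsometry.norm_map, hn]⟩
  refine ⟨e'.toContinuousLinearEquiv, fun x => e'.norm_map x, fun x hx => ⟨fun i hi => ?_, ?_⟩⟩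
  · change e x i = 0
    rw [he, zShift_apply, blk_other _ _ _ _ _ _ (by omega) (by omega), hx _ (by omega)]
  · change e x 0 = _
    rw [he, zShift_apply, zero_add, blk_neg, hx (-1) (by omega)]
    simp
end dil

/-- a bounded operator `T` on a complex Hilbert space `H` admits a loose
dilation (through a complex Hilbert space `K`, with `J, Q` bounded, `U` invertible and
`(U^n)_{n ∈ ℤ}` bounded, `T^n = Q U^n J` for `n ≥ 0`) if and only if `T` is similar to a
contraction. -/
theorem stmt_13 {H : Type} [NormedAddCommGroup H] [InnerProductSpace ℂ H] [CompleteSpace H]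
    (T : H →L[ℂ] H) :
    (∃ (K : Type) (_ : NormedAddCommGroup K) (_ : InnerProductSpace ℂ K) (_ : CompleteSpace K)
      (J : H →L[ℂ] K) (Q : K →L[ℂ] H) (U : K ≃L[ℂ] K),
        (∃ M : ℝ, ∀ n : ℤ, ‖(U ^ n).toContinuousLinearMap‖ ≤ M) ∧
        ∀ n : ℕ, (T ^ n) = Q.comp (((U ^ (n : ℤ)).toContinuousLinearMap).comp J)) ↔
    (∃ V : H ≃L[ℂ] H,
      ‖(V.symm.toContinuousLinearMap.comp T).comp V.toContinuousLinearMap‖ ≤ 1) := by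
  constructor
  · rintro ⟨K, _, _, _, J, Q, U, ⟨M, hM⟩, h⟩
    have hp : ∀ (n : ℕ) x, (U ^ n) x = ((U : K →L[ℂ] K) ^ n) x := by
      intro n
      induction n with
      | zero => intro x; rfl
      | succ n ih => intro x; rw [pow_succ, pow_succ]; exact ih (U x)
    have hM' : ∀ (n : ℤ) x, ‖(U ^ n) x‖ ≤ max M 1 * ‖x‖ := fun n x =>
      ((U ^ n).toContinuousLinearMap.le_opNorm x).trans (by
        gcongr
        exact (hM n).trans (le_max_left _ _))
    obtain ⟨S, hS⟩ := power_bounded_case (U : K →L[ℂ] K) (max M 1) (by positivity)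
      (fun n x => by
        have := hM' n x
        rwa [zpow_natCast, hp] at this)
      (fun n x => by
        have := hM' (-n) ((U ^ n) x)
        rw [zpow_neg, zpow_natCast, ← hp] at *
        have e : ((U ^ n)⁻¹) ((U ^ n) x) = x := (U ^ n).symm_apply_apply x
        rwa [e] at this)
    let W : K →L[ℂ] K := (S : K →L[ℂ] K).comp ((U : K →L[ℂ] K).comp (S.symm : K →L[ℂ] K))
    have hW : ∀ (n : ℕ) x, (W ^ n) (S x) = S (((U : K →L[ℂ] K) ^ n) x) := by
      intro n
      induction n with
      | zero => intro x; rfl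
      | succ n ih =>
        intro x
        rw [pow_succ, pow_succ]
        change (W ^ n) (W (S x)) = S (((U : K →L[ℂ] K) ^ n) (U x))
        rw [← ih]
        simp [W]
    obtain ⟨V, hV⟩ := contraction_case T ((S : K →L[ℂ] K).comp J)
      (Q.comp (S.symm : K →L[ℂ] K)) W
      (fun x => by
        have := hS (S.symm x)
        rw [S.apply_symm_apply] at this
        exact this.le)
      (fun n x => by
        rw [h n, zpow_natCast]
        change Q ((U ^ n) (J x)) = Q (S.symm ((W ^ n) (S (J x))))
        rw [hW, S.symm_apply_apply, hp])
    refine ⟨V, ContinuousLinearMap.opNorm_le_bound _ zero_le_one fun x => ?_⟩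
    rw [one_mul]
    exact hV x
  · rintro ⟨V, hV⟩
    obtain ⟨U, hU, hU'⟩ := exists_dilation _ hV
    have hn : ∀ (n : ℕ) x, ‖(U ^ n) x‖ = ‖x‖ := by
      intro n
      induction n with
      | zero => intro x; rfl
      | succ n ih => intro x; rw [pow_succ]; exact (ih (U x)).trans (hU x)
    refine ⟨lp (fun _ : ℤ => H) 2, inferInstance, inferInstance, inferInstance,
      (lp.singleContinuousLinearMap ℂ (fun _ : ℤ => H) 2 0).comp (V.symm : H →L[ℂ] H),
      (V : H →L[ℂ] H).comp (lp.evalCLM ℂ (fun _ : ℤ => H) 2 0), U, ⟨1, fun n => ?_⟩, fun n => ?_⟩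
    · refine ContinuousLinearMap.opNorm_le_bound _ zero_le_one fun x => ?_
      rw [one_mul]
      obtain ⟨k, rfl | rfl⟩ := n.eq_nat_or_neg
      · rw [zpow_natCast]
        exact (hn k x).le
      · rw [zpow_neg, zpow_natCast]
        have := hn k ((U ^ k).symm x)
        rw [ContinuousLinearEquiv.apply_symm_apply] at this
        exact this.symm.le
    · have key : ∀ (n : ℕ) (x : lp (fun _ : ℤ => H) 2), (∀ i < 0, x i = 0) →
          V ((U ^ n) x 0) = (T ^ n) (V (x 0)) := by
        intro n
        induction n with
        | zero => intro x _; rfl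
        | succ n ih =>
          intro x hx
          obtain ⟨h1, h2⟩ := hU' x hx
          rw [pow_succ, pow_succ]
          refine (ih (U x) h1).trans ?_
          rw [h2]
          simp
      ext x
      rw [zpow_natCast]
      have := key n (lp.single 2 0 (V.symm x)) (fun i hi => by
        rw [lp.single_apply_ne _ _ _ hi.ne])
      rw [lp.single_apply_self, V.apply_symm_apply] at this
      exact this.symm
end

section
/- Let 1 < p < ∞. There exists a bounded operator T : L^p([0,1]) → L^p([0,1]) (with Lebesgue measure) which is p-polynomially bounded but is not p-completely polynomially bounded. -/
open MeasureTheory Polynomial unitInterval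
open scoped ENNReal

/-- The map `k ↦ k - 1` preserves the counting measure on `ℤ`. -/
theorem shift_measurePreserving :
    MeasurePreserving (fun k : ℤ => k - 1) Measure.count Measure.count := by
  constructor
  · exact Measurable.of_discrete
  · ext s hs
    rw [Measure.map_apply Measurable.of_discrete hs]
    have h : (fun k : ℤ => k - 1) ⁻¹' s = (fun k : ℤ => k + 1) '' s := by
      ext k
      constructor
      · intro hk; exact ⟨k - 1, hk, by ring⟩
      · rintro ⟨a, ha, rfl⟩; simpa using ha
    rw [h, Measure.count_injective_image (fun a b hab => by simpa using hab)]

/-- The shift operator `S` on `ℓ^p(ℤ)`, realized as `L^p` of the counting measure on `ℤ`: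
`(S t) k = t (k - 1)`. -/
noncomputable def shiftOp (P : ℝ≥0∞) [Fact (1 ≤ P)] :
    Lp ℂ P (Measure.count : Measure ℤ) →L[ℂ] Lp ℂ P (Measure.count : Measure ℤ) :=
  (Lp.compMeasurePreservingₗᵢ ℂ (fun k : ℤ => k - 1) shift_measurePreserving).toContinuousLinearMap

/-- The block operator on `ℓ^p_n(X)` associated to a matrix `[M_{ij}]` of bounded operators
on `X`: `(x_j)_j ↦ (∑_j M_{ij} x_j)_i`. -/
noncomputable def blockCLM {X : Type*} [NormedAddCommGroup X] [NormedSpace ℂ X]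
    (P : ℝ≥0∞) [Fact (1 ≤ P)] {n : ℕ} (M : Fin n → Fin n → (X →L[ℂ] X)) :
    PiLp P (fun _ : Fin n => X) →L[ℂ] PiLp P (fun _ : Fin n => X) :=
  ((PiLp.continuousLinearEquiv P ℂ (fun _ : Fin n => X)).symm.toContinuousLinearMap).comp
    ((ContinuousLinearMap.pi fun i => ∑ j, (M i j).comp (ContinuousLinearMap.proj j)).comp
      (PiLp.continuousLinearEquiv P ℂ (fun _ : Fin n => X)).toContinuousLinearMap)

noncomputable def nsq (p : ℂ[X]) : ℝ := ∑ i ∈ p.support, ‖p.coeff i‖ ^ 2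

lemma nsq_nonneg (p : ℂ[X]) : 0 ≤ nsq p := Finset.sum_nonneg fun _ _ => by positivity

lemma sum_le_nsq (p : ℂ[X]) (s : Finset ℕ) : ∑ i ∈ s, ‖p.coeff i‖ ^ 2 ≤ nsq p := by
  classical
  calc ∑ i ∈ s, ‖p.coeff i‖ ^ 2 ≤ ∑ i ∈ s ∪ p.support, ‖p.coeff i‖ ^ 2 :=
        Finset.sum_le_sum_of_subset_of_nonneg Finset.subset_union_left (fun _ _ _ => by positivity)
    _ = nsq p := by
        symm
        apply Finset.sum_subset Finset.subset_union_right
        intro x _ hx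
        simp at hx
        simp [hx]

lemma sum_nsq_le {α β : Type*} (s : Finset α) (P : α → ℂ[X]) (t : Finset β) (R : β → ℂ[X])
    (M e : ℝ) (h : ∀ z : ℂ, ‖z‖ = 1 →
      ∑ i ∈ s, ‖(P i).eval z‖ ^ 2 ≤ M * ∑ i ∈ t, ‖(R i).eval z‖ ^ 2 + e) :
    ∑ i ∈ s, nsq (P i) ≤ M * ∑ i ∈ t, nsq (R i) + e := by
  have hci : ∀ p : ℂ[X], CircleIntegrable (fun z => ‖p.eval z‖ ^ 2) 0 1 := fun p =>
    ContinuousOn.circleIntegrable zero_le_one (by fun_prop)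
  have e1 : ∑ i ∈ s, nsq (P i) = Real.circleAverage (fun z => ∑ i ∈ s, ‖(P i).eval z‖ ^ 2) 0 1 := by
    rw [Real.circleAverage_fun_sum (fun i _ => hci _)]
    exact Finset.sum_congr rfl fun i _ => sum_sq_norm_coeff_eq_circleAverage _
  have e2 : M * ∑ i ∈ t, nsq (R i) + e =
      Real.circleAverage (fun z => M * ∑ i ∈ t, ‖(R i).eval z‖ ^ 2 + e) 0 1 := by
    have h1 : Real.circleAverage (fun z => M * ∑ i ∈ t, ‖(R i).eval z‖ ^ 2 + e) 0 1
        = Real.circleAverage (fun z => M • ∑ i ∈ t, ‖(R i).eval z‖ ^ 2) 0 1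
          + Real.circleAverage (fun _ : ℂ => e) 0 1 := by
      rw [← Real.circleAverage_fun_add]
      · rfl
      · exact ContinuousOn.circleIntegrable zero_le_one (by fun_prop)
      · exact ContinuousOn.circleIntegrable zero_le_one (by fun_prop)
    rw [h1, Real.circleAverage_fun_smul, Real.circleAverage_fun_sum (fun i _ => hci _),
      Real.circleAverage_const, smul_eq_mul]
    congr 2
    exact Finset.sum_congr rfl fun i _ => sum_sq_norm_coeff_eq_circleAverage _
  rw [e1, e2]
  apply Real.circleAverage_mono
  · exact ContinuousOn.circleIntegrable zero_le_one (by fun_prop)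
  · exact ContinuousOn.circleIntegrable zero_le_one (by fun_prop)
  · intro z hz
    apply h
    simpa using hz

lemma nsq_mul_le (φ a : ℂ[X]) (B : ℝ) (hB : ∀ z : ℂ, ‖z‖ = 1 → ‖φ.eval z‖ ≤ B) :
    nsq (φ * a) ≤ B ^ 2 * nsq a := by
  have := sum_nsq_le {()} (fun _ => φ * a) {()} (fun _ => a) (B ^ 2) 0 (by
    intro z hz
    simp only [Finset.sum_singleton, eval_mul, norm_mul, mul_pow, add_zero]
    gcongr
    exact hB z hz)
  simpa using this

lemma norm_coeff_le (p : ℂ[X]) (B : ℝ) (hB : ∀ z : ℂ, ‖z‖ = 1 → ‖p.eval z‖ ≤ B) (k : ℕ) :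
    ‖p.coeff k‖ ≤ B := by
  have hB0 : 0 ≤ B := (norm_nonneg _).trans (hB 1 (by simp))
  have := sum_nsq_le {()} (fun _ => p) (∅ : Finset Unit) (fun _ => p) 0 (B ^ 2) (by
    intro z hz
    simp only [Finset.sum_singleton, zero_mul, zero_add]
    gcongr
    exact hB z hz)
  have h2 := sum_le_nsq p {k}
  simp at this h2
  exact abs_le_of_sq_le_sq' (h2.trans this) hB0 |>.2

lemma geom_aux (i n : ℕ) :
    ((i ≤ 2 ^ n → ∑ l ∈ Finset.range n, (if i ≤ 2 ^ l then ((i : ℝ) / 2 ^ l) ^ 2 else 0)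
      ≤ 2 - 2 * ((i : ℝ) / 2 ^ n) ^ 2) ∧
    (2 ^ n < i → ∑ l ∈ Finset.range n, (if i ≤ 2 ^ l then ((i : ℝ) / 2 ^ l) ^ 2 else 0) = 0)) := by
  induction n with
  | zero =>
    constructor
    · intro h
      have : (i : ℝ) ≤ 1 := by exact_mod_cast h
      have h0 : (0 : ℝ) ≤ i := by positivity
      simp
      nlinarith
    · simp
  | succ n ih =>
    rw [Finset.sum_range_succ]
    have e : (i : ℝ) / 2 ^ (n + 1) = (i : ℝ) / 2 ^ n / 2 := by rw [pow_succ]; field_simp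
    constructor
    · intro h
      by_cases h1 : i ≤ 2 ^ n
      · have := ih.1 h1
        rw [if_pos h1, e]
        nlinarith [sq_nonneg ((i : ℝ) / 2 ^ n)]
      · rw [if_neg h1, ih.2 (by omega)]
        have : (i : ℝ) / 2 ^ (n + 1) ≤ 1 := by
          rw [div_le_one (by positivity)]
          exact_mod_cast h
        have h0 : 0 ≤ (i : ℝ) / 2 ^ (n + 1) := by positivity
        nlinarith
    · intro h
      have h1 : 2 ^ n < i := lt_of_le_of_lt (Nat.pow_le_pow_right (by norm_num) (Nat.le_succ n)) h
      rw [if_neg (by omega), ih.2 h1, add_zero]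

lemma dyadic_geom_le (i n : ℕ) :
    ∑ l ∈ Finset.range n, (if i ≤ 2 ^ l then ((i : ℝ) / 2 ^ l) ^ 2 else 0) ≤ 2 := by
  rcases le_or_gt i (2 ^ n) with h | h
  · have := (geom_aux i n).1 h
    nlinarith [sq_nonneg ((i : ℝ) / 2 ^ n)]
  · rw [(geom_aux i n).2 h]; norm_num

lemma coeff_X_deriv (a : ℂ[X]) (i : ℕ) : (X * derivative a).coeff i = i * a.coeff i := by
  cases i with
  | zero => simp
  | succ i => rw [coeff_X_mul, coeff_derivative]; push_cast; ring

lemma norm_sum_mul_sq_le {α : Type*} (s : Finset α) (f g : α → ℂ) :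
    ‖∑ i ∈ s, f i * g i‖ ^ 2 ≤ (∑ i ∈ s, ‖f i‖ ^ 2) * ∑ i ∈ s, ‖g i‖ ^ 2 := by
  calc ‖∑ i ∈ s, f i * g i‖ ^ 2 ≤ (∑ i ∈ s, ‖f i‖ * ‖g i‖) ^ 2 := by
        gcongr
        exact (norm_sum_le _ _).trans (by simp)
    _ ≤ _ := Finset.sum_mul_sq_le_sq_mul_sq _ _ _

lemma keyK (n : ℕ) (a : ℂ[X]) (w : ℕ → ℂ[X]) :
    ‖∑ l ∈ Finset.range n, ((2 : ℂ) ^ l)⁻¹ * (X * derivative a * w l).coeff (2 ^ l)‖ ^ 2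
      ≤ 2 * nsq a * ∑ l ∈ Finset.range n, nsq (w l) := by
  set N := 2 ^ n + 1 with hN
  have e1 : ∀ l ∈ Finset.range n, ((2 : ℂ) ^ l)⁻¹ * (X * derivative a * w l).coeff (2 ^ l) =
      ∑ i ∈ Finset.range N, a.coeff i *
        (if i ≤ 2 ^ l then ((i : ℂ) / 2 ^ l) * (w l).coeff (2 ^ l - i) else 0) := by
    intro l hl
    rw [coeff_mul, Finset.Nat.sum_antidiagonal_eq_sum_range_succ_mk, Finset.mul_sum]
    have hsub : Finset.range (2 ^ l + 1) ⊆ Finset.range N := by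
      apply Finset.range_mono
      have := Nat.pow_le_pow_right (n := 2) (by norm_num) (Finset.mem_range.1 hl).le
      omega
    rw [← Finset.sum_subset hsub]
    · apply Finset.sum_congr rfl
      intro i hi
      rw [if_pos (by simpa [Nat.lt_succ_iff] using hi)]
      simp only [coeff_X_deriv]
      field_simp
    · intro i _ hi
      rw [if_neg (by simpa [Nat.lt_succ_iff] using hi), mul_zero]
  rw [Finset.sum_congr rfl e1, Finset.sum_comm]
  simp_rw [← Finset.mul_sum]
  refine (norm_sum_mul_sq_le _ _ _).trans ?_
  have e2 : ∀ i : ℕ, ‖∑ l ∈ Finset.range n,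
      (if i ≤ 2 ^ l then ((i : ℂ) / 2 ^ l) * (w l).coeff (2 ^ l - i) else 0)‖ ^ 2 ≤
      2 * ∑ l ∈ Finset.range n, (if i ≤ 2 ^ l then ‖(w l).coeff (2 ^ l - i)‖ ^ 2 else 0) := by
    intro i
    have := norm_sum_mul_sq_le (Finset.range n)
      (fun l => if i ≤ 2 ^ l then ((i : ℂ) / 2 ^ l) else 0)
      (fun l => if i ≤ 2 ^ l then (w l).coeff (2 ^ l - i) else 0)
    calc _ = ‖∑ l ∈ Finset.range n, (if i ≤ 2 ^ l then ((i : ℂ) / 2 ^ l) else 0) *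
          (if i ≤ 2 ^ l then (w l).coeff (2 ^ l - i) else 0)‖ ^ 2 := by
            congr 2
            apply Finset.sum_congr rfl
            intro l _
            split_ifs <;> simp
      _ ≤ _ := this
      _ = (∑ l ∈ Finset.range n, (if i ≤ 2 ^ l then ((i : ℝ) / 2 ^ l) ^ 2 else 0)) *
          ∑ l ∈ Finset.range n, (if i ≤ 2 ^ l then ‖(w l).coeff (2 ^ l - i)‖ ^ 2 else 0) := by
            congr 1
            · apply Finset.sum_congr rfl
              intro l _
              split_ifs <;> simp
            · apply Finset.sum_congr rfl
              intro l _
              split_ifs <;> simp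
      _ ≤ _ := by
        gcongr
        exact dyadic_geom_le i n
  have e3 : ∑ i ∈ Finset.range N, ‖∑ l ∈ Finset.range n,
      (if i ≤ 2 ^ l then ((i : ℂ) / 2 ^ l) * (w l).coeff (2 ^ l - i) else 0)‖ ^ 2 ≤
      2 * ∑ l ∈ Finset.range n, nsq (w l) := by
    refine (Finset.sum_le_sum fun i _ => e2 i).trans ?_
    rw [← Finset.mul_sum, Finset.sum_comm]
    gcongr with l hl
    rw [← Finset.sum_filter]
    calc ∑ i ∈ (Finset.range N).filter (fun i => i ≤ 2 ^ l), ‖(w l).coeff (2 ^ l - i)‖ ^ 2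
        = ∑ j ∈ ((Finset.range N).filter (fun i => i ≤ 2 ^ l)).image (fun i => 2 ^ l - i),
            ‖(w l).coeff j‖ ^ 2 := by
          rw [Finset.sum_image]
          intro x hx y hy hxy
          simp at hx hy hxy
          omega
      _ ≤ _ := sum_le_nsq _ _
  calc _ ≤ nsq a * (2 * ∑ l ∈ Finset.range n, nsq (w l)) := by
        gcongr
        · exact nsq_nonneg a
        · exact sum_le_nsq _ _
    _ = _ := by ring

/-- real parts of trigonometric polynomials are real parts of analytic polynomials -/
lemma re_trig (g : C(AddCircle (2 * Real.pi), ℂ))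
    (hg : g ∈ Submodule.span ℂ (Set.range (@fourier (2 * Real.pi)))) :
    ∀ c : ℂ, ∃ q : ℂ[X], ∀ t, (c * g t).re = (q.eval (AddCircle.toCircle t : ℂ)).re := by
  induction hg using Submodule.span_induction with
  | mem x hx =>
    obtain ⟨n, rfl⟩ := hx
    intro c
    rcases Int.eq_nat_or_neg n with ⟨k, rfl | rfl⟩
    · refine ⟨C c * X ^ k, fun t => ?_⟩
      simp [fourier_apply, AddCircle.toCircle_nsmul]
    · refine ⟨C (star c) * X ^ k, fun t => ?_⟩
      rw [fourier_neg, ← Complex.conj_re]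
      simp [fourier_apply, AddCircle.toCircle_nsmul]
  | zero => exact fun c => ⟨0, by simp⟩
  | add x y _ _ hx hy =>
    intro c
    obtain ⟨q, hq⟩ := hx c
    obtain ⟨r, hr⟩ := hy c
    refine ⟨q + r, fun t => ?_⟩
    simp [mul_add, ← hq, ← hr]
  | smul a x _ hx =>
    intro c
    obtain ⟨q, hq⟩ := hx (c * a)
    refine ⟨q, fun t => ?_⟩
    rw [← hq]
    simp [mul_assoc]

lemma exists_re_approx (h : ℂ → ℝ) (hc : Continuous h) (η : ℝ) (hη : 0 < η) :
    ∃ q : ℂ[X], ∀ z : ℂ, ‖z‖ = 1 → |(q.eval z).re - h z| ≤ η := by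
  have : Fact (0 < 2 * Real.pi) := ⟨Real.two_pi_pos⟩
  let H : C(AddCircle (2 * Real.pi), ℂ) :=
    ⟨fun t => (h (AddCircle.toCircle t : ℂ) : ℂ), by
      have := AddCircle.continuous_toCircle (T := 2 * Real.pi)
      fun_prop⟩
  have hH : H ∈ (Submodule.span ℂ (Set.range (@fourier (2 * Real.pi)))).topologicalClosure := by
    rw [span_fourier_closure_eq_top]; trivial
  obtain ⟨g, hg, hd⟩ := Metric.mem_closure_iff.1 hH η hη
  obtain ⟨q, hq⟩ := re_trig g hg 1
  refine ⟨q, fun z hz => ?_⟩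
  obtain ⟨t, ht⟩ := (AddCircle.homeomorphCircle (T := 2 * Real.pi) (by positivity)).surjective
    ⟨z, by simpa [Submonoid.unitSphere] using hz⟩
  rw [AddCircle.homeomorphCircle_apply] at ht
  have hzt : (AddCircle.toCircle t : ℂ) = z := by rw [ht]
  have h1 := (ContinuousMap.dist_apply_le_dist (f := H) (g := g) t).trans hd.le
  rw [← hzt, ← hq t, one_mul]
  have h2 : (g t).re - h (AddCircle.toCircle t : ℂ) = (g t - H t).re := by simp [H]
  rw [h2]
  refine (Complex.abs_re_le_norm _).trans ?_
  rwa [dist_comm, dist_eq_norm] at h1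

lemma hasSum_exp_real (R : ℝ) : HasSum (fun k : ℕ => R ^ k / k.factorial) (Real.exp R) := by
  rw [Real.exp_eq_exp_ℝ]; exact NormedSpace.expSeries_div_hasSum_exp R

lemma hasSum_exp_complex (R : ℂ) :
    HasSum (fun k : ℕ => R ^ k / k.factorial) (Complex.exp R) := by
  rw [Complex.exp_eq_exp_ℂ]; exact NormedSpace.expSeries_div_hasSum_exp R

lemma exists_exp_approx (q : ℂ[X]) (η : ℝ) (hη : 0 < η) :
    ∃ f : ℂ[X], ∀ z : ℂ, ‖z‖ = 1 → ‖f.eval z - Complex.exp (q.eval z)‖ ≤ η := by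
  obtain ⟨R, hR⟩ := (isCompact_sphere (0 : ℂ) 1).exists_bound_of_continuousOn
    (f := fun z => q.eval z) (by fun_prop)
  have h0 : Filter.Tendsto (fun K : ℕ => ∑ k ∈ Finset.range K, R ^ k / k.factorial) Filter.atTop
      (nhds (Real.exp R)) := by
    have := hasSum_exp_real R
    exact this.tendsto_sum_nat
  obtain ⟨K, hK⟩ := (Metric.tendsto_atTop.1 h0 η hη)
  refine ⟨∑ k ∈ Finset.range K, C ((k.factorial : ℂ)⁻¹) * q ^ k, fun z hz => ?_⟩
  have hz' := hR z (by simpa using hz)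
  have hs := hasSum_exp_complex (q.eval z)
  have hsR := hasSum_exp_real R
  have e1 : Complex.exp (q.eval z) - ∑ k ∈ Finset.range K, (q.eval z) ^ k / k.factorial
      = ∑' k, (q.eval z) ^ (k + K) / (k + K).factorial := by
    rw [← hs.tsum_eq, ← hs.summable.sum_add_tsum_nat_add K]
    ring
  have e2 : Real.exp R - ∑ k ∈ Finset.range K, R ^ k / k.factorial
      = ∑' k, R ^ (k + K) / (k + K).factorial := by
    rw [← hsR.tsum_eq, ← hsR.summable.sum_add_tsum_nat_add K]
    ring
  have e3 : (∑ k ∈ Finset.range K, C ((k.factorial : ℂ)⁻¹) * q ^ k).eval z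
      = ∑ k ∈ Finset.range K, (q.eval z) ^ k / k.factorial := by
    simp [eval_finsetSum, div_eq_inv_mul]
  rw [norm_sub_rev, e3, e1]
  have sR : Summable fun k => R ^ (k + K) / ((k + K).factorial : ℝ) :=
    (summable_nat_add_iff K).2 hsR.summable
  refine (tsum_of_norm_bounded sR.hasSum fun k => ?_).trans ?_
  · rw [norm_div, norm_pow, Complex.norm_natCast]
    gcongr
  · rw [← e2]
    have := hK K le_rfl
    rw [Real.dist_eq, abs_lt] at this
    linarith

lemma outer_factor {ι : Type*} [Fintype ι] (P : ι → ℂ[X]) (ε : ℝ) (hε : 0 < ε) :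
    ∃ f v : ℂ[X], ∀ z : ℂ, ‖z‖ = 1 →
      ‖f.eval z‖ ^ 2 ≤ ∑ b, ‖(P b).eval z‖ ^ 2 + ε ∧
      ‖v.eval z‖ ^ 2 * ∑ b, ‖(P b).eval z‖ ^ 2 ≤ 1 + ε ∧
      ‖1 - f.eval z * v.eval z‖ ≤ ε := by
  set G : ℂ → ℝ := fun z => ∑ b, ‖(P b).eval z‖ ^ 2 with hG
  have hGc : Continuous G := by fun_prop
  have hG0 : ∀ z, 0 ≤ G z := fun z => Finset.sum_nonneg fun _ _ => by positivity
  obtain ⟨R, hR⟩ := (isCompact_sphere (0 : ℂ) 1).exists_bound_of_continuousOn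
    (f := G) hGc.continuousOn
  have hR' : ∀ z : ℂ, ‖z‖ = 1 → G z ≤ R := fun z hz =>
    (le_abs_self _).trans (hR z (by simpa using hz))
  have hR0 : 0 ≤ R := (hG0 1).trans (hR' 1 (by simp))
  -- choose exact exponent
  have key : ∃ q : ℂ[X], ∀ z : ℂ, ‖z‖ = 1 →
      ‖Complex.exp (q.eval z)‖ ^ 2 ≤ G z + ε / 2 ∧
      ‖Complex.exp (-(q.eval z))‖ ^ 2 * G z ≤ 1 := by
    obtain ⟨η, hη, hη'⟩ : ∃ η > 0, Real.exp (4 * η) * (R + ε / 4) ≤ (R + ε / 4) + ε / 4 := by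
      have : Filter.Tendsto (fun η : ℝ => Real.exp (4 * η) * (R + ε / 4)) (nhdsWithin 0 (Set.Ioi 0))
          (nhds (Real.exp (4 * 0) * (R + ε / 4))) := by
        apply Filter.Tendsto.mono_left _ nhdsWithin_le_nhds
        apply Continuous.tendsto
        fun_prop
      have h2 := this.eventually (eventually_le_nhds (b := (R + ε / 4) + ε / 4) (by
        rw [mul_zero, Real.exp_zero, one_mul]; linarith))
      obtain ⟨η, h3, h4⟩ := (h2.and self_mem_nhdsWithin).exists
      exact ⟨η, h4, h3⟩
    have hpos : ∀ z, 0 < G z + ε / 4 := fun z => by have := hG0 z; linarith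
    obtain ⟨q, hq⟩ := exists_re_approx (fun z => Real.log (G z + ε / 4) / 2 + η)
      (by
        have := hGc.add (continuous_const (y := ε / 4))
        exact (((this.log fun z => (hpos z).ne').div_const 2).add continuous_const)) η hη
    refine ⟨q, fun z hz => ?_⟩
    have h1 := abs_le.1 (hq z hz)
    have hl : Real.exp (Real.log (G z + ε / 4)) = G z + ε / 4 := Real.exp_log (hpos z)
    constructor
    · rw [Complex.norm_exp, ← Real.exp_nat_mul]
      calc Real.exp ((2 : ℕ) * (q.eval z).re) ≤ Real.exp (4 * η + Real.log (G z + ε / 4)) := by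
            gcongr; push_cast; linarith
        _ = Real.exp (4 * η) * (G z + ε / 4) := by rw [Real.exp_add, hl]
        _ ≤ (G z + ε / 4) + ε / 4 := by
            have hx : 1 ≤ Real.exp (4 * η) := Real.one_le_exp (by positivity)
            nlinarith [hR' z hz]
        _ = _ := by ring
    · rw [Complex.norm_exp, ← Real.exp_nat_mul]
      calc Real.exp ((2 : ℕ) * (-(q.eval z)).re) * G z
          ≤ Real.exp (-Real.log (G z + ε / 4)) * (G z + ε / 4) := by
            gcongr
            · push_cast; simp; linarith
            · linarith
        _ = 1 := by rw [Real.exp_neg, hl]; exact inv_mul_cancel₀ (hpos z).ne'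
  obtain ⟨q, hq⟩ := key
  obtain ⟨M1, hM1⟩ := (isCompact_sphere (0 : ℂ) 1).exists_bound_of_continuousOn
    (f := fun z => Complex.exp (q.eval z)) (by fun_prop)
  obtain ⟨M2, hM2⟩ := (isCompact_sphere (0 : ℂ) 1).exists_bound_of_continuousOn
    (f := fun z => Complex.exp (-(q.eval z))) (by fun_prop)
  set M := max M1 M2
  have hM0 : 0 ≤ M := (norm_nonneg _).trans ((hM1 1 (by simp)).trans (le_max_left _ _))
  set η := min 1 (ε / 2 / ((2 * M + 1) * (R + 1))) with hη
  have hη0 : 0 < η := by positivity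
  have hη1 : η ≤ 1 := min_le_left _ _
  have hη2 : (2 * M + 1) * η * (R + 1) ≤ ε / 2 := by
    have : η ≤ ε / 2 / ((2 * M + 1) * (R + 1)) := min_le_right _ _
    rw [le_div_iff₀ (by positivity)] at this
    linarith
  have hη3 : (2 * M + 1) * η * R ≤ ε / 2 := by nlinarith [show 0 ≤ (2 * M + 1) * η by positivity]
  have hη4 : (2 * M + 1) * η ≤ ε / 2 := by nlinarith [show 0 ≤ (2 * M + 1) * η * R by positivity]
  obtain ⟨f, hf⟩ := exists_exp_approx q η hη0
  obtain ⟨v, hv⟩ := exists_exp_approx (-q) η hη0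
  refine ⟨f, v, fun z hz => ?_⟩
  have hz' : z ∈ Metric.sphere (0 : ℂ) 1 := by simpa using hz
  have a1 := (hM1 z hz').trans (le_max_left M1 M2)
  have a2 := (hM2 z hz').trans (le_max_right M1 M2)
  have b1 := hf z hz
  have b2 := hv z hz
  obtain ⟨c1, c2⟩ := hq z hz
  rw [eval_neg] at b2
  set F := Complex.exp (q.eval z)
  set F' := Complex.exp (-(q.eval z))
  have hFF : F * F' = 1 := by simp only [F, F', ← Complex.exp_add]; simp
  have d1 : ‖f.eval z‖ ≤ ‖F‖ + η := by
    have := norm_add_le (f.eval z - F) F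
    rw [sub_add_cancel] at this; linarith
  have d2 : ‖v.eval z‖ ≤ ‖F'‖ + η := by
    have := norm_add_le (v.eval z - F') F'
    rw [sub_add_cancel] at this; linarith
  have s1 : ∀ x y : ℝ, 0 ≤ x → x ≤ y + η → y ≤ M → 0 ≤ y → x ^ 2 ≤ y ^ 2 + (2 * M + 1) * η := by
    intro x y hx hxy hyM hy
    have : x ^ 2 ≤ (y + η) ^ 2 := by gcongr
    nlinarith
  have t1 := s1 _ _ (norm_nonneg _) d1 a1 (norm_nonneg _)
  have t2 := s1 _ _ (norm_nonneg _) d2 a2 (norm_nonneg _)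
  refine ⟨?_, ?_, ?_⟩
  · change _ ≤ G z + ε
    linarith
  · change _ * G z ≤ _
    have hGR := hR' z hz
    calc ‖v.eval z‖ ^ 2 * G z ≤ (‖F'‖ ^ 2 + (2 * M + 1) * η) * G z := by
          gcongr
      _ ≤ ‖F'‖ ^ 2 * G z + (2 * M + 1) * η * R := by
          rw [add_mul]; gcongr
      _ ≤ _ := by linarith
  · have : 1 - f.eval z * v.eval z = -(F * (v.eval z - F') + (f.eval z - F) * F' +
        (f.eval z - F) * (v.eval z - F')) := by rw [← hFF]; ring
    rw [this, norm_neg]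
    have u1 : ‖F * (v.eval z - F')‖ ≤ M * η := by rw [norm_mul]; gcongr
    have u2 : ‖(f.eval z - F) * F'‖ ≤ η * M := by rw [norm_mul]; gcongr
    have u3 : ‖(f.eval z - F) * (v.eval z - F')‖ ≤ η * 1 := by
      rw [norm_mul]; gcongr; exact b2.trans hη1
    have := norm_add₃_le (a := F * (v.eval z - F')) (b := (f.eval z - F) * F')
      (c := (f.eval z - F) * (v.eval z - F'))
    linarith

/-- The off-diagonal form. -/
noncomputable def Qform {ι : Type*} [Fintype ι] (n : ℕ) (Cm : ℕ → Matrix ι ι ℂ) (φ : ℂ[X])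
    (P Y : ι → ℂ[X]) : ℂ :=
  ∑ l ∈ Finset.range n, ((2 : ℂ) ^ l)⁻¹ *
    (X * derivative φ * ∑ a, ∑ b, C (Cm l a b) * Y a * P b).coeff (2 ^ l)

lemma Qform_bound {ι : Type*} [Fintype ι] (n : ℕ) (Cm : ℕ → Matrix ι ι ℂ)
    (hC : ∀ u v : ι → ℂ, ∑ l ∈ Finset.range n, ‖∑ a, ∑ b, Cm l a b * v a * u b‖ ^ 2 ≤
      (∑ b, ‖u b‖ ^ 2) * ∑ a, ‖v a‖ ^ 2)
    (φ : ℂ[X]) (P Y : ι → ℂ[X]) (B : ℝ) (hB : ∀ z : ℂ, ‖z‖ = 1 → ‖φ.eval z‖ ≤ B) :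
    ‖Qform n Cm φ P Y‖ ≤
      4 * B * (Real.sqrt (∑ b, nsq (P b)) * Real.sqrt (∑ a, nsq (Y a))) := by
  have hB0 : 0 ≤ B := (norm_nonneg _).trans (hB 1 (by simp))
  set SP := ∑ b, nsq (P b) with hSP
  set SY := ∑ b, nsq (Y b) with hSY
  have hSP0 : 0 ≤ SP := Finset.sum_nonneg fun _ _ => nsq_nonneg _
  have hSY0 : 0 ≤ SY := Finset.sum_nonneg fun _ _ => nsq_nonneg _
  -- crude continuity
  have crude : ∃ K : ℝ, ∀ (ε : ℝ) (g : ℂ[X]), (∀ z : ℂ, ‖z‖ = 1 → ‖g.eval z‖ ≤ ε) →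
      ‖Qform n Cm φ (fun b => g * P b) Y‖ ≤ K * ε := by
    have hb : ∀ l, ∃ K : ℝ, ∀ z : ℂ, ‖z‖ = 1 →
        ‖(X * derivative φ * ∑ a, ∑ b, C (Cm l a b) * Y a * P b).eval z‖ ≤ K := by
      intro l
      obtain ⟨K, hK⟩ := (isCompact_sphere (0 : ℂ) 1).exists_bound_of_continuousOn
        (f := fun z => (X * derivative φ * ∑ a, ∑ b, C (Cm l a b) * Y a * P b).eval z)
        (Polynomial.continuous _).continuousOn
      exact ⟨K, fun z hz => hK z (by simpa using hz)⟩
    choose K hK using hb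
    refine ⟨∑ l ∈ Finset.range n, ‖((2 : ℂ) ^ l)⁻¹‖ * K l, fun ε g hg => ?_⟩
    rw [Qform, Finset.sum_mul]
    refine (norm_sum_le _ _).trans (Finset.sum_le_sum fun l _ => ?_)
    refine ((norm_mul _ _).le.trans (mul_le_mul_of_nonneg_left (c := K l * ε) ?_
      (norm_nonneg _))).trans_eq (mul_assoc _ _ _).symm
    apply norm_coeff_le
    intro z hz
    have : X * derivative φ * ∑ a, ∑ b, C (Cm l a b) * Y a * (g * P b) =
        (X * derivative φ * ∑ a, ∑ b, C (Cm l a b) * Y a * P b) * g := by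
      simp only [Finset.mul_sum, Finset.sum_mul]
      refine Finset.sum_congr rfl fun a _ => Finset.sum_congr rfl fun b _ => by ring
    rw [this, eval_mul, norm_mul]
    have h1 := hK l z hz
    have h2 := hg z hz
    have h3 := (norm_nonneg _).trans h1
    gcongr
  obtain ⟨K, hK⟩ := crude
  -- main estimate
  have main : ∀ ε : ℝ, 0 < ε → ‖Qform n Cm φ P Y‖ ≤
      4 * B * (Real.sqrt (SP + ε) * Real.sqrt ((1 + ε) * SY)) + K * ε := by
    intro ε hε
    obtain ⟨f, v, hfv⟩ := outer_factor P ε hε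
    set w : ℕ → ℂ[X] := fun l => ∑ a, ∑ b, C (Cm l a b) * Y a * (v * P b) with hw
    have hnf : nsq f ≤ SP + ε := by
      have := sum_nsq_le {()} (fun _ => f) Finset.univ P 1 ε (by
        intro z hz; simpa using (hfv z hz).1)
      simpa using this
    have hnw : ∑ l ∈ Finset.range n, nsq (w l) ≤ (1 + ε) * SY := by
      have := sum_nsq_le (Finset.range n) w Finset.univ Y (1 + ε) 0 (by
        intro z hz
        have h1 := hC (fun b => (v * P b).eval z) (fun a => (Y a).eval z)
        simp only [hw, eval_finsetSum, eval_mul, eval_C, norm_mul, mul_pow, add_zero] at h1 ⊢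
        refine h1.trans ?_
        rw [← Finset.mul_sum]
        gcongr
        exact (hfv z hz).2.1)
      simpa using this
    have split : Qform n Cm φ P Y = Qform n Cm φ (fun b => (1 - f * v) * P b) Y +
        (∑ l ∈ Finset.range n, ((2 : ℂ) ^ l)⁻¹ * (X * derivative (φ * f) * w l).coeff (2 ^ l) -
         ∑ l ∈ Finset.range n, ((2 : ℂ) ^ l)⁻¹ * (X * derivative f * (φ * w l)).coeff (2 ^ l)) := by
      simp only [Qform]
      rw [← Finset.sum_sub_distrib, ← Finset.sum_add_distrib]
      refine Finset.sum_congr rfl fun l _ => ?_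
      rw [← mul_sub, ← mul_add, ← coeff_sub, ← coeff_add]
      congr 2
      have e1 : ∑ a, ∑ b, C (Cm l a b) * Y a * P b =
          (∑ a, ∑ b, C (Cm l a b) * Y a * ((1 - f * v) * P b)) + f * w l := by
        simp only [hw, Finset.mul_sum, ← Finset.sum_add_distrib]
        refine Finset.sum_congr rfl fun a _ => Finset.sum_congr rfl fun b _ => by ring
      rw [e1, derivative_mul]
      ring
    have k1 := keyK n (φ * f) w
    have k2 := keyK n f (fun l => φ * w l)
    have m1 := nsq_mul_le φ f B hB
    have m2 : ∑ l ∈ Finset.range n, nsq (φ * w l) ≤ B ^ 2 * ∑ l ∈ Finset.range n, nsq (w l) := by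
      rw [Finset.mul_sum]
      exact Finset.sum_le_sum fun l _ => nsq_mul_le φ (w l) B hB
    set W := ∑ l ∈ Finset.range n, nsq (w l) with hW
    have hW0 : 0 ≤ W := Finset.sum_nonneg fun _ _ => nsq_nonneg _
    set D := Real.sqrt (SP + ε) * Real.sqrt ((1 + ε) * SY) with hD
    have hD2 : D ^ 2 = (SP + ε) * ((1 + ε) * SY) := by
      rw [hD, mul_pow, Real.sq_sqrt (by positivity), Real.sq_sqrt (by positivity)]
    have hD0 : 0 ≤ D := by positivity
    have hfW : nsq f * W ≤ D ^ 2 := by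
      rw [hD2]; gcongr
    have q1 : ‖∑ l ∈ Finset.range n, ((2 : ℂ) ^ l)⁻¹ *
        (X * derivative (φ * f) * w l).coeff (2 ^ l)‖ ≤ 2 * B * D := by
      apply le_of_sq_le_sq _ (by positivity)
      refine k1.trans ?_
      have : nsq (φ * f) * W ≤ B ^ 2 * nsq f * W := by gcongr
      nlinarith [sq_nonneg (B * D), sq_nonneg B]
    have q2 : ‖∑ l ∈ Finset.range n, ((2 : ℂ) ^ l)⁻¹ *
        (X * derivative f * (φ * w l)).coeff (2 ^ l)‖ ≤ 2 * B * D := by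
      apply le_of_sq_le_sq _ (by positivity)
      refine k2.trans ?_
      have : nsq f * ∑ l ∈ Finset.range n, nsq (φ * w l) ≤ nsq f * (B ^ 2 * W) := by
        gcongr; exact nsq_nonneg _
      nlinarith [sq_nonneg (B * D), sq_nonneg B]
    have q3 := hK ε (1 - f * v) (by
      intro z hz; simpa using (hfv z hz).2.2)
    rw [split]
    refine (norm_add_le _ _).trans ?_
    have := norm_sub_le (∑ l ∈ Finset.range n, ((2 : ℂ) ^ l)⁻¹ *
        (X * derivative (φ * f) * w l).coeff (2 ^ l)) (∑ l ∈ Finset.range n, ((2 : ℂ) ^ l)⁻¹ *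
        (X * derivative f * (φ * w l)).coeff (2 ^ l))
    linarith
  have lim : Filter.Tendsto (fun ε : ℝ => 4 * B * (Real.sqrt (SP + ε) *
      Real.sqrt ((1 + ε) * SY)) + K * ε) (nhdsWithin 0 (Set.Ioi 0))
      (nhds (4 * B * (Real.sqrt (SP + 0) * Real.sqrt ((1 + 0) * SY)) + K * 0)) := by
    apply Filter.Tendsto.mono_left _ nhdsWithin_le_nhds
    apply Continuous.tendsto (f := fun ε : ℝ => 4 * B * (Real.sqrt (SP + ε) *
      Real.sqrt ((1 + ε) * SY)) + K * ε)
    fun_prop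
  have := ge_of_tendsto lim (Filter.eventually_of_mem self_mem_nhdsWithin fun ε hε => main ε hε)
  simpa using this

/-- Data of finite-dimensional matrices satisfying the canonical anticommutation relations. -/
structure CarData (n : ℕ) (ι : Type) [Fintype ι] [DecidableEq ι] (D : ℕ → Matrix ι ι ℂ)
    (κ : ι → ℕ) : Prop where
  card : Fintype.card ι = 2 ^ n
  wt : ∀ l < n, ∀ a b, D l a b ≠ 0 → κ b = κ a + 2 ^ l
  row : ∀ a, ∑ b, ∑ l ∈ Finset.range n, ‖D l a b‖ ≤ n
  col : ∀ b, ∑ a, ∑ l ∈ Finset.range n, ‖D l a b‖ ≤ n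
  sq : ∀ l < n, 2 * ∑ a, ∑ b, D l a b * D l a b = 2 ^ n
  car : ∀ c : ℕ → ℂ, (∑ l ∈ Finset.range n, c l • D l) *
    (∑ l ∈ Finset.range n, c l • D l).conjTranspose +
    (∑ l ∈ Finset.range n, c l • D l).conjTranspose * (∑ l ∈ Finset.range n, c l • D l) =
    ((∑ l ∈ Finset.range n, ‖c l‖ ^ 2 : ℝ) : ℂ) • (1 : Matrix ι ι ℂ)

lemma exists_car (n : ℕ) : ∃ (ι : Type) (_ : Fintype ι) (_ : DecidableEq ι)
    (D : ℕ → Matrix ι ι ℂ) (κ : ι → ℕ), CarData n ι D κ := by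
  induction n with
  | zero =>
    refine ⟨Unit, inferInstance, inferInstance, fun _ => 0, fun _ => 0, ?_⟩
    constructor <;> simp
  | succ n ih =>
    obtain ⟨ι, i1, i2, D, κ, h⟩ := ih
    refine ⟨ι ⊕ ι, inferInstance, inferInstance, fun l => if l = n then
      Matrix.fromBlocks 0 1 0 0 else Matrix.fromBlocks (D l) 0 0 (-D l),
      Sum.elim κ (fun a => κ a + 2 ^ n), ?_⟩
    have hne : ∀ l ∈ Finset.range n, l ≠ n := fun l hl => (Finset.mem_range.1 hl).ne
    constructor
    · simp [h.card, pow_succ, mul_two]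
    · intro l hl a b hab
      rcases (Nat.lt_succ_iff_lt_or_eq.1 hl) with hl' | rfl
      · rw [if_neg hl'.ne] at hab
        rcases a with a | a <;> rcases b with b | b <;> simp at hab ⊢
        · exact h.wt l hl' a b hab
        · have := h.wt l hl' a b hab; omega
      · rw [if_pos rfl] at hab
        rcases a with a | a <;> rcases b with b | b <;> simp [Matrix.one_apply] at hab ⊢
        rw [hab]
    · intro a
      have key : ∀ f : ℕ → Matrix (ι ⊕ ι) (ι ⊕ ι) ℂ, ∀ a b, 
        ∑ l ∈ Finset.range (n + 1), ‖(if l = n then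
          Matrix.fromBlocks 0 1 0 0 else f l : Matrix (ι ⊕ ι) (ι ⊕ ι) ℂ) a b‖ =
        ∑ l ∈ Finset.range n, ‖f l a b‖ +
          ‖(Matrix.fromBlocks 0 1 0 0 : Matrix (ι ⊕ ι) (ι ⊕ ι) ℂ) a b‖ := by
        intro f a b
        rw [Finset.sum_range_succ, if_pos rfl]
        congr 1
        exact Finset.sum_congr rfl fun l hl => by rw [if_neg (hne l hl)]
      simp only [key]
      rcases a with a | a
      · have := h.row a
        simp [Matrix.one_apply, apply_ite norm]
        linarith
      · have := h.row a
        simp [Matrix.one_apply]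
        linarith
    · intro b
      have key : ∀ f : ℕ → Matrix (ι ⊕ ι) (ι ⊕ ι) ℂ, ∀ a b, 
        ∑ l ∈ Finset.range (n + 1), ‖(if l = n then
          Matrix.fromBlocks 0 1 0 0 else f l : Matrix (ι ⊕ ι) (ι ⊕ ι) ℂ) a b‖ =
        ∑ l ∈ Finset.range n, ‖f l a b‖ +
          ‖(Matrix.fromBlocks 0 1 0 0 : Matrix (ι ⊕ ι) (ι ⊕ ι) ℂ) a b‖ := by
        intro f a b
        rw [Finset.sum_range_succ, if_pos rfl]
        congr 1
        exact Finset.sum_congr rfl fun l hl => by rw [if_neg (hne l hl)]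
      simp only [key]
      rcases b with b | b
      · have := h.col b
        simp [Matrix.one_apply]
        linarith
      · have := h.col b
        simp [Matrix.one_apply, apply_ite norm, Finset.sum_add_distrib]
        linarith
    · intro l hl
      rcases (Nat.lt_succ_iff_lt_or_eq.1 hl) with hl' | rfl
      · have := h.sq l hl'
        simp [hl'.ne]
        rw [pow_succ, ← this]; ring
      · simp [Matrix.one_apply, h.card, pow_succ]; ring
    · intro c
      have e : (∑ l ∈ Finset.range (n + 1), c l • (if l = n then
          Matrix.fromBlocks 0 1 0 0 else Matrix.fromBlocks (D l) 0 0 (-D l) :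
          Matrix (ι ⊕ ι) (ι ⊕ ι) ℂ)) = Matrix.fromBlocks (∑ l ∈ Finset.range n, c l • D l)
            (c n • 1) 0 (-∑ l ∈ Finset.range n, c l • D l) := by
        rw [Finset.sum_range_succ, if_pos rfl]
        rw [Finset.sum_congr rfl (g := fun l => c l • Matrix.fromBlocks (D l) 0 0 (-D l))
          fun l hl => by rw [if_neg (hne l hl)]]
        ext a b
        rcases a with a | a <;> rcases b with b | b <;> simp [Matrix.sum_apply]
      have hc := h.car c
      rw [e]
      set A := ∑ l ∈ Finset.range n, c l • D l with hA
      rw [Matrix.fromBlocks_conjTranspose, Matrix.fromBlocks_multiply, Matrix.fromBlocks_multiply,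
        Matrix.fromBlocks_add, ← Matrix.fromBlocks_one, Matrix.fromBlocks_smul]
      have hn : ((‖c n‖ ^ 2 : ℝ) : ℂ) = c n * star (c n) := by
        rw [Complex.star_def, Complex.mul_conj, Complex.normSq_eq_norm_sq]
      rw [Finset.sum_range_succ, Complex.ofReal_add, add_smul, ← hc, hn]
      congr 1
      · simp [smul_smul, mul_comm]; abel
      · simp
      · simp
      · simp [smul_smul, mul_comm]; abel

lemma exists_car_fin (n : ℕ) : ∃ (D : ℕ → Matrix (Fin (2 ^ n)) (Fin (2 ^ n)) ℂ)
    (κ : Fin (2 ^ n) → ℕ), CarData n (Fin (2 ^ n)) D κ := by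
  obtain ⟨ι, i1, i2, D, κ, h⟩ := exists_car n
  let e : ι ≃ Fin (2 ^ n) := Fintype.equivFinOfCardEq h.card
  refine ⟨fun l => (D l).submatrix e.symm e.symm, κ ∘ e.symm, ?_⟩
  constructor
  · simp
  · intro l hl a b hab
    exact h.wt l hl _ _ hab
  · intro a
    refine le_trans (le_of_eq ?_) (h.row (e.symm a))
    exact Equiv.sum_comp e.symm (fun b => ∑ l ∈ Finset.range n, ‖D l (e.symm a) b‖)
  · intro b
    refine le_trans (le_of_eq ?_) (h.col (e.symm b))
    exact Equiv.sum_comp e.symm (fun a => ∑ l ∈ Finset.range n, ‖D l a (e.symm b)‖)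
  · intro l hl
    rw [← h.sq l hl, ← Equiv.sum_comp e.symm]
    congr 1
    refine Finset.sum_congr rfl fun a _ => ?_
    rw [← Equiv.sum_comp e.symm]
    rfl
  · intro c
    have e1 : ∑ l ∈ Finset.range n, c l • (D l).submatrix e.symm e.symm =
        (∑ l ∈ Finset.range n, c l • D l).submatrix e.symm e.symm := by
      ext a b; simp [Matrix.sum_apply]
    rw [e1, Matrix.conjTranspose_submatrix, Matrix.submatrix_mul_equiv,
      Matrix.submatrix_mul_equiv]
    have := congrArg (fun M => Matrix.submatrix M e.symm e.symm) (h.car c)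
    rw [← Matrix.submatrix_one_equiv e.symm]
    exact this

lemma dotProduct_star_self_sum {ι : Type*} [Fintype ι] (w : ι → ℂ) :
    star w ⬝ᵥ w = ((∑ a, ‖w a‖ ^ 2 : ℝ) : ℂ) := by
  rw [dotProduct, Complex.ofReal_sum]
  refine Finset.sum_congr rfl fun a _ => ?_
  rw [Pi.star_apply, Complex.star_def, mul_comm, Complex.mul_conj, Complex.normSq_eq_norm_sq]

lemma CarData.mulVec_bound {n : ℕ} {ι : Type} [Fintype ι] [DecidableEq ι]
    {D : ℕ → Matrix ι ι ℂ} {κ : ι → ℕ} (h : CarData n ι D κ) (c : ℕ → ℂ) (u : ι → ℂ) :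
    ∑ a, ‖((∑ l ∈ Finset.range n, c l • D l).mulVec u) a‖ ^ 2 ≤
      (∑ l ∈ Finset.range n, ‖c l‖ ^ 2) * ∑ b, ‖u b‖ ^ 2 := by
  have hc := congrArg (fun M => star u ⬝ᵥ M.mulVec u) (h.car c)
  set A := ∑ l ∈ Finset.range n, c l • D l with hA
  have e1 : ∀ B : Matrix ι ι ℂ, star u ⬝ᵥ (B.conjTranspose * B).mulVec u =
      ((∑ a, ‖B.mulVec u a‖ ^ 2 : ℝ) : ℂ) := by
    intro B
    rw [← Matrix.mulVec_mulVec, Matrix.dotProduct_mulVec, ← Matrix.star_mulVec,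
      dotProduct_star_self_sum]
  have e2 := e1 A.conjTranspose
  rw [Matrix.conjTranspose_conjTranspose] at e2
  simp only [Matrix.add_mulVec, dotProduct_add, Matrix.smul_mulVec, Matrix.one_mulVec,
    dotProduct_smul] at hc
  rw [e2, e1 A, dotProduct_star_self_sum, smul_eq_mul, ← Complex.ofReal_add,
    ← Complex.ofReal_mul] at hc
  have hc' := Complex.ofReal_injective hc
  have : 0 ≤ ∑ a, ‖(A.conjTranspose).mulVec u a‖ ^ 2 := by positivity
  linarith

lemma CarData.form_bound {n : ℕ} {ι : Type} [Fintype ι] [DecidableEq ι]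
    {D : ℕ → Matrix ι ι ℂ} {κ : ι → ℕ} (h : CarData n ι D κ) (c : ℕ → ℂ) (u v : ι → ℂ) :
    ‖∑ l ∈ Finset.range n, c l * ∑ a, ∑ b, D l a b * v a * u b‖ ^ 2 ≤
      (∑ l ∈ Finset.range n, ‖c l‖ ^ 2) * ((∑ b, ‖u b‖ ^ 2) * ∑ a, ‖v a‖ ^ 2) := by
  have e : ∑ l ∈ Finset.range n, c l * ∑ a, ∑ b, D l a b * v a * u b =
      ∑ a, ((∑ l ∈ Finset.range n, c l • D l).mulVec u) a * v a := by
    simp only [Matrix.mulVec, dotProduct, Matrix.sum_apply, Matrix.smul_apply, smul_eq_mul,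
      Finset.mul_sum, Finset.sum_mul]
    rw [Finset.sum_comm]
    refine Finset.sum_congr rfl fun a _ => ?_
    rw [Finset.sum_comm]
    refine Finset.sum_congr rfl fun b _ => Finset.sum_congr rfl fun l _ => by ring
  rw [e]
  refine (norm_sum_mul_sq_le _ _ _).trans ?_
  rw [← mul_assoc]
  gcongr
  exact h.mulVec_bound c u

lemma CarData.hC {n : ℕ} {ι : Type} [Fintype ι] [DecidableEq ι]
    {D : ℕ → Matrix ι ι ℂ} {κ : ι → ℕ} (h : CarData n ι D κ) (u v : ι → ℂ) :
    ∑ l ∈ Finset.range n, ‖∑ a, ∑ b, D l a b * v a * u b‖ ^ 2 ≤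
      (∑ b, ‖u b‖ ^ 2) * ∑ a, ‖v a‖ ^ 2 := by
  set f : ℕ → ℂ := fun l => ∑ a, ∑ b, D l a b * v a * u b with hf
  have := h.form_bound (fun l => star (f l)) u v
  have e : ∑ l ∈ Finset.range n, star (f l) * f l =
      ((∑ l ∈ Finset.range n, ‖f l‖ ^ 2 : ℝ) : ℂ) := by
    rw [Complex.ofReal_sum]
    refine Finset.sum_congr rfl fun a _ => ?_
    rw [Complex.star_def, mul_comm, Complex.mul_conj, Complex.normSq_eq_norm_sq]
  change ‖∑ l ∈ Finset.range n, star (f l) * f l‖ ^ 2 ≤ _ at this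
  rw [e, Complex.norm_real, Real.norm_eq_abs, sq_abs] at this
  simp only [norm_star] at this
  set W := ∑ l ∈ Finset.range n, ‖f l‖ ^ 2 with hW
  have hW0 : 0 ≤ W := by positivity
  change W ≤ _
  have hK : 0 ≤ (∑ b, ‖u b‖ ^ 2) * ∑ a, ‖v a‖ ^ 2 := by positivity
  by_contra hlt
  push Not at hlt
  have : 0 < W := lt_of_le_of_lt hK hlt
  nlinarith

noncomputable def toPoly {d : ℕ} (x : Fin d → ℂ) : ℂ[X] := ∑ j, C (x j) * X ^ (j : ℕ)

lemma toPoly_coeff {d : ℕ} (x : Fin d → ℂ) (m : ℕ) :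
    (toPoly x).coeff m = if h : m < d then x ⟨m, h⟩ else 0 := by
  simp only [toPoly, finsetSum_coeff, coeff_C_mul, coeff_X_pow]
  split_ifs with h
  · rw [Finset.sum_eq_single ⟨m, h⟩]
    · simp
    · intro b _ hb
      have : m ≠ (b : ℕ) := fun h' => hb (Fin.ext h'.symm)
      simp [this]
    · simp
  · refine Finset.sum_eq_zero fun b _ => ?_
    have : m ≠ (b : ℕ) := fun h' => h (h' ▸ b.2)
    simp [this]

lemma nsq_toPoly {d : ℕ} (x : Fin d → ℂ) : nsq (toPoly x) ≤ ∑ j, ‖x j‖ ^ 2 := by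
  have h : ∑ j, ‖x j‖ ^ 2 = ∑ m ∈ Finset.range d, ‖(toPoly x).coeff m‖ ^ 2 := by
    rw [Finset.sum_range]
    refine Finset.sum_congr rfl fun j _ => ?_
    rw [toPoly_coeff, dif_pos j.2]
  rw [h, nsq]
  refine Finset.sum_le_sum_of_subset_of_nonneg ?_ fun _ _ _ => by positivity
  intro m hm
  rw [mem_support_iff, toPoly_coeff] at hm
  rw [Finset.mem_range]
  by_contra h
  simp [h] at hm

/-- The `k`-th power of the finite Foguel-Hankel block. -/
noncomputable def fhPow {ι : Type} [DecidableEq ι] (n d : ℕ) (D : ℕ → Matrix ι ι ℂ) (k : ℕ) :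
    Matrix ((ι × Fin d) ⊕ (ι × Fin d)) ((ι × Fin d) ⊕ (ι × Fin d)) ℂ :=
  Matrix.fromBlocks
    (Matrix.of fun x y => if x.1 = y.1 ∧ (y.2 : ℕ) = x.2 + k then 1 else 0)
    (Matrix.of fun x y => k * ∑ l ∈ Finset.range n, ((2 : ℂ) ^ l)⁻¹ *
      if (x.2 : ℕ) + y.2 + k = 2 ^ l then D l x.1 y.1 else 0)
    0
    (Matrix.of fun x y => if x.1 = y.1 ∧ (x.2 : ℕ) = y.2 + k then 1 else 0)

lemma fhPow_zero {ι : Type} [DecidableEq ι] (n d : ℕ) (D : ℕ → Matrix ι ι ℂ) :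
    fhPow n d D 0 = 1 := by
  rw [fhPow, ← Matrix.fromBlocks_one]
  congr 1
  · ext x y
    simp [Matrix.one_apply, Prod.ext_iff, Fin.ext_iff, eq_comm]
  · ext x y; simp
  · ext x y
    simp [Matrix.one_apply, Prod.ext_iff, Fin.ext_iff]

lemma sum_shift_aux {ι : Type} [Fintype ι] [DecidableEq ι] {d : ℕ} (f : ι × Fin d → ℂ) (a : ι)
    (m : ℕ) : (∑ z : ι × Fin d, if a = z.1 ∧ (z.2 : ℕ) = m then f z else 0) =
      if h : m < d then f (a, ⟨m, h⟩) else 0 := by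
  split_ifs with h
  · rw [Finset.sum_eq_single (a, ⟨m, h⟩)]
    · simp
    · rintro ⟨b, j⟩ _ hb
      rw [if_neg]
      rintro ⟨rfl, h'⟩
      exact hb (Prod.ext rfl (Fin.ext h'))
    · simp
  · refine Finset.sum_eq_zero ?_
    rintro ⟨b, j⟩ _
    rw [if_neg]
    rintro ⟨rfl, h'⟩
    exact h (h' ▸ j.2)

lemma fhPow_succ {ι : Type} [Fintype ι] [DecidableEq ι] (n d : ℕ) (hd : 2 ^ n ≤ d)
    (D : ℕ → Matrix ι ι ℂ) (k : ℕ) :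
    fhPow n d D k * fhPow n d D 1 = fhPow n d D (k + 1) := by
  have hl : ∀ l ∈ Finset.range n, 2 ^ l < d := fun l hl =>
    (Nat.pow_lt_pow_right (by norm_num) (Finset.mem_range.1 hl)).trans_le hd
  simp only [fhPow]
  rw [Matrix.fromBlocks_multiply]
  congr 1
  · ext ⟨a, i⟩ ⟨b, j⟩
    simp only [Matrix.mul_zero, add_zero, Matrix.mul_apply, Matrix.of_apply, ite_mul, one_mul,
      zero_mul]
    rw [sum_shift_aux]
    by_cases h : (i : ℕ) + k < d
    · simp [h, add_assoc]
    · have : ¬ ((j : ℕ) = i + (k + 1)) := by have := j.2; omega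
      simp [h, this]
  · ext ⟨a, i⟩ ⟨b, j⟩
    simp only [Matrix.add_apply, Matrix.mul_apply, Matrix.of_apply, ite_mul, one_mul,
      zero_mul, mul_ite, mul_one, mul_zero]
    rw [sum_shift_aux]
    have e : ∀ z : ι × Fin d, (z.1 = b ∧ (z.2 : ℕ) = j + 1) ↔ (b = z.1 ∧ (z.2 : ℕ) = j + 1) :=
      fun z => by rw [eq_comm]
    simp only [e]
    rw [sum_shift_aux]
    have e1 : (if h : (i : ℕ) + k < d then ((1 : ℕ) : ℂ) * ∑ l ∈ Finset.range n,
        (if i + k + j + 1 = 2 ^ l then ((2 : ℂ) ^ l)⁻¹ * D l a b else 0) else 0) =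
        ∑ l ∈ Finset.range n,
        (if (i : ℕ) + j + (k + 1) = 2 ^ l then ((2 : ℂ) ^ l)⁻¹ * D l a b else 0) := by
      have e0 : (i : ℕ) + j + (k + 1) = i + k + j + 1 := by ring
      rw [e0]
      split_ifs with h
      · simp
      · symm
        refine Finset.sum_eq_zero fun l hl' => if_neg ?_
        have := hl l hl'
        omega
    have e2 : (if h : (j : ℕ) + 1 < d then (k : ℂ) * ∑ l ∈ Finset.range n,
        (if (i : ℕ) + (j + 1) + k = 2 ^ l then ((2 : ℂ) ^ l)⁻¹ * D l a b else 0) else 0) =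
        (k : ℂ) * ∑ l ∈ Finset.range n,
        (if (i : ℕ) + j + (k + 1) = 2 ^ l then ((2 : ℂ) ^ l)⁻¹ * D l a b else 0) := by
      have e0 : (i : ℕ) + j + (k + 1) = i + (j + 1) + k := by ring
      rw [e0]
      split_ifs with h
      · rfl
      · symm
        rw [Finset.sum_eq_zero, mul_zero]
        refine fun l hl' => if_neg ?_
        have := hl l hl'
        omega
    refine (congrArg₂ (· + ·) e1 e2).trans ?_
    push_cast
    ring
  · simp
  · ext ⟨a, i⟩ ⟨b, j⟩
    simp only [Matrix.zero_mul, zero_add, Matrix.mul_apply, Matrix.of_apply, 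
      mul_ite, mul_one, mul_zero]
    have e : ∀ z : ι × Fin d, (z.1 = b ∧ (z.2 : ℕ) = j + 1) ↔ (b = z.1 ∧ (z.2 : ℕ) = j + 1) :=
      fun z => by rw [eq_comm]
    simp only [e]
    rw [sum_shift_aux]
    by_cases h : (j : ℕ) + 1 < d
    · have e0 : (j : ℕ) + (k + 1) = j + 1 + k := by ring
      simp [h, e0]
    · have : ¬ ((i : ℕ) = j + (k + 1)) := by have := i.2; omega
      simp [h, this]

lemma fhPow_pow {ι : Type} [Fintype ι] [DecidableEq ι] (n d : ℕ) (hd : 2 ^ n ≤ d)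
    (D : ℕ → Matrix ι ι ℂ) (k : ℕ) : (fhPow n d D 1) ^ k = fhPow n d D k := by
  induction k with
  | zero => rw [pow_zero, fhPow_zero]
  | succ k ih => rw [pow_succ, ih, fhPow_succ n d hd]

lemma fhPow_corner {ι : Type} [DecidableEq ι] (n d : ℕ) (hd : 0 < d)
    (D : ℕ → Matrix ι ι ℂ) (l : ℕ) (hl : l < n) (a b : ι) :
    fhPow n d D (2 ^ l) (Sum.inl (a, ⟨0, hd⟩)) (Sum.inr (b, ⟨0, hd⟩)) = D l a b := by
  simp only [fhPow, Matrix.fromBlocks_apply₁₂, Matrix.of_apply, zero_add]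
  rw [Finset.sum_eq_single l]
  · simp
  · intro m _ hm
    rw [if_neg, mul_zero]
    intro h
    exact hm (Nat.pow_right_injective le_rfl h).symm
  · simp [hl]

lemma monomial_mul_toPoly_coeff {d : ℕ} (k : ℕ) (c : ℂ) (x : Fin d → ℂ) (m : ℕ) :
    (monomial k c * toPoly x).coeff m = c * ∑ i : Fin d, if m = (i : ℕ) + k then x i else 0 := by
  rw [toPoly, Finset.mul_sum, finsetSum_coeff, Finset.mul_sum]
  refine Finset.sum_congr rfl fun i _ => ?_
  have : monomial k c * (C (x i) * X ^ (i : ℕ)) = C (c * x i) * X ^ ((i : ℕ) + k) := by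
    rw [← C_mul_X_pow_eq_monomial, C_mul, pow_add]; ring
  rw [this, coeff_C_mul, coeff_X_pow]
  split_ifs <;> simp

lemma Qform_monomial {ι : Type} [Fintype ι] (n d : ℕ) (D : ℕ → Matrix ι ι ℂ) (k : ℕ) (c : ℂ)
    (v w : ι → Fin d → ℂ) :
    Qform n D (monomial k c) (fun b => toPoly (v b)) (fun a => toPoly (w a)) =
      ∑ a, ∑ i : Fin d, ∑ b, ∑ j : Fin d, w a i * (c * (k * ∑ l ∈ Finset.range n,
        ((2 : ℂ) ^ l)⁻¹ * if (i : ℕ) + j + k = 2 ^ l then D l a b else 0)) * v b j := by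
  have h0 : X * derivative (monomial k c) = C (c * k) * X ^ k := by
    rw [derivative_monomial, C_mul_X_pow_eq_monomial]
    rcases k with _ | k
    · simp
    · rw [Nat.add_sub_cancel, X_mul_monomial]
  have h1 : ∀ l, (X * derivative (monomial k c) * ∑ a, ∑ b, C (D l a b) * toPoly (w a) *
      toPoly (v b)).coeff (2 ^ l) = ∑ a, ∑ i : Fin d, ∑ b, ∑ j : Fin d,
        w a i * (c * (k * if (i : ℕ) + j + k = 2 ^ l then D l a b else 0)) * v b j := by
    intro l
    rw [h0, Finset.mul_sum, finsetSum_coeff]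
    refine Finset.sum_congr rfl fun a _ => ?_
    rw [Finset.mul_sum, finsetSum_coeff, Finset.sum_comm]
    refine Finset.sum_congr rfl fun b _ => ?_
    have e1 : C (D l a b) * toPoly (w a) * toPoly (v b) = ∑ i : Fin d, ∑ j : Fin d,
        C (D l a b) * (C (w a i) * X ^ (i : ℕ)) * (C (v b j) * X ^ (j : ℕ)) := by
      rw [toPoly, toPoly, mul_assoc, Finset.sum_mul_sum, Finset.mul_sum]
      refine Finset.sum_congr rfl fun i _ => ?_
      rw [Finset.mul_sum]
      refine Finset.sum_congr rfl fun j _ => (mul_assoc _ _ _).symm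
    rw [e1, Finset.mul_sum, finsetSum_coeff]
    refine Finset.sum_congr rfl fun i _ => ?_
    rw [Finset.mul_sum, finsetSum_coeff]
    refine Finset.sum_congr rfl fun j _ => ?_
    have : C (c * (k : ℂ)) * X ^ k * (C (D l a b) * (C (w a i) * X ^ (i : ℕ)) *
        (C (v b j) * X ^ (j : ℕ))) =
        C (c * k * D l a b * w a i * v b j) * X ^ ((i : ℕ) + j + k) := by
      simp only [C_mul, pow_add]; ring
    rw [this, coeff_C_mul, coeff_X_pow]
    by_cases h : (i : ℕ) + j + k = 2 ^ l
    · rw [if_pos h.symm, if_pos h]; ring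
    · rw [if_neg (Ne.symm h), if_neg h]; ring
  simp only [Qform, h1]
  simp only [Finset.mul_sum, Finset.sum_mul]
  rw [Finset.sum_comm]
  refine Finset.sum_congr rfl fun a _ => ?_
  rw [Finset.sum_comm]
  refine Finset.sum_congr rfl fun i _ => ?_
  rw [Finset.sum_comm]
  refine Finset.sum_congr rfl fun b _ => ?_
  rw [Finset.sum_comm]
  refine Finset.sum_congr rfl fun j _ => Finset.sum_congr rfl fun l _ => ?_
  ring

lemma fromBlocks_form {α : Type*} [Fintype α] (c : ℂ) (A E F : Matrix α α ℂ) (w v : α ⊕ α → ℂ) :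
    w ⬝ᵥ (c • Matrix.fromBlocks A E 0 F).mulVec v =
      ∑ x, ∑ y, w (Sum.inl x) * (c * A x y) * v (Sum.inl y) +
      ∑ x, ∑ y, w (Sum.inl x) * (c * E x y) * v (Sum.inr y) +
      ∑ x, ∑ y, w (Sum.inr x) * (c * F x y) * v (Sum.inr y) := by
  simp [dotProduct, Matrix.mulVec, Finset.mul_sum, mul_add, Finset.sum_add_distrib, mul_assoc]
  rw [add_assoc]

lemma fh_form {ι : Type} [Fintype ι] [DecidableEq ι] (n d : ℕ) (hd : 2 ^ n ≤ d)
    (D : ℕ → Matrix ι ι ℂ) (φ : ℂ[X]) (w v : (ι × Fin d) ⊕ (ι × Fin d) → ℂ) :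
    w ⬝ᵥ (aeval (fhPow n d D 1) φ).mulVec v =
      ∑ a, ∑ j : Fin d, v (Sum.inl (a, j)) * (φ * toPoly fun i => w (Sum.inl (a, i))).coeff j +
      Qform n D φ (fun b => toPoly fun j => v (Sum.inr (b, j)))
        (fun a => toPoly fun i => w (Sum.inl (a, i))) +
      ∑ a, ∑ i : Fin d, w (Sum.inr (a, i)) *
        (φ * toPoly fun j => v (Sum.inr (a, j))).coeff i := by
  induction φ using Polynomial.induction_on' with
  | add φ ψ h1 h2 =>
    have hQ : ∀ P Y : ι → ℂ[X], Qform n D (φ + ψ) P Y = Qform n D φ P Y + Qform n D ψ P Y := by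
      intro P Y
      simp only [Qform, derivative_add, mul_add, add_mul, coeff_add, Finset.sum_add_distrib]
    rw [map_add, Matrix.add_mulVec, dotProduct_add, h1, h2, hQ]
    simp only [add_mul, coeff_add, mul_add, Finset.sum_add_distrib]
    ring
  | monomial k c =>
    have hM : aeval (fhPow n d D 1) (monomial k c) = c • fhPow n d D k := by
      rw [aeval_monomial, fhPow_pow n d hd, Algebra.algebraMap_eq_smul_one, smul_mul_assoc, one_mul]
    rw [hM, Qform_monomial]
    simp only [monomial_mul_toPoly_coeff]
    rw [fhPow, fromBlocks_form]
    congr 1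
    · congr 1
      · rw [Finset.sum_comm, Fintype.sum_prod_type]
        refine Finset.sum_congr rfl fun a _ => Finset.sum_congr rfl fun j _ => ?_
        rw [Fintype.sum_prod_type, Finset.sum_eq_single a]
        · simp only [Finset.mul_sum]
          refine Finset.sum_congr rfl fun i _ => ?_
          simp only [Matrix.of_apply, true_and]
          split_ifs <;> ring
        · intro b _ hb
          simp [hb]
        · simp
      · simp only [Fintype.sum_prod_type, Matrix.of_apply]
    · rw [Fintype.sum_prod_type]
      refine Finset.sum_congr rfl fun a _ => Finset.sum_congr rfl fun j _ => ?_
      rw [Fintype.sum_prod_type, Finset.sum_eq_single a]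
      · simp only [Finset.mul_sum]
        refine Finset.sum_congr rfl fun i _ => ?_
        simp only [Matrix.of_apply, true_and]
        split_ifs <;> ring
      · intro b _ hb
        simp [hb.symm]
      · simp

lemma norm_sq_sum_prod {ι : Type} [Fintype ι] {d : ℕ} (f : ι × Fin d → ℂ) :
    ∑ z, ‖f z‖ ^ 2 = ∑ a, ∑ i, ‖f (a, i)‖ ^ 2 := Fintype.sum_prod_type _

lemma diag_form_bound {ι : Type} [Fintype ι] {d : ℕ} (φ : ℂ[X]) (B : ℝ)
    (hB : ∀ z : ℂ, ‖z‖ = 1 → ‖φ.eval z‖ ≤ B) (x y : ι → Fin d → ℂ) :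
    ‖∑ a, ∑ j : Fin d, x a j * (φ * toPoly (y a)).coeff j‖ ^ 2 ≤
      (∑ a, ∑ j, ‖x a j‖ ^ 2) * (B ^ 2 * ∑ a, ∑ j, ‖y a j‖ ^ 2) := by
  have h1 := norm_sum_mul_sq_le Finset.univ (fun z : ι × Fin d => x z.1 z.2)
    (fun z => (φ * toPoly (y z.1)).coeff z.2)
  simp only [Fintype.sum_prod_type] at h1
  refine h1.trans ?_
  gcongr
  rw [Finset.mul_sum]
  refine Finset.sum_le_sum fun a _ => ?_
  calc ∑ j : Fin d, ‖(φ * toPoly (y a)).coeff j‖ ^ 2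
      = ∑ j ∈ Finset.range d, ‖(φ * toPoly (y a)).coeff j‖ ^ 2 := by rw [Finset.sum_range]
    _ ≤ nsq (φ * toPoly (y a)) := sum_le_nsq _ _
    _ ≤ B ^ 2 * nsq (toPoly (y a)) := nsq_mul_le _ _ _ hB
    _ ≤ _ := by gcongr; exact nsq_toPoly _

lemma fh_form_bound {n : ℕ} {ι : Type} [Fintype ι] [DecidableEq ι]
    {D : ℕ → Matrix ι ι ℂ} {κ : ι → ℕ} (h : CarData n ι D κ) (d : ℕ) (hd : 2 ^ n ≤ d)
    (φ : ℂ[X]) (B : ℝ) (hB : ∀ z : ℂ, ‖z‖ = 1 → ‖φ.eval z‖ ≤ B)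
    (w v : (ι × Fin d) ⊕ (ι × Fin d) → ℂ) :
    ‖w ⬝ᵥ (aeval (fhPow n d D 1) φ).mulVec v‖ ≤
      6 * B * (Real.sqrt (∑ z, ‖v z‖ ^ 2) * Real.sqrt (∑ z, ‖w z‖ ^ 2)) := by
  have hB0 : 0 ≤ B := (norm_nonneg _).trans (hB 1 (by simp))
  rw [fh_form n d hd]
  simp only [Fintype.sum_sum_type, norm_sq_sum_prod]
  set v1 := ∑ a, ∑ i : Fin d, ‖v (Sum.inl (a, i))‖ ^ 2
  set v2 := ∑ a, ∑ i : Fin d, ‖v (Sum.inr (a, i))‖ ^ 2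
  set w1 := ∑ a, ∑ i : Fin d, ‖w (Sum.inl (a, i))‖ ^ 2
  set w2 := ∑ a, ∑ i : Fin d, ‖w (Sum.inr (a, i))‖ ^ 2
  have hv1 : 0 ≤ v1 := by positivity
  have hv2 : 0 ≤ v2 := by positivity
  have hw1 : 0 ≤ w1 := by positivity
  have hw2 : 0 ≤ w2 := by positivity
  set N := Real.sqrt (v1 + v2) * Real.sqrt (w1 + w2) with hN
  have hN0 : 0 ≤ N := by positivity
  have hN2 : N ^ 2 = (v1 + v2) * (w1 + w2) := by
    rw [hN, mul_pow, Real.sq_sqrt (by positivity), Real.sq_sqrt (by positivity)]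
  have t1 := diag_form_bound φ B hB (fun a j => v (Sum.inl (a, j))) (fun a j => w (Sum.inl (a, j)))
  have t3 := diag_form_bound φ B hB (fun a j => w (Sum.inr (a, j))) (fun a j => v (Sum.inr (a, j)))
  have t2 := Qform_bound n D h.hC φ (fun b => toPoly fun j => v (Sum.inr (b, j)))
        (fun a => toPoly fun i => w (Sum.inl (a, i))) B hB
  have q1 : ‖∑ a, ∑ j : Fin d, v (Sum.inl (a, j)) *
      (φ * toPoly fun i => w (Sum.inl (a, i))).coeff j‖ ≤ B * N := by
    apply le_of_sq_le_sq _ (by positivity)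
    refine t1.trans ?_
    rw [mul_pow, hN2]
    change v1 * (B ^ 2 * w1) ≤ _
    have : v1 * w1 ≤ (v1 + v2) * (w1 + w2) := by gcongr <;> linarith
    nlinarith [sq_nonneg B]
  have q3 : ‖∑ a, ∑ i : Fin d, w (Sum.inr (a, i)) *
        (φ * toPoly fun j => v (Sum.inr (a, j))).coeff i‖ ≤ B * N := by
    apply le_of_sq_le_sq _ (by positivity)
    refine t3.trans ?_
    rw [mul_pow, hN2]
    change w2 * (B ^ 2 * v2) ≤ _
    have : v2 * w2 ≤ (v1 + v2) * (w1 + w2) := by gcongr <;> linarith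
    nlinarith [sq_nonneg B]
  have q2 : ‖Qform n D φ (fun b => toPoly fun j => v (Sum.inr (b, j)))
        (fun a => toPoly fun i => w (Sum.inl (a, i)))‖ ≤ 4 * B * N := by
    refine t2.trans (mul_le_mul_of_nonneg_left ?_ (by positivity))
    rw [hN]
    gcongr
    · refine (Finset.sum_le_sum fun b _ => nsq_toPoly _).trans ?_
      change v2 ≤ _
      linarith
    · refine (Finset.sum_le_sum fun b _ => nsq_toPoly _).trans ?_
      change w1 ≤ _
      linarith
  refine (norm_add₃_le).trans ?_
  linarith

lemma fh_mulVec_bound {n : ℕ} {ι : Type} [Fintype ι] [DecidableEq ι]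
    {D : ℕ → Matrix ι ι ℂ} {κ : ι → ℕ} (h : CarData n ι D κ) (d : ℕ) (hd : 2 ^ n ≤ d)
    (φ : ℂ[X]) (B : ℝ) (hB : ∀ z : ℂ, ‖z‖ = 1 → ‖φ.eval z‖ ≤ B)
    (v : (ι × Fin d) ⊕ (ι × Fin d) → ℂ) :
    ∑ z, ‖(aeval (fhPow n d D 1) φ).mulVec v z‖ ^ 2 ≤ (6 * B) ^ 2 * ∑ z, ‖v z‖ ^ 2 := by
  have hB0 : 0 ≤ B := (norm_nonneg _).trans (hB 1 (by simp))
  set u := (aeval (fhPow n d D 1) φ).mulVec v with hu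
  have h1 := fh_form_bound h d hd φ B hB (star u) v
  rw [← hu, dotProduct_star_self_sum, Complex.norm_real, Real.norm_eq_abs,
    abs_of_nonneg (by positivity)] at h1
  simp only [Pi.star_apply, norm_star] at h1
  set U := ∑ z, ‖u z‖ ^ 2 with hU
  set V := ∑ z, ‖v z‖ ^ 2 with hV
  have hU0 : 0 ≤ U := by positivity
  have hV0 : 0 ≤ V := by positivity
  have s1 := Real.sq_sqrt hU0
  have s2 := Real.sq_sqrt hV0
  have n1 := Real.sqrt_nonneg U
  have n2 := Real.sqrt_nonneg V
  have : Real.sqrt U ≤ 6 * B * Real.sqrt V := by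
    rcases n1.eq_or_lt with h0 | h0
    · rw [← h0]; positivity
    · by_contra hlt
      push Not at hlt
      nlinarith
  calc U = Real.sqrt U ^ 2 := s1.symm
    _ ≤ (6 * B * Real.sqrt V) ^ 2 := by gcongr
    _ = _ := by rw [mul_pow, s2]

lemma l2_summable {J : Type*} (x : lp (fun _ : J => ℂ) 2) : Summable fun i => ‖x i‖ ^ 2 := by
  have := (lp.memℓp x).summable (by norm_num)
  simpa using this

lemma l2_norm_sq {J : Type*} (x : lp (fun _ : J => ℂ) 2) : ‖x‖ ^ 2 = ∑' i, ‖x i‖ ^ 2 := by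
  have := lp.norm_rpow_eq_tsum (p := 2) (by norm_num) x
  simpa using this

lemma l2_mem {J : Type*} (y : J → ℂ) (h : Summable fun i => ‖y i‖ ^ 2) : Memℓp y 2 := by
  apply memℓp_gen
  simpa using h

lemma sig_bound {K : ℕ → Type} [∀ n, Fintype (K n)] (x : lp (fun _ : Σ n, K n => ℂ) 2)
    (y : (Σ n, K n) → ℂ) (c : ℝ) (hc : 0 ≤ c)
    (h : ∀ n, ∑ i, ‖y ⟨n, i⟩‖ ^ 2 ≤ c ^ 2 * ∑ i, ‖x ⟨n, i⟩‖ ^ 2) :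
    ∃ hy : Memℓp y 2, ‖(⟨y, hy⟩ : lp (fun _ : Σ n, K n => ℂ) 2)‖ ≤ c * ‖x‖ := by
  have hx := l2_summable x
  have hx' := (summable_sigma_of_nonneg (fun _ => by positivity)).1 hx
  have hx2 := hx'.2
  simp only [tsum_fintype] at hx2
  have hy2 : Summable fun n => ∑ i, ‖y ⟨n, i⟩‖ ^ 2 :=
    Summable.of_nonneg_of_le (fun _ => by positivity) h (hx2.mul_left _)
  have hy : Summable fun i => ‖y i‖ ^ 2 := by
    refine (summable_sigma_of_nonneg (fun _ => by positivity)).2 ⟨fun n => ?_, ?_⟩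
    · exact (hasSum_fintype _).summable
    · simpa only [tsum_fintype] using hy2
  refine ⟨l2_mem y hy, ?_⟩
  apply le_of_sq_le_sq _ (by positivity)
  rw [l2_norm_sq, mul_pow, l2_norm_sq]
  change ∑' i, ‖y i‖ ^ 2 ≤ _
  rw [hy.tsum_sigma, hx.tsum_sigma]
  simp only [tsum_fintype]
  rw [← tsum_mul_left]
  exact hy2.tsum_le_tsum h (hx2.mul_left _)

lemma exists_blockDiag0 {K : ℕ → Type} [∀ n, Fintype (K n)]
    (M : ∀ n, Matrix (K n) (K n) ℂ) (c : ℝ)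
    (h1 : ∀ n (v : K n → ℂ), ∑ z, ‖(M n).mulVec v z‖ ^ 2 ≤ c ^ 2 * ∑ z, ‖v z‖ ^ 2) (hc : 0 ≤ c) :
    ∃ T : lp (fun _ : Σ n, K n => ℂ) 2 →L[ℂ] lp (fun _ : Σ n, K n => ℂ) 2,
      ∀ x n i, (T x) ⟨n, i⟩ = (M n).mulVec (fun j => x ⟨n, j⟩) i := by
  have hex : ∀ x : lp (fun _ : Σ n, K n => ℂ) 2, ∃ y : lp (fun _ : Σ n, K n => ℂ) 2,
      (∀ n i, y ⟨n, i⟩ = (M n).mulVec (fun j => x ⟨n, j⟩) i) ∧ ‖y‖ ≤ c * ‖x‖ := by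
    intro x
    have h2 : ∀ n, ∑ i, ‖(M n).mulVec (fun j => x ⟨n, j⟩) i‖ ^ 2 ≤
        c ^ 2 * ∑ i, ‖x ⟨n, i⟩‖ ^ 2 := fun n => h1 n (fun j => x ⟨n, j⟩)
    have h3 := sig_bound x (fun s => (M s.1).mulVec (fun j => x ⟨s.1, j⟩) s.2) c hc h2
    obtain ⟨hy, h⟩ := h3
    exact ⟨⟨_, hy⟩, fun n i => rfl, h⟩
  choose F hF hFn using hex
  let L : lp (fun _ : Σ n, K n => ℂ) 2 →ₗ[ℂ] lp (fun _ : Σ n, K n => ℂ) 2 :=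
    { toFun := F
      map_add' := by
        intro x y
        ext ⟨n, i⟩
        rw [lp.coeFn_add, Pi.add_apply, hF, hF, hF, ← Pi.add_apply, ← Matrix.mulVec_add]
        rfl
      map_smul' := by
        intro r x
        ext ⟨n, i⟩
        rw [lp.coeFn_smul, Pi.smul_apply, hF, hF, ← Pi.smul_apply, ← Matrix.mulVec_smul]
        rfl }
  exact ⟨L.mkContinuous c hFn, hF⟩

lemma blockDiag_aeval {K : ℕ → Type} [∀ n, Fintype (K n)] [∀ n, DecidableEq (K n)]
    (M : ∀ n, Matrix (K n) (K n) ℂ)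
    (T : lp (fun _ : Σ n, K n => ℂ) 2 →L[ℂ] lp (fun _ : Σ n, K n => ℂ) 2)
    (hT : ∀ x n i, (T x) ⟨n, i⟩ = (M n).mulVec (fun j => x ⟨n, j⟩) i) (φ : ℂ[X]) :
    ∀ x n i, (aeval T φ x) ⟨n, i⟩ = (aeval (M n) φ).mulVec (fun j => x ⟨n, j⟩) i := by
  induction φ using Polynomial.induction_on with
  | C a =>
    intro x n i
    rw [aeval_C, aeval_C, Algebra.algebraMap_eq_smul_one, Algebra.algebraMap_eq_smul_one,
      Matrix.smul_mulVec, Matrix.one_mulVec]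
    rfl
  | add φ ψ h1 h2 =>
    intro x n i
    rw [map_add, map_add, Matrix.add_mulVec, Pi.add_apply, ← h1, ← h2]
    rfl
  | monomial k a ih =>
    intro x n i
    have e1 : aeval T (C a * X ^ (k + 1)) = aeval T (C a * X ^ k) * T := by
      rw [pow_succ, ← mul_assoc, map_mul _ _ X, aeval_X]
    have e2 : aeval (M n) (C a * X ^ (k + 1)) = aeval (M n) (C a * X ^ k) * M n := by
      rw [pow_succ, ← mul_assoc, map_mul _ _ X, aeval_X]
    rw [e1, e2]
    rw [ContinuousLinearMap.mul_def, ContinuousLinearMap.comp_apply, ih, ← Matrix.mulVec_mulVec]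
    congr 1
    ext j
    exact hT x n j

lemma exists_blockDiag {K : ℕ → Type} [∀ n, Fintype (K n)] [∀ n, DecidableEq (K n)]
    (M : ∀ n, Matrix (K n) (K n) ℂ) (c : ℝ)
    (hM : ∀ (n : ℕ) (φ : ℂ[X]) (B : ℝ), (∀ z : ℂ, ‖z‖ = 1 → ‖φ.eval z‖ ≤ B) → ∀ v : K n → ℂ,
      ∑ z, ‖(aeval (M n) φ).mulVec v z‖ ^ 2 ≤ (c * B) ^ 2 * ∑ z, ‖v z‖ ^ 2) (hc : 0 ≤ c) :
    ∃ T : lp (fun _ : Σ n, K n => ℂ) 2 →L[ℂ] lp (fun _ : Σ n, K n => ℂ) 2,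
      (∀ (φ : ℂ[X]) x n i, (aeval T φ x) ⟨n, i⟩ =
        (aeval (M n) φ).mulVec (fun j => x ⟨n, j⟩) i) ∧
      (∀ (φ : ℂ[X]) (B : ℝ), (∀ z : ℂ, ‖z‖ = 1 → ‖φ.eval z‖ ≤ B) → ‖aeval T φ‖ ≤ c * B) := by
  have h1 : ∀ n (v : K n → ℂ), ∑ z, ‖(M n).mulVec v z‖ ^ 2 ≤ c ^ 2 * ∑ z, ‖v z‖ ^ 2 := by
    intro n v
    have := hM n X 1 (by intro z hz; simp [hz]) v
    simpa using this
  obtain ⟨T, hT⟩ := exists_blockDiag0 M c h1 hc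
  refine ⟨T, blockDiag_aeval M T hT, fun φ B hB => ?_⟩
  have hB0 : 0 ≤ B := (norm_nonneg _).trans (hB 1 (by simp))
  refine ContinuousLinearMap.opNorm_le_bound _ (by positivity) fun x => ?_
  obtain ⟨hy, h⟩ := sig_bound x (fun s => (aeval T φ x) s) (c * B) (by positivity) (by
    intro n
    simp only [blockDiag_aeval M T hT φ]
    exact hM n φ B hB _)
  exact h

lemma l2_partial {A : Type*} (x : lp (fun _ : A => ℂ) 2) (s : Finset A) :
    ∑ i ∈ s, ‖x i‖ ^ 2 ≤ ‖x‖ ^ 2 := by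
  rw [l2_norm_sq]
  exact (l2_summable x).sum_le_tsum s fun _ _ => by positivity

lemma exists_J {A E : Type*} [NormedAddCommGroup E] [NormedSpace ℂ E] [CompleteSpace E]
    (G : A → E) (K : ℝ) (hK : 0 ≤ K)
    (hG : ∀ (s : Finset A) (c : A → ℂ), ‖∑ k ∈ s, c k • G k‖ ^ 2 ≤ K ^ 2 * ∑ k ∈ s, ‖c k‖ ^ 2) :
    ∃ J : lp (fun _ : A => ℂ) 2 →L[ℂ] E, ∀ x, HasSum (fun k => x k • G k) (J x) := by
  have hs : ∀ x : lp (fun _ : A => ℂ) 2, Summable fun k => x k • G k := by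
    intro x
    rw [summable_iff_vanishing_norm]
    intro ε hε
    have h1 := summable_iff_vanishing_norm.1 (l2_summable x) ((ε / (K + 1)) ^ 2) (by positivity)
    obtain ⟨s, hs⟩ := h1
    refine ⟨s, fun t ht => ?_⟩
    have h2 := hs t ht
    rw [Real.norm_of_nonneg (by positivity)] at h2
    have h3 := hG t (fun k => x k)
    have h4 : ‖∑ k ∈ t, x k • G k‖ ^ 2 < ε ^ 2 := by
      calc ‖∑ k ∈ t, x k • G k‖ ^ 2 ≤ K ^ 2 * ∑ k ∈ t, ‖x k‖ ^ 2 := h3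
        _ ≤ (K + 1) ^ 2 * ∑ k ∈ t, ‖x k‖ ^ 2 := by gcongr; linarith
        _ < (K + 1) ^ 2 * (ε / (K + 1)) ^ 2 := by gcongr
        _ = ε ^ 2 := by field_simp
    exact lt_of_pow_lt_pow_left₀ 2 hε.le h4
  have hb : ∀ x : lp (fun _ : A => ℂ) 2, ‖∑' k, x k • G k‖ ≤ K * ‖x‖ := by
    intro x
    refine le_of_tendsto (hs x).hasSum.norm (Filter.Eventually.of_forall fun s => ?_)
    apply le_of_sq_le_sq _ (by positivity)
    refine (hG s fun k => x k).trans ?_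
    rw [mul_pow]
    gcongr
    exact l2_partial x s
  let L : lp (fun _ : A => ℂ) 2 →ₗ[ℂ] E :=
    { toFun := fun x => ∑' k, x k • G k
      map_add' := by
        intro x y
        rw [← (hs x).tsum_add (hs y)]
        congr 1; ext k
        rw [lp.coeFn_add, Pi.add_apply, add_smul]
      map_smul' := by
        intro r x
        rw [RingHom.id_apply, ← (hs x).tsum_const_smul]
        congr 1; ext k
        rw [lp.coeFn_smul, Pi.smul_apply, smul_assoc] }
  exact ⟨L.mkContinuous K hb, fun x => (hs x).hasSum⟩

lemma exists_Q {A E : Type*} [NormedAddCommGroup E] [NormedSpace ℂ E]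
    (Λ : A → E →L[ℂ] ℂ) (K : ℝ) (hK : 0 ≤ K)
    (hL : ∀ (s : Finset A) (c : A → ℂ), ‖∑ k ∈ s, c k • Λ k‖ ^ 2 ≤ K ^ 2 * ∑ k ∈ s, ‖c k‖ ^ 2) :
    ∃ Q : E →L[ℂ] lp (fun _ : A => ℂ) 2, ∀ g k, Q g k = Λ k g := by
  have hfin : ∀ (g : E) (s : Finset A), ∑ k ∈ s, ‖Λ k g‖ ^ 2 ≤ (K * ‖g‖) ^ 2 := by
    intro g s
    have h1 := hL s fun k => star (Λ k g)
    set W := ∑ k ∈ s, ‖Λ k g‖ ^ 2 with hW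
    have hW0 : 0 ≤ W := by positivity
    simp only [norm_star] at h1
    have h2 : (∑ k ∈ s, star (Λ k g) • Λ k) g = (W : ℂ) := by
      rw [hW, Complex.ofReal_sum]
      simp only [ContinuousLinearMap.sum_apply, ContinuousLinearMap.smul_apply, smul_eq_mul]
      refine Finset.sum_congr rfl fun a _ => ?_
      rw [Complex.star_def, mul_comm, Complex.mul_conj, Complex.normSq_eq_norm_sq]
    have h3 := (∑ k ∈ s, star (Λ k g) • Λ k).le_opNorm g
    rw [h2, Complex.norm_real, Real.norm_of_nonneg hW0] at h3
    have h4 : W ^ 2 ≤ (K * ‖g‖) ^ 2 * W := by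
      calc W ^ 2 ≤ (‖∑ k ∈ s, star (Λ k g) • Λ k‖ * ‖g‖) ^ 2 := by gcongr
        _ = ‖∑ k ∈ s, star (Λ k g) • Λ k‖ ^ 2 * ‖g‖ ^ 2 := by ring
        _ ≤ K ^ 2 * W * ‖g‖ ^ 2 := by gcongr
        _ = _ := by ring
    by_contra hlt
    push Not at hlt
    have : 0 < W := lt_of_le_of_lt (by positivity) hlt
    nlinarith
  have hex : ∀ g : E, ∃ y : lp (fun _ : A => ℂ) 2, (∀ k, y k = Λ k g) ∧ ‖y‖ ≤ K * ‖g‖ := by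
    intro g
    have hs : Summable fun k => ‖Λ k g‖ ^ 2 :=
      summable_of_sum_le (fun _ => by positivity) (hfin g)
    refine ⟨⟨fun k => Λ k g, l2_mem _ hs⟩, fun k => rfl, ?_⟩
    apply le_of_sq_le_sq _ (by positivity)
    rw [l2_norm_sq]
    exact hs.tsum_le_of_sum_le (hfin g)
  choose F hF hFn using hex
  let L : E →ₗ[ℂ] lp (fun _ : A => ℂ) 2 :=
    { toFun := F
      map_add' := by
        intro x y
        ext k
        rw [lp.coeFn_add, Pi.add_apply, hF, hF, hF, map_add]
      map_smul' := by
        intro r x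
        ext k
        rw [lp.coeFn_smul, Pi.smul_apply, hF, hF, map_smul]; rfl }
  exact ⟨L.mkContinuous K hFn, hF⟩

lemma exists_JQ_abs {A E : Type*} [DecidableEq A] [NormedAddCommGroup E] [NormedSpace ℂ E]
    [CompleteSpace E] (G : A → E) (Λ : A → E →L[ℂ] ℂ) (K : ℝ) (hK : 0 ≤ K)
    (hG : ∀ (s : Finset A) (c : A → ℂ), ‖∑ k ∈ s, c k • G k‖ ^ 2 ≤ K ^ 2 * ∑ k ∈ s, ‖c k‖ ^ 2)
    (K' : ℝ) (hK' : 0 ≤ K')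
    (hL : ∀ (s : Finset A) (c : A → ℂ), ‖∑ k ∈ s, c k • Λ k‖ ^ 2 ≤ K' ^ 2 * ∑ k ∈ s, ‖c k‖ ^ 2)
    (hLG : ∀ j k, Λ j (G k) = if j = k then 1 else 0) :
    ∃ (J : lp (fun _ : A => ℂ) 2 →L[ℂ] E) (Q : E →L[ℂ] lp (fun _ : A => ℂ) 2),
      ∀ x, Q (J x) = x := by
  obtain ⟨J, hJ⟩ := exists_J G K hK hG
  obtain ⟨Q, hQ⟩ := exists_Q Λ K' hK' hL
  refine ⟨J, Q, fun x => ?_⟩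
  ext k
  rw [hQ]
  have h1 := (hJ x).mapL (Λ k)
  simp only [map_smul, hLG, smul_eq_mul, mul_ite, mul_one, mul_zero] at h1
  have h2 := hasSum_ite_eq k (x k)
  refine h1.unique ?_
  convert h2 using 2 with j
  by_cases h : j = k
  · subst h; simp
  · simp [h, Ne.symm h]

open ProbabilityTheory in
lemma exists_gaussians (A : Type) [Countable A] : ∃ X : A → unitInterval → ℝ,
    (∀ k, Measurable (X k)) ∧ (∀ k, (volume : Measure unitInterval).map (X k) = gaussianReal 0 1) ∧
    iIndepFun X (volume : Measure unitInterval) := by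
  obtain ⟨f, hf, hmap⟩ := (Measure.infinitePi (fun _ : A => gaussianReal 0 1)).exists_measurable_map_eq
  have hm : ∀ k, Measurable fun t => f t k := fun k => (measurable_pi_apply k).comp hf
  have hl : ∀ k, (volume : Measure unitInterval).map (fun t => f t k) = gaussianReal 0 1 := by
    intro k
    have := Measure.infinitePi_map_eval (fun _ : A => gaussianReal 0 1) k
    rw [← hmap, Measure.map_map (measurable_pi_apply k) hf] at this
    exact this
  refine ⟨fun k t => f t k, hm, hl, ?_⟩
  rw [iIndepFun_iff_map_fun_eq_infinitePi_map₀' fun k => (hm k).aemeasurable]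
  simp only [hl]
  exact hmap

open ProbabilityTheory in
lemma gauss_sum_law {A : Type} {X : A → unitInterval → ℝ} (hm : ∀ k, Measurable (X k))
    (hl : ∀ k, (volume : Measure unitInterval).map (X k) = gaussianReal 0 1)
    (hi : iIndepFun X (volume : Measure unitInterval)) (s : Finset A) (c : A → ℝ) :
    (volume : Measure unitInterval).map (∑ k ∈ s, fun t => c k * X k t) =
      gaussianReal 0 (∑ k ∈ s, ‖c k‖₊ ^ 2) := by
  classical
  induction s using Finset.induction_on with
  | empty =>
    simp only [Finset.sum_empty, gaussianReal_zero_var]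
    rw [show (0 : unitInterval → ℝ) = fun _ => 0 from rfl, Measure.map_const]
    simp
  | insert a s ha ih =>
    have hi' : iIndepFun (fun k t => c k * X k t) (volume : Measure unitInterval) :=
      hi.comp (fun k x => c k * x) fun k => by fun_prop
    have h1 := hi'.indepFun_finsetSum_of_notMem (fun k => by have := hm k; fun_prop) ha
    have h2 : (volume : Measure unitInterval).map (fun t => c a * X a t) =
        gaussianReal 0 (‖c a‖₊ ^ 2) := by
      have := gaussianReal_map_const_mul (μ := 0) (v := 1) (c a)
      rw [← hl a, Measure.map_map (by fun_prop) (hm a)] at this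
      refine this.trans ?_
      rw [mul_zero, mul_one]
      congr 1
      ext
      simp
    have h3 := gaussianReal_add_gaussianReal_of_indepFun h1 ih h2
    rw [Finset.sum_insert ha, Finset.sum_insert ha, add_comm, h3, zero_add, add_comm]

open ProbabilityTheory in
lemma gauss_eLpNorm {A : Type} {X : A → unitInterval → ℝ} (hm : ∀ k, Measurable (X k))
    (hl : ∀ k, (volume : Measure unitInterval).map (X k) = gaussianReal 0 1)
    (hi : iIndepFun X (volume : Measure unitInterval)) (q : ℝ≥0∞) (s : Finset A) (c : A → ℝ) :
    eLpNorm (∑ k ∈ s, fun t => c k * X k t) q (volume : Measure unitInterval) =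
      ENNReal.ofReal (Real.sqrt (∑ k ∈ s, c k ^ 2)) * eLpNorm id q (gaussianReal 0 1) := by
  set sg := Real.sqrt (∑ k ∈ s, c k ^ 2) with hsg
  have hms : Measurable (∑ k ∈ s, fun t => c k * X k t) := by
    have hfun : (∑ k ∈ s, fun t => c k * X k t) = fun t => ∑ k ∈ s, c k * X k t := by
      ext t; simp
    rw [hfun]
    exact Finset.measurable_sum s fun k _ => (hm k).const_mul (c k)
  have h1 : eLpNorm (∑ k ∈ s, fun t => c k * X k t) q (volume : Measure unitInterval) =
      eLpNorm id q (gaussianReal 0 (∑ k ∈ s, ‖c k‖₊ ^ 2)) := by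
    rw [← gauss_sum_law hm hl hi s c, eLpNorm_map_measure (by fun_prop) hms.aemeasurable]
    rfl
  have h2 := gaussianReal_map_const_mul (μ := 0) (v := 1) sg
  rw [mul_zero, mul_one] at h2
  have h3 : (NNReal.mk (sg ^ 2) (sq_nonneg _)) = ∑ k ∈ s, ‖c k‖₊ ^ 2 := by
    ext
    simp [hsg, Real.sq_sqrt (show 0 ≤ ∑ k ∈ s, c k ^ 2 by positivity)]
  rw [h3] at h2
  rw [h1, ← h2, eLpNorm_map_measure (by fun_prop) (by fun_prop)]
  have : (id ∘ fun x : ℝ => sg * x) = sg • (id : ℝ → ℝ) := by ext; simp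
  rw [this, eLpNorm_const_smul, Real.enorm_eq_ofReal (Real.sqrt_nonneg _)]

open ProbabilityTheory in
lemma gauss_memLp {A : Type} {X : A → unitInterval → ℝ} (hm : ∀ k, Measurable (X k))
    (hl : ∀ k, (volume : Measure unitInterval).map (X k) = gaussianReal 0 1)
    (q : ℝ≥0∞) (hq : q ≠ ∞) (k : A) :
    MemLp (fun t => (X k t : ℂ)) q (volume : Measure unitInterval) := by
  have h1 : MemLp (X k) q (volume : Measure unitInterval) := by
    have := memLp_id_gaussianReal' (μ := 0) (v := 1) q hq
    rw [← hl k, memLp_map_measure_iff (by fun_prop) (hm k).aemeasurable] at this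
    exact this
  exact h1.ofReal

open ProbabilityTheory in
lemma gauss_khinchine {A : Type} {X : A → unitInterval → ℝ} (hm : ∀ k, Measurable (X k))
    (hl : ∀ k, (volume : Measure unitInterval).map (X k) = gaussianReal 0 1)
    (hi : iIndepFun X (volume : Measure unitInterval)) (q : ℝ≥0∞) (hq : q ≠ ∞) [Fact (1 ≤ q)]
    (s : Finset A) (c : A → ℂ) :
    ‖∑ k ∈ s, c k • (gauss_memLp hm hl q hq k).toLp _‖ ^ 2 ≤
      (2 * (eLpNorm id q (gaussianReal 0 1)).toReal) ^ 2 * ∑ k ∈ s, ‖c k‖ ^ 2 := by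
  set K := (eLpNorm id q (gaussianReal 0 1)).toReal with hK
  set G := fun k => (gauss_memLp hm hl q hq k).toLp _ with hG
  have hae : ∀ (s : Finset A) (a : A → ℝ), (∑ k ∈ s, (a k : ℂ) • G k : Lp ℂ q volume) =ᵐ[volume]
      fun t => (((∑ k ∈ s, fun t => a k * X k t) t : ℝ) : ℂ) := by
    classical
    intro s a
    induction s using Finset.induction_on with
    | empty =>
      simp only [Finset.sum_empty]
      filter_upwards [Lp.coeFn_zero ℂ q (volume : Measure unitInterval)] with t ht
      rw [ht]; simp
    | insert b s hb ih =>
      rw [Finset.sum_insert hb, Finset.sum_insert hb]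
      filter_upwards [Lp.coeFn_add ((a b : ℂ) • G b) (∑ k ∈ s, (a k : ℂ) • G k), ih,
        Lp.coeFn_smul (a b : ℂ) (G b), (gauss_memLp hm hl q hq b).coeFn_toLp] with t h1 h2 h3 h4
      rw [h1, Pi.add_apply, h2, h3, Pi.smul_apply, h4]
      simp
  have hreal : ∀ a : A → ℝ, ‖∑ k ∈ s, (a k : ℂ) • G k‖ = Real.sqrt (∑ k ∈ s, a k ^ 2) * K := by
    intro a
    rw [Lp.norm_def, eLpNorm_congr_ae (hae s a)]
    have : eLpNorm (fun t => (((∑ k ∈ s, fun t => a k * X k t) t : ℝ) : ℂ)) q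
        (volume : Measure unitInterval) = eLpNorm (∑ k ∈ s, fun t => a k * X k t) q volume := by
      apply eLpNorm_congr_norm_ae
      filter_upwards with t
      rw [Complex.norm_real]
    rw [this, gauss_eLpNorm hm hl hi, ENNReal.toReal_mul, ENNReal.toReal_ofReal (Real.sqrt_nonneg _)]
  have hsplit : ∑ k ∈ s, c k • G k = ∑ k ∈ s, ((c k).re : ℂ) • G k +
      Complex.I • ∑ k ∈ s, ((c k).im : ℂ) • G k := by
    rw [Finset.smul_sum, ← Finset.sum_add_distrib]
    refine Finset.sum_congr rfl fun k _ => ?_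
    rw [smul_smul, ← add_smul]
    congr 1
    rw [mul_comm]
    exact (Complex.re_add_im _).symm
  have hK0 : 0 ≤ K := ENNReal.toReal_nonneg
  have hle : ∀ a : A → ℝ, (∀ k, |a k| ≤ ‖c k‖) →
      ‖∑ k ∈ s, (a k : ℂ) • G k‖ ≤ Real.sqrt (∑ k ∈ s, ‖c k‖ ^ 2) * K := by
    intro a ha
    rw [hreal]
    refine mul_le_mul_of_nonneg_right (Real.sqrt_le_sqrt (Finset.sum_le_sum fun k _ => ?_)) hK0
    exact sq_le_sq' (neg_le_of_abs_le (ha k)) (le_of_abs_le (ha k))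
  have h1 := hle _ fun k => Complex.abs_re_le_norm (c k)
  have h2 := hle _ fun k => Complex.abs_im_le_norm (c k)
  have h3 : ‖∑ k ∈ s, c k • G k‖ ≤ 2 * K * Real.sqrt (∑ k ∈ s, ‖c k‖ ^ 2) := by
    rw [hsplit]
    refine (norm_add_le _ _).trans ?_
    rw [norm_smul, Complex.norm_I, one_mul]
    linarith
  calc _ ≤ (2 * K * Real.sqrt (∑ k ∈ s, ‖c k‖ ^ 2)) ^ 2 := by gcongr
    _ = _ := by rw [mul_pow, Real.sq_sqrt (by positivity)]

open ProbabilityTheory in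
lemma gauss_orth {A : Type} [DecidableEq A] {X : A → unitInterval → ℝ} (hm : ∀ k, Measurable (X k))
    (hl : ∀ k, (volume : Measure unitInterval).map (X k) = gaussianReal 0 1)
    (hi : iIndepFun X (volume : Measure unitInterval)) (j k : A) :
    ∫ t, X j t * X k t = if j = k then 1 else 0 := by
  have hmean : ∀ k, ∫ t, X k t = 0 := by
    intro k
    have := integral_id_gaussianReal (μ := 0) (v := 1)
    rw [← hl k, integral_map (hm k).aemeasurable (by fun_prop)] at this
    exact this
  split_ifs with h
  · subst h
    have h1 := variance_of_integral_eq_zero (X := X j) (μ := (volume : Measure unitInterval))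
      (hm j).aemeasurable (hmean j)
    have h2 := variance_id_gaussianReal (μ := 0) (v := 1)
    rw [← hl j, variance_map (by fun_prop) (hm j).aemeasurable] at h2
    rw [Function.id_comp, h1] at h2
    simpa [sq] using h2
  · rw [(hi.indepFun h).integral_fun_mul_eq_mul_integral (hm j).aestronglyMeasurable
      (hm k).aestronglyMeasurable, hmean j, zero_mul]

theorem exists_JQ (p : ℝ) (hp : 1 < p) [Fact (1 ≤ ENNReal.ofReal p)] (A : Type) [Countable A] :
    ∃ (J : lp (fun _ : A => ℂ) 2 →L[ℂ] Lp ℂ (ENNReal.ofReal p) (volume : Measure unitInterval))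
      (Q : Lp ℂ (ENNReal.ofReal p) (volume : Measure unitInterval) →L[ℂ] lp (fun _ : A => ℂ) 2),
      ∀ x, Q (J x) = x := by
  classical
  obtain ⟨X, hm, hl, hi⟩ := exists_gaussians A
  have hpq := Real.HolderConjugate.conjExponent hp
  set q := Real.conjExponent p with hq
  have : Fact (1 ≤ ENNReal.ofReal q) := ⟨by
    rw [← ENNReal.ofReal_one]; exact ENNReal.ofReal_le_ofReal hpq.symm.lt.le⟩
  have : ENNReal.HolderConjugate (ENNReal.ofReal p) (ENNReal.ofReal q) := hpq.ennrealOfReal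
  let pair := (ContinuousLinearMap.mul ℂ ℂ).lpPairing (volume : Measure unitInterval)
    (ENNReal.ofReal p) (ENNReal.ofReal q)
  let G := fun k => (gauss_memLp hm hl (ENNReal.ofReal p) ENNReal.ofReal_ne_top k).toLp _
  let H := fun k => (gauss_memLp hm hl (ENNReal.ofReal q) ENNReal.ofReal_ne_top k).toLp _
  refine exists_JQ_abs G (fun k => pair.flip (H k))
    (2 * (eLpNorm id (ENNReal.ofReal p) (ProbabilityTheory.gaussianReal 0 1)).toReal) (by positivity)
    (gauss_khinchine hm hl hi (ENNReal.ofReal p) ENNReal.ofReal_ne_top) (‖pair.flip‖ * (2 * (eLpNorm id (ENNReal.ofReal q)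
      (ProbabilityTheory.gaussianReal 0 1)).toReal)) (by positivity) ?_ ?_
  · intro s c
    have h1 : ∑ k ∈ s, c k • pair.flip (H k) = pair.flip (∑ k ∈ s, c k • H k) := by
      simp only [map_sum, map_smul]
    rw [h1]
    calc _ ≤ (‖pair.flip‖ * ‖∑ k ∈ s, c k • H k‖) ^ 2 := by
          gcongr; exact ContinuousLinearMap.le_opNorm _ _
      _ = ‖pair.flip‖ ^ 2 * ‖∑ k ∈ s, c k • H k‖ ^ 2 := by ring
      _ ≤ _ := by
          rw [mul_pow, mul_assoc]
          gcongr
          exact gauss_khinchine hm hl hi (ENNReal.ofReal q) ENNReal.ofReal_ne_top s c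
  · intro j k
    rw [ContinuousLinearMap.flip_apply, ContinuousLinearMap.lpPairing_eq_integral]
    have h1 : ∫ t, (ContinuousLinearMap.mul ℂ ℂ) (G k t) (H j t) =
        ∫ t, ((X j t * X k t : ℝ) : ℂ) := by
      apply integral_congr_ae
      filter_upwards [(gauss_memLp hm hl (ENNReal.ofReal p) ENNReal.ofReal_ne_top k).coeFn_toLp,
        (gauss_memLp hm hl (ENNReal.ofReal q) ENNReal.ofReal_ne_top j).coeFn_toLp] with t h1 h2
      simp only [G, H, h1, h2, ContinuousLinearMap.mul_apply']
      push_cast; ring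
    rw [h1, integral_complex_ofReal, gauss_orth hm hl hi]
    split_ifs <;> simp

open Complex.HadamardThreeLines in
lemma interp_form {α β : Type} [Fintype α] [Fintype β] {p q : ℝ} (hpq : p.HolderConjugate q)
    (hp2 : p ≤ 2) (b : α → β → ℂ) (N : ℝ) (hN : 0 < N)
    (h1 : ∀ (x : β → ℂ) (y : α → ℂ), (∀ a, ‖y a‖ ≤ 1) →
      ‖∑ a, ∑ j, b a j * (x j * y a)‖ ≤ N * ∑ j, ‖x j‖)
    (h2 : ∀ (x : β → ℂ) (y : α → ℂ),
      ‖∑ a, ∑ j, b a j * (x j * y a)‖ ^ 2 ≤ N * ((∑ j, ‖x j‖ ^ 2) * ∑ a, ‖y a‖ ^ 2))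
    (x : β → ℂ) (y : α → ℂ) (hx : ∑ j, ‖x j‖ ^ p ≤ 1) (hy : ∑ a, ‖y a‖ ^ q ≤ 1) :
    ‖∑ a, ∑ j, b a j * (x j * y a)‖ ≤ N ^ (1 / p) := by
  have hp0 := hpq.pos
  have hq0 := hpq.symm.pos
  have hq2 : 2 ≤ q := by
    have := hpq.inv_add_inv_eq_one
    have h3 : (2:ℝ)⁻¹ ≤ p⁻¹ := inv_anti₀ hp0 hp2
    have h4 : q⁻¹ ≤ 2⁻¹ := by norm_num at h3 ⊢; linarith
    exact (inv_le_inv₀ hq0 (by norm_num)).1 h4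
  set sgn : ℂ → ℂ := fun w => w / (‖w‖ : ℂ) with hsgn
  have hsgn1 : ∀ w, ‖sgn w‖ ≤ 1 := by
    intro w
    simp only [hsgn, norm_div, Complex.norm_real, norm_norm]
    exact div_self_le_one _
  set xz : ℂ → β → ℂ := fun z j => sgn (x j) * Complex.exp (p * (1 - z / 2) * (Real.log ‖x j‖ : ℝ)) with hxz
  set yz : ℂ → α → ℂ := fun z a => sgn (y a) * Complex.exp (q * z / 2 * (Real.log ‖y a‖ : ℝ)) with hyz
  have nx : ∀ z j, ‖xz z j‖ = ‖sgn (x j)‖ * Real.exp (p * (1 - z.re / 2) * Real.log ‖x j‖) := by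
    intro z j
    simp only [hxz, norm_mul, Complex.norm_exp]
    congr 2
    simp
  have ny : ∀ z a, ‖yz z a‖ = ‖sgn (y a)‖ * Real.exp (q * z.re / 2 * Real.log ‖y a‖) := by
    intro z j
    simp only [hyz, norm_mul, Complex.norm_exp]
    congr 2
    simp
  have ex : ∀ (w : ℂ) (s : ℝ), s ≠ 0 → ‖sgn w‖ * Real.exp (s * Real.log ‖w‖) = ‖w‖ ^ s := by
    intro w s hs
    by_cases hw : w = 0
    · simp [hsgn, hw, Real.zero_rpow hs]
    · have : 0 < ‖w‖ := norm_pos_iff.2 hw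
      rw [Real.rpow_def_of_pos this, mul_comm s]
      simp only [hsgn, norm_div, Complex.norm_real, norm_norm]
      rw [div_self this.ne', one_mul]
  set f : ℂ → ℂ := fun z => ∑ a, ∑ j, b a j * (xz z j * yz z a) with hf
  have hfd : Differentiable ℂ f := by
    simp only [hf, hxz, hyz]
    fun_prop
  have key := norm_le_interp_of_mem_verticalClosedStrip₀₁' f (z := ((2 / q : ℝ) : ℂ)) (a := N)
    (b := N ^ (1 / 2 : ℝ)) ?_ hfd.diffContOnCl ?_ ?_ ?_
  · have e1 : f ((2 / q : ℝ) : ℂ) = ∑ a, ∑ j, b a j * (x j * y a) := by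
      have es : ∀ w : ℂ, sgn w * Complex.exp (Real.log ‖w‖ : ℝ) = w := by
        intro w
        by_cases hw : w = 0
        · simp [hsgn, hw]
        · have : 0 < ‖w‖ := norm_pos_iff.2 hw
          rw [← Complex.ofReal_exp, Real.exp_log this]
          simp only [hsgn]
          rw [div_mul_cancel₀]
          exact_mod_cast this.ne'
      have ep : (p : ℂ) * (1 - ((2 / q : ℝ) : ℂ) / 2) = 1 := by
        have : p * (1 - (2 / q) / 2) = 1 := by
          have h3 := hpq.inv_add_inv_eq_one
          have h4 : 1 - (2 / q) / 2 = p⁻¹ := by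
            rw [← h3]; field_simp; ring
          rw [h4, mul_inv_cancel₀ hp0.ne']
        exact_mod_cast this
      have eq' : (q : ℂ) * ((2 / q : ℝ) : ℂ) / 2 = 1 := by
        have : q * (2 / q) / 2 = 1 := by field_simp
        exact_mod_cast this
      simp only [hf, hxz, hyz, ep, eq', one_mul, es]
    rw [e1, Complex.ofReal_re, ← Real.rpow_mul hN.le, ← Real.rpow_add hN] at key
    convert key using 2
    have h3 := hpq.inv_add_inv_eq_one
    rw [one_div, ← sub_eq_iff_eq_add.2 h3.symm]
    field_simp; ring
  · simp only [verticalClosedStrip, Set.mem_preimage, Complex.ofReal_re, Set.mem_Icc]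
    exact ⟨by positivity, (div_le_one hq0).2 hq2⟩
  · refine ⟨∑ a, ∑ j, ‖b a j‖ * (Real.exp (p * |Real.log ‖x j‖|) *
      Real.exp (q * |Real.log ‖y a‖|)), ?_⟩
    rintro _ ⟨z, hz, rfl⟩
    simp only [verticalClosedStrip, Set.mem_preimage, Set.mem_Icc] at hz
    have hA : ∀ (s t u : ℝ), 0 ≤ s → s ≤ t → s * u ≤ t * |u| := by
      intro s t u hs hst
      calc s * u ≤ s * |u| := mul_le_mul_of_nonneg_left (le_abs_self u) hs
        _ ≤ t * |u| := mul_le_mul_of_nonneg_right hst (abs_nonneg u)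
    refine norm_sum_le_of_le _ fun a _ => norm_sum_le_of_le _ fun j _ => ?_
    rw [norm_mul, norm_mul, nx, ny]
    gcongr
    · calc _ ≤ 1 * Real.exp (p * (1 - z.re / 2) * Real.log ‖x j‖) := by
            gcongr; exact hsgn1 _
        _ ≤ _ := by
          rw [one_mul]; apply Real.exp_le_exp.2
          apply hA
          · apply mul_nonneg hp0.le; linarith
          · nlinarith
    · calc _ ≤ 1 * Real.exp (q * z.re / 2 * Real.log ‖y a‖) := by
            gcongr; exact hsgn1 _
        _ ≤ _ := by
          rw [one_mul]; apply Real.exp_le_exp.2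
          apply hA
          · have := mul_nonneg hq0.le hz.1; linarith
          · nlinarith
  · intro z hz
    have hz0 : z.re = 0 := hz
    refine (h1 _ _ fun a => ?_).trans ?_
    · rw [ny, hz0]; simpa using hsgn1 _
    · have : ∑ j, ‖xz z j‖ = ∑ j, ‖x j‖ ^ p := by
        refine Finset.sum_congr rfl fun j _ => ?_
        rw [nx, hz0, ← ex _ _ hp0.ne']; simp
      rw [this]
      nlinarith
  · intro z hz
    have hz0 : z.re = 1 := hz
    have hh := h2 (xz z) (yz z)
    have e1 : ∑ j, ‖xz z j‖ ^ 2 = ∑ j, ‖x j‖ ^ p := by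
      refine Finset.sum_congr rfl fun j _ => ?_
      rw [nx, hz0, ex _ _ (by linarith), ← Real.rpow_mul_natCast (norm_nonneg _)]
      congr 1; push_cast; ring
    have e2 : ∑ j, ‖yz z j‖ ^ 2 = ∑ j, ‖y j‖ ^ q := by
      refine Finset.sum_congr rfl fun j _ => ?_
      rw [ny, hz0, ex _ _ (by linarith), ← Real.rpow_mul_natCast (norm_nonneg _)]
      congr 1; push_cast; ring
    rw [e1, e2] at hh
    have h5 : (∑ j, ‖x j‖ ^ p) * ∑ j, ‖y j‖ ^ q ≤ 1 :=
      mul_le_one₀ hx (by positivity) hy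
    have h6 : ‖f z‖ ^ 2 ≤ N := hh.trans (by nlinarith)
    rw [← Real.sqrt_eq_rpow]
    exact Real.le_sqrt_of_sq_le h6

lemma form_max {α β : Type} [Fintype α] [Fintype β] {p q : ℝ} (hpq : p.HolderConjugate q)
    (b : α → β → ℂ) (N : ℝ) (hN : 1 ≤ N)
    (hr : ∀ a, ∑ j, ‖b a j‖ ≤ N) (hc : ∀ j, ∑ a, ‖b a j‖ ≤ N)
    (h2 : ∀ (x : β → ℂ) (y : α → ℂ),
      ‖∑ a, ∑ j, b a j * (x j * y a)‖ ^ 2 ≤ N * ((∑ j, ‖x j‖ ^ 2) * ∑ a, ‖y a‖ ^ 2))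
    (x : β → ℂ) (y : α → ℂ) (hx : ∑ j, ‖x j‖ ^ p ≤ 1) (hy : ∑ a, ‖y a‖ ^ q ≤ 1) :
    ‖∑ a, ∑ j, b a j * (x j * y a)‖ ≤ N ^ (max (1 / p) (1 / q)) := by
  have hN0 : 0 < N := by linarith
  have gen : ∀ {α β : Type} [Fintype α] [Fintype β] (b : α → β → ℂ) (hc : ∀ j, ∑ a, ‖b a j‖ ≤ N)
      (x : β → ℂ) (y : α → ℂ), (∀ a, ‖y a‖ ≤ 1) →
      ‖∑ a, ∑ j, b a j * (x j * y a)‖ ≤ N * ∑ j, ‖x j‖ := by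
    intro α β _ _ b hc x y hy
    rw [Finset.sum_comm, Finset.mul_sum]
    refine norm_sum_le_of_le _ fun j _ => ?_
    calc _ ≤ ∑ a, ‖b a j‖ * ‖x j‖ := by
          refine norm_sum_le_of_le _ fun a _ => ?_
          rw [norm_mul, norm_mul]
          gcongr
          exact mul_le_of_le_one_right (norm_nonneg _) (hy a)
      _ ≤ _ := by
          rw [← Finset.sum_mul]
          gcongr
          exact hc j
  rcases le_total p 2 with h | h
  · refine (interp_form hpq h b N hN0 (gen b hc) h2 x y hx hy).trans ?_
    exact Real.rpow_le_rpow_of_exponent_le hN (le_max_left _ _)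
  · have hq2 : q ≤ 2 := by
      have := hpq.inv_add_inv_eq_one
      have h3 : p⁻¹ ≤ (2:ℝ)⁻¹ := inv_anti₀ (by norm_num) h
      have h4 : 2⁻¹ ≤ q⁻¹ := by norm_num at h3 ⊢; linarith
      exact (inv_le_inv₀ (by norm_num) hpq.symm.pos).1 h4
    have hsw : ∀ (x : β → ℂ) (y : α → ℂ), ∑ j, ∑ a, b a j * (y a * x j) =
        ∑ a, ∑ j, b a j * (x j * y a) := by
      intro x y
      rw [Finset.sum_comm]
      simp only [mul_comm (y _)]
    have := interp_form hpq.symm hq2 (fun j a => b a j) N hN0 (gen _ hr)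
      (fun u v => by rw [hsw, mul_comm (∑ j, _)]; exact h2 v u) y x hy hx
    rw [hsw] at this
    refine this.trans ?_
    exact Real.rpow_le_rpow_of_exponent_le hN (le_max_right _ _)

lemma matrix_lp_bound {α β : Type} [Fintype α] [Fintype β] {p q : ℝ} (hpq : p.HolderConjugate q)
    (b : α → β → ℂ) (B : ℝ) (hB : 0 ≤ B)
    (h : ∀ (x : β → ℂ) (y : α → ℂ), ∑ j, ‖x j‖ ^ p ≤ 1 → ∑ a, ‖y a‖ ^ q ≤ 1 →
      ‖∑ a, ∑ j, b a j * (x j * y a)‖ ≤ B) (x : β → ℂ) :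
    ∑ a, ‖∑ j, b a j * x j‖ ^ p ≤ B ^ p * ∑ j, ‖x j‖ ^ p := by
  have hp0 := hpq.pos
  have hq0 := hpq.symm.pos
  -- normalized case
  have hnorm : ∀ x : β → ℂ, ∑ j, ‖x j‖ ^ p ≤ 1 → ∑ a, ‖∑ j, b a j * x j‖ ^ p ≤ B ^ p := by
    intro x hx
    obtain ⟨⟨g, hg, hge⟩, -⟩ := NNReal.isGreatest_Lp Finset.univ (fun a => ‖∑ j, b a j * x j‖₊) hpq
    simp only [Set.mem_setOf_eq] at hg hge
    set c := fun a => ∑ j, b a j * x j with hc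
    obtain ⟨u, hu, huc⟩ : ∃ u : α → ℂ, (∀ a, ‖u a‖ = 1) ∧ ∀ a, c a * u a = (‖c a‖ : ℂ) := by
      have : ∀ a, ∃ u : ℂ, ‖u‖ = 1 ∧ c a * u = (‖c a‖ : ℂ) := by
        intro a
        by_cases hca : c a = 0
        · exact ⟨1, by simp, by simp [hca]⟩
        · have h0 : (‖c a‖ : ℂ) ≠ 0 := by exact_mod_cast (norm_pos_iff.2 hca).ne'
          refine ⟨(‖c a‖ : ℂ) / c a, ?_, by field_simp⟩
          rw [norm_div, Complex.norm_real, norm_norm, div_self (norm_ne_zero_iff.2 hca)]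
      choose u hu using this
      exact ⟨u, fun a => (hu a).1, fun a => (hu a).2⟩
    have h1 := h x (fun a => u a * (g a : ℝ)) hx (by
      have : ∀ a, ‖u a * (g a : ℝ)‖ ^ q = ((g a ^ q : NNReal) : ℝ) := by
        intro a
        rw [norm_mul, hu, one_mul]; simp
      simp only [this]
      exact_mod_cast hg)
    have h3 : ∑ a, ∑ j, b a j * (x j * (u a * (g a : ℝ))) =
        ((∑ a, ‖c a‖ * (g a : ℝ) : ℝ) : ℂ) := by
      push_cast
      refine Finset.sum_congr rfl fun a _ => ?_
      rw [← huc, hc]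
      simp only [Finset.sum_mul]
      refine Finset.sum_congr rfl fun j _ => ?_
      ring
    rw [h3, Complex.norm_real] at h1
    have h4 : ∑ a, ‖c a‖ * (g a : ℝ) = (∑ a, ‖c a‖ ^ p) ^ (1 / p) := by
      have := congrArg ((↑) : NNReal → ℝ) hge
      push_cast at this
      exact this
    rw [h4, Real.norm_of_nonneg (by positivity)] at h1
    have h5 := Real.rpow_le_rpow (by positivity) h1 hp0.le
    rwa [← Real.rpow_mul (by positivity), one_div, inv_mul_cancel₀ hp0.ne', Real.rpow_one] at h5
  set s := ∑ j, ‖x j‖ ^ p with hs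
  have hs0 : 0 ≤ s := by positivity
  rcases hs0.eq_or_lt with h0 | h0
  · have hx0 : ∀ j, x j = 0 := by
      intro j
      have := (Finset.sum_eq_zero_iff_of_nonneg (fun j _ => by positivity)).1 (hs ▸ h0.symm) j
        (Finset.mem_univ j)
      rw [Real.rpow_eq_zero_iff_of_nonneg (norm_nonneg _)] at this
      exact norm_eq_zero.1 this.1
    simp only [hx0, mul_zero, Finset.sum_const_zero, norm_zero, Real.zero_rpow hp0.ne', ← h0]
    exact le_rfl
  · set r := s ^ (1 / p) with hr
    have hr0 : 0 < r := Real.rpow_pos_of_pos h0 _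
    have hrp : r ^ p = s := by
      rw [hr, ← Real.rpow_mul hs0, one_div, inv_mul_cancel₀ hp0.ne', Real.rpow_one]
    have hnr : ‖((r : ℂ))⁻¹‖ = r⁻¹ := by
      rw [norm_inv, Complex.norm_real, Real.norm_of_nonneg hr0.le]
    have h6 : ∀ w : ℂ, ‖(r : ℂ)⁻¹ * w‖ ^ p = s⁻¹ * ‖w‖ ^ p := by
      intro w
      rw [norm_mul, hnr, Real.mul_rpow (by positivity) (by positivity), Real.inv_rpow hr0.le, hrp]
    have h7 := hnorm (fun j => (r : ℂ)⁻¹ * x j) (by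
      simp only [h6]
      rw [← Finset.mul_sum, ← hs, inv_mul_cancel₀ h0.ne'])
    have h8 : ∀ a, ∑ j, b a j * ((r : ℂ)⁻¹ * x j) = (r : ℂ)⁻¹ * ∑ j, b a j * x j := by
      intro a
      rw [Finset.mul_sum]
      exact Finset.sum_congr rfl fun j _ => by ring
    simp only [h8, h6] at h7
    rw [← Finset.mul_sum, inv_mul_le_iff₀ h0] at h7
    linarith

lemma CarData.lp_bound {n : ℕ} {ι : Type} [Fintype ι] [DecidableEq ι] {D : ℕ → Matrix ι ι ℂ}
    {κ : ι → ℕ} (h : CarData n ι D κ) (hn : 1 ≤ n) {p q : ℝ} (hpq : p.HolderConjugate q)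
    (x : ι → ℂ) :
    ∑ a, ‖∑ j, (∑ l ∈ Finset.range n, D l a j) * x j‖ ^ p ≤
      ((n : ℝ) ^ (max (1 / p) (1 / q))) ^ p * ∑ j, ‖x j‖ ^ p := by
  refine matrix_lp_bound hpq (fun a j => ∑ l ∈ Finset.range n, D l a j) _ (by positivity) ?_ x
  refine form_max hpq _ _ (by exact_mod_cast hn) ?_ ?_ ?_
  · intro a
    exact (Finset.sum_le_sum fun j _ => norm_sum_le _ _).trans (h.row a)
  · intro a
    exact (Finset.sum_le_sum fun j _ => norm_sum_le _ _).trans (h.col a)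
  · intro u v
    have := h.form_bound (fun _ => 1) u v
    simp only [norm_one, one_pow, Finset.sum_const, Finset.card_range, nsmul_eq_mul, mul_one,
      one_mul] at this
    refine le_trans (le_of_eq ?_) this
    congr 2
    symm
    rw [Finset.sum_comm]
    refine Finset.sum_congr rfl fun a _ => ?_
    rw [Finset.sum_comm]
    refine Finset.sum_congr rfl fun j _ => ?_
    rw [Finset.sum_mul]
    exact Finset.sum_congr rfl fun l _ => by ring

lemma count_enorm_rpow (p : ℝ) (hp : 1 < p) (f : Lp ℂ (ENNReal.ofReal p) (Measure.count : Measure ℤ)) :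
    ‖f‖ₑ ^ p = ∑' k, ‖f k‖ₑ ^ p := by
  have hp0 : 0 < p := by linarith
  rw [Lp.enorm_def, eLpNorm_eq_lintegral_rpow_enorm_toReal (by simpa using hp0) ENNReal.ofReal_ne_top,
    lintegral_count, ENNReal.toReal_ofReal hp0.le, one_div, ENNReal.rpow_inv_rpow hp0.ne']

lemma count_ext {P : ℝ≥0∞} {f g : Lp ℂ P (Measure.count : Measure ℤ)} (h : ∀ k, f k = g k) :
    f = g := Lp.ext (Measure.ae_count_iff.2 h)

lemma shift_apply (P : ℝ≥0∞) [Fact (1 ≤ P)] (f : Lp ℂ P (Measure.count : Measure ℤ)) (k : ℤ) :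
    shiftOp P f k = f (k - 1) :=
  Measure.ae_count_iff.1 (Lp.coeFn_compMeasurePreserving f shift_measurePreserving) k

lemma shift_norm (P : ℝ≥0∞) [Fact (1 ≤ P)] (f : Lp ℂ P (Measure.count : Measure ℤ)) :
    ‖shiftOp P f‖ = ‖f‖ :=
  (Lp.compMeasurePreservingₗᵢ ℂ (fun k : ℤ => k - 1) shift_measurePreserving).norm_map f

lemma shift_pow_norm (P : ℝ≥0∞) [Fact (1 ≤ P)] (m : ℕ) (f : Lp ℂ P (Measure.count : Measure ℤ)) :
    ‖(shiftOp P ^ m) f‖ = ‖f‖ := by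
  induction m with
  | zero => simp
  | succ m ih => rw [pow_succ', ContinuousLinearMap.mul_apply, shift_norm, ih]

noncomputable def cbasis (P : ℝ≥0∞) (k : ℤ) : Lp ℂ P (Measure.count : Measure ℤ) :=
  indicatorConstLp P (s := {k}) (measurableSet_singleton k) (by simp) (1 : ℂ)

lemma cbasis_apply (P : ℝ≥0∞) (k j : ℤ) : cbasis P k j = if j = k then 1 else 0 := by
  have := Measure.ae_count_iff.1 (indicatorConstLp_coeFn (p := P) (μ := Measure.count)
    (hs := measurableSet_singleton k) (hμs := by simp) (c := (1:ℂ))) j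
  rw [cbasis, this, Set.indicator_apply]
  simp

lemma shift_cbasis (P : ℝ≥0∞) [Fact (1 ≤ P)] (k : ℤ) : shiftOp P (cbasis P k) = cbasis P (k + 1) := by
  apply count_ext
  intro j
  rw [shift_apply, cbasis_apply, cbasis_apply]
  simp only [sub_eq_iff_eq_add]

lemma count_add_apply {P : ℝ≥0∞} (f g : Lp ℂ P (Measure.count : Measure ℤ)) (k : ℤ) :
    (f + g) k = f k + g k := Measure.ae_count_iff.1 (Lp.coeFn_add f g) k

lemma count_zero_apply {P : ℝ≥0∞} (k : ℤ) :
    (0 : Lp ℂ P (Measure.count : Measure ℤ)) k = 0 :=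
  Measure.ae_count_iff.1 (Lp.coeFn_zero ℂ P (Measure.count : Measure ℤ)) k

lemma count_smul_apply {P : ℝ≥0∞} (c : ℂ) (f : Lp ℂ P (Measure.count : Measure ℤ)) (k : ℤ) :
    (c • f) k = c * f k := Measure.ae_count_iff.1 (Lp.coeFn_smul c f) k

lemma count_sum_apply {P : ℝ≥0∞} {ι : Type} (s : Finset ι)
    (f : ι → Lp ℂ P (Measure.count : Measure ℤ)) (k : ℤ) :
    (∑ i ∈ s, f i) k = ∑ i ∈ s, f i k := by
  classical
  induction s using Finset.induction_on with
  | empty => simpa using count_zero_apply k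
  | insert a s ha ih => rw [Finset.sum_insert ha, Finset.sum_insert ha, count_add_apply, ih]

lemma test_norm (p : ℝ) (hp : 1 < p) [Fact (1 ≤ ENNReal.ofReal p)] (w : ℂ) (hw : ‖w‖ = 1) (N : ℕ) :
    ‖∑ k ∈ Finset.range N, w ^ k • cbasis (ENNReal.ofReal p) (k : ℤ)‖ = (N : ℝ) ^ (1 / p) := by
  have hp0 : 0 < p := by linarith
  set x := ∑ k ∈ Finset.range N, w ^ k • cbasis (ENNReal.ofReal p) (k : ℤ) with hx
  have hxk : ∀ j : ℤ, ‖x j‖ₑ ^ p = if j ∈ (Finset.range N).map Nat.castEmbedding then 1 else 0 := by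
    intro j
    rw [hx, count_sum_apply]
    simp only [count_smul_apply, cbasis_apply]
    split_ifs with h
    · simp only [Finset.mem_map, Nat.castEmbedding_apply] at h
      obtain ⟨m, hm, rfl⟩ := h
      rw [Finset.sum_eq_single m]
      · simp only [if_true, mul_one, enorm_pow]
        rw [← ofReal_norm, hw]; simp
      · intro k _ hk
        rw [if_neg (by exact_mod_cast hk.symm), mul_zero]
      · intro h; exact absurd hm h
    · rw [Finset.sum_eq_zero]
      · simp [hp0]
      · intro k hk
        rw [if_neg, mul_zero]
        rintro rfl
        exact h (Finset.mem_map.2 ⟨k, hk, rfl⟩)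
  have h1 : ‖x‖ₑ ^ p = N := by
    rw [count_enorm_rpow p hp]
    simp only [hxk]
    rw [tsum_eq_sum (s := (Finset.range N).map Nat.castEmbedding)
      (fun j hj => if_neg hj), Finset.sum_congr rfl (fun j hj => if_pos hj)]
    simp
  have h2 : ‖x‖ ^ p = N := by
    have := congrArg ENNReal.toReal h1
    rwa [← ENNReal.toReal_rpow, toReal_enorm, ENNReal.toReal_natCast] at this
  rw [← h2, one_div, Real.rpow_rpow_inv (norm_nonneg _) hp0.ne']

lemma eval_le_shift (p : ℝ) (hp : 1 < p) [Fact (1 ≤ ENNReal.ofReal p)] (φ : ℂ[X]) (z : ℂ)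
    (hz : ‖z‖ = 1) : ‖φ.eval z‖ ≤ ‖aeval (shiftOp (ENNReal.ofReal p)) φ‖ := by
  have hp0 : 0 < p := by linarith
  set S := shiftOp (ENNReal.ofReal p) with hS
  have hz0 : z ≠ 0 := by rintro rfl; simp at hz
  obtain ⟨ψ, hψ⟩ : ∃ ψ : ℂ[X], φ = ψ * (X - C z) + C (φ.eval z) := by
    have : (X - C z) ∣ φ - C (φ.eval z) := by
      rw [dvd_iff_isRoot]; simp
    obtain ⟨ψ, h⟩ := this
    exact ⟨ψ, by rw [mul_comm, ← h]; ring⟩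
  set E := ‖aeval S ψ‖ with hE
  have hN : ∀ N : ℕ, ‖φ.eval z‖ * (N : ℝ) ^ (1 / p) ≤ ‖aeval S φ‖ * (N : ℝ) ^ (1 / p) + E * 2 := by
    intro N
    set x := ∑ k ∈ Finset.range N, (z⁻¹) ^ k • cbasis (ENNReal.ofReal p) (k : ℤ) with hx
    have hxn : ‖x‖ = (N : ℝ) ^ (1 / p) := test_norm p hp _ (by rw [norm_inv, hz, inv_one]) N
    have hb : ∀ k, ‖cbasis (ENNReal.ofReal p) k‖ = 1 := by
      intro k
      rw [cbasis, norm_indicatorConstLp (by simpa using hp0) ENNReal.ofReal_ne_top]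
      simp [Measure.real]
    have hd : ‖S x - z • x‖ ≤ 2 := by
      have : S x - z • x = z • ((z⁻¹) ^ N • cbasis (ENNReal.ofReal p) (N : ℤ) -
          (z⁻¹) ^ 0 • cbasis (ENNReal.ofReal p) ((0 : ℕ) : ℤ)) := by
        rw [← Finset.sum_range_sub (fun k : ℕ => (z⁻¹) ^ k • cbasis (ENNReal.ofReal p) (k : ℤ)),
          hx, map_sum, Finset.smul_sum, Finset.smul_sum, ← Finset.sum_sub_distrib]
        refine Finset.sum_congr rfl fun k _ => ?_
        rw [map_smul, hS, shift_cbasis, smul_sub, smul_smul, smul_smul]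
        congr 2
        · rw [pow_succ']; field_simp
      rw [this, norm_smul, hz, one_mul]
      refine (norm_sub_le _ _).trans ?_
      rw [norm_smul, norm_smul, hb, hb, norm_pow, norm_pow, norm_inv, hz]
      norm_num
    have h1 : aeval S φ x = aeval S ψ (S x - z • x) + φ.eval z • x := by
      conv_lhs => rw [hψ]
      simp [Algebra.algebraMap_eq_smul_one]
    have h2 : φ.eval z • x = aeval S φ x - aeval S ψ (S x - z • x) := by rw [h1]; abel
    calc _ = ‖φ.eval z • x‖ := by rw [norm_smul, hxn]
      _ ≤ ‖aeval S φ x‖ + ‖aeval S ψ (S x - z • x)‖ := by rw [h2]; exact norm_sub_le _ _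
      _ ≤ ‖aeval S φ‖ * ‖x‖ + E * ‖S x - z • x‖ :=
        add_le_add (ContinuousLinearMap.le_opNorm _ _) (ContinuousLinearMap.le_opNorm _ _)
      _ ≤ _ := by rw [hxn]; gcongr
  by_contra! hlt
  have ht : Filter.Tendsto (fun N : ℕ => (‖φ.eval z‖ - ‖aeval S φ‖) * (N : ℝ) ^ (1 / p))
      Filter.atTop Filter.atTop :=
    ((tendsto_rpow_atTop (by positivity)).comp tendsto_natCast_atTop_atTop).const_mul_atTop
      (sub_pos.2 hlt)
  obtain ⟨N, hN'⟩ := (ht.eventually_gt_atTop (E * 2)).exists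
  have := hN N
  linarith

lemma blockCLM_apply {X : Type*} [NormedAddCommGroup X] [NormedSpace ℂ X]
    (P : ℝ≥0∞) [Fact (1 ≤ P)] {n : ℕ} (M : Fin n → Fin n → (X →L[ℂ] X))
    (x : PiLp P (fun _ : Fin n => X)) (i : Fin n) :
    blockCLM P M x i = ∑ j, M i j (x j) := by
  simp [blockCLM]

noncomputable def testPoly (n : ℕ) {m : ℕ} (D : ℕ → Matrix (Fin m) (Fin m) ℂ) (a b : Fin m) : ℂ[X] :=
  ∑ l ∈ Finset.range n, C (D l a b) * X ^ (2 ^ l)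

lemma block_shift_bound (p q : ℝ) (hpq : p.HolderConjugate q) [Fact (1 ≤ ENNReal.ofReal p)]
    {n m : ℕ} (hn : 1 ≤ n) {D : ℕ → Matrix (Fin m) (Fin m) ℂ} {κ : Fin m → ℕ}
    (h : CarData n (Fin m) D κ) :
    ‖blockCLM (ENNReal.ofReal p) (fun i j => aeval (shiftOp (ENNReal.ofReal p)) (testPoly n D i j))‖ ≤
      (n : ℝ) ^ (max (1 / p) (1 / q)) := by
  have hp := hpq.lt
  have hp0 : 0 < p := by linarith
  set S := shiftOp (ENNReal.ofReal p) with hS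
  set B := (n : ℝ) ^ (max (1 / p) (1 / q)) with hB
  have hB0 : 0 ≤ B := by positivity
  refine ContinuousLinearMap.opNorm_le_bound _ hB0 fun x => ?_
  set y := blockCLM (ENNReal.ofReal p) (fun i j => aeval S (testPoly n D i j)) x with hy
  have hpr : (ENNReal.ofReal p).toReal = p := ENNReal.toReal_ofReal hp0.le
  rw [PiLp.norm_eq_sum (by rw [hpr]; exact hp0), PiLp.norm_eq_sum (by rw [hpr]; exact hp0), hpr]
  set w : Fin m → Lp ℂ (ENNReal.ofReal p) (Measure.count : Measure ℤ) := fun j => (S ^ κ j) (x j) with hw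
  have h1 : ∀ a, (S ^ κ a) (y a) = ∑ j, (∑ l ∈ Finset.range n, D l a j) • w j := by
    intro a
    rw [hy, blockCLM_apply, map_sum]
    refine Finset.sum_congr rfl fun j _ => ?_
    simp only [testPoly, map_sum, map_mul, aeval_C, map_pow, aeval_X]
    rw [ContinuousLinearMap.sum_apply, map_sum, Finset.sum_smul]
    refine Finset.sum_congr rfl fun l hl => ?_
    by_cases hD : D l a j = 0
    · simp [hD]
    · rw [hw]
      simp only []
      rw [h.wt l (Finset.mem_range.1 hl) a j hD, pow_add, Algebra.algebraMap_eq_smul_one,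
        smul_mul_assoc, one_mul, ContinuousLinearMap.smul_apply, map_smul,
        ContinuousLinearMap.mul_apply]
  have hny : ∀ a, ‖y a‖ = ‖∑ j, (∑ l ∈ Finset.range n, D l a j) • w j‖ := by
    intro a; rw [← h1, hS, shift_pow_norm]
  have hnx : ∀ j, ‖x j‖ = ‖w j‖ := by
    intro j; rw [hw, hS]; exact (shift_pow_norm _ _ _).symm
  have key : ∑ a, ‖∑ j, (∑ l ∈ Finset.range n, D l a j) • w j‖ ^ p ≤ B ^ p * ∑ j, ‖w j‖ ^ p := by
    have hen : ∀ f : Lp ℂ (ENNReal.ofReal p) (Measure.count : Measure ℤ),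
        ENNReal.ofReal (‖f‖ ^ p) = ∑' k, ENNReal.ofReal (‖f k‖ ^ p) := by
      intro f
      simp only [← ENNReal.ofReal_rpow_of_nonneg (norm_nonneg _) hp0.le, ofReal_norm]
      exact count_enorm_rpow p hp f
    rw [← ENNReal.ofReal_le_ofReal_iff (by positivity), ENNReal.ofReal_mul (by positivity),
      ENNReal.ofReal_sum_of_nonneg (fun _ _ => by positivity),
      ENNReal.ofReal_sum_of_nonneg (fun _ _ => by positivity)]
    simp only [hen]
    rw [← Summable.tsum_finsetSum (fun _ _ => ENNReal.summable),
      ← Summable.tsum_finsetSum (fun _ _ => ENNReal.summable), ← ENNReal.tsum_mul_left]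
    refine ENNReal.tsum_le_tsum fun k => ?_
    rw [← ENNReal.ofReal_sum_of_nonneg (fun _ _ => by positivity),
      ← ENNReal.ofReal_sum_of_nonneg (fun _ _ => by positivity), ← ENNReal.ofReal_mul (by positivity)]
    apply ENNReal.ofReal_le_ofReal
    simp only [count_sum_apply, count_smul_apply]
    exact h.lp_bound hn hpq (fun j => w j k)
  simp only [hny, hnx]
  calc _ ≤ (B ^ p * ∑ j, ‖w j‖ ^ p) ^ (1 / p) := by gcongr
    _ = _ := by
      rw [Real.mul_rpow (by positivity) (by positivity), one_div, Real.rpow_rpow_inv hB0 hp0.ne']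

lemma coeff_zero_le (φ : ℂ[X]) (B : ℝ) (hB : ∀ z : ℂ, ‖z‖ = 1 → ‖φ.eval z‖ ≤ B) :
    ‖φ.coeff 0‖ ≤ B := by
  have := Complex.norm_le_of_forall_mem_frontier_norm_le (f := fun z => φ.eval z)
    (U := Metric.ball (0:ℂ) 1) Metric.isBounded_ball φ.differentiable.diffContOnCl (C := B)
    (fun z hz => hB z (by
      rw [frontier_ball (0:ℂ) one_ne_zero] at hz
      simpa using hz)) (z := 0) (subset_closure (by simp))
  simpa [coeff_zero_eq_eval_zero] using this

lemma lift_aeval {H Y : Type} [NormedAddCommGroup H] [NormedSpace ℂ H] [NormedAddCommGroup Y]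
    [NormedSpace ℂ Y] (J : H →L[ℂ] Y) (Q : Y →L[ℂ] H) (hQJ : ∀ x, Q (J x) = x) (T0 : H →L[ℂ] H)
    (φ : ℂ[X]) :
    (∀ y, aeval (J.comp (T0.comp Q)) φ (J y) = J (aeval T0 φ y)) ∧
    (∀ x, aeval (J.comp (T0.comp Q)) φ x = J (aeval T0 φ (Q x)) + φ.coeff 0 • (x - J (Q x))) := by
  set T := J.comp (T0.comp Q) with hT
  have hTJ : ∀ y, T (J y) = J (T0 y) := by intro y; simp [hT, hQJ]
  have h1 : ∀ (φ : ℂ[X]) y, aeval T φ (J y) = J (aeval T0 φ y) := by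
    intro φ
    induction φ using Polynomial.induction_on' with
    | add f g hf hg => intro y; simp [hf, hg]
    | monomial k c =>
      intro y
      have hk : ∀ y, (T ^ k) (J y) = J ((T0 ^ k) y) := by
        induction k with
        | zero => intro y; simp
        | succ k ih =>
          intro y
          rw [pow_succ, pow_succ, mul_apply_eq_comp, mul_apply_eq_comp, hTJ, ih]
      rw [aeval_monomial, aeval_monomial, Algebra.algebraMap_eq_smul_one,
        Algebra.algebraMap_eq_smul_one, smul_mul_assoc, smul_mul_assoc, one_mul, one_mul]
      simp [hk]
  refine ⟨h1 φ, fun x => ?_⟩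
  have h2 : ∀ v, T v = 0 → aeval T φ v = φ.coeff 0 • v := by
    intro v hv
    conv_lhs => rw [← divX_mul_X_add φ]
    simp [hv, Algebra.algebraMap_eq_smul_one]
  have h3 : T (x - J (Q x)) = 0 := by simp [hT, hQJ]
  conv_lhs => rw [show x = J (Q x) + (x - J (Q x)) by abel, map_add, h1, h2 _ h3]

lemma lift_bound {H Y : Type} [NormedAddCommGroup H] [NormedSpace ℂ H] [NormedAddCommGroup Y]
    [NormedSpace ℂ Y] (J : H →L[ℂ] Y) (Q : Y →L[ℂ] H) (hQJ : ∀ x, Q (J x) = x) (T0 : H →L[ℂ] H)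
    (φ : ℂ[X]) (B : ℝ) (hB : ∀ z : ℂ, ‖z‖ = 1 → ‖φ.eval z‖ ≤ B) (h : ‖aeval T0 φ‖ ≤ 6 * B) :
    ‖aeval (J.comp (T0.comp Q)) φ‖ ≤ (1 + 7 * (‖J‖ * ‖Q‖)) * B := by
  have hB0 : 0 ≤ B := (norm_nonneg _).trans (hB 1 (by simp))
  refine ContinuousLinearMap.opNorm_le_bound _ (by positivity) fun x => ?_
  rw [(lift_aeval J Q hQJ T0 φ).2 x]
  have h0 := coeff_zero_le φ B hB
  have hQ : ‖Q x‖ ≤ ‖Q‖ * ‖x‖ := Q.le_opNorm x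
  have h1 : ‖J (aeval T0 φ (Q x))‖ ≤ ‖J‖ * (6 * B * (‖Q‖ * ‖x‖)) := by
    refine (J.le_opNorm _).trans ?_
    gcongr
    refine (ContinuousLinearMap.le_opNorm _ _).trans ?_
    gcongr
  have h2 : ‖x - J (Q x)‖ ≤ ‖x‖ + ‖J‖ * (‖Q‖ * ‖x‖) := by
    refine (norm_sub_le _ _).trans ?_
    gcongr
    refine (J.le_opNorm _).trans ?_
    gcongr
  have h3 : ‖φ.coeff 0 • (x - J (Q x))‖ ≤ B * (‖x‖ + ‖J‖ * (‖Q‖ * ‖x‖)) := by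
    rw [norm_smul]; gcongr
  refine (norm_add_le _ _).trans ((add_le_add h1 h3).trans (le_of_eq ?_))
  ring

lemma lower_bound {p q : ℝ} (hpq : p.HolderConjugate q) [Fact (1 ≤ ENNReal.ofReal p)]
    {Y H : Type} [NormedAddCommGroup H] [NormedSpace ℂ H] [NormedAddCommGroup Y]
    [NormedSpace ℂ Y] (J : H →L[ℂ] Y) (Q : Y →L[ℂ] H) {m : ℕ} (hm : 0 < m)
    (M : Fin m → Fin m → (Y →L[ℂ] Y)) (e : Fin m → H) (he : ∀ j, ‖e j‖ ≤ 1)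
    (c : Fin m → H → ℂ) (hc : ∀ a h, ‖c a h‖ ≤ ‖h‖) (s : ℝ)
    (hs : ‖∑ a, c a (Q (∑ j, M a j (J (e j))))‖ = s * m) :
    s ≤ ‖J‖ * ‖Q‖ * ‖blockCLM (ENNReal.ofReal p) M‖ := by
  have hp0 := hpq.pos
  have hm0 : (0:ℝ) < m := by exact_mod_cast hm
  have hpr : (ENNReal.ofReal p).toReal = p := ENNReal.toReal_ofReal hp0.le
  set x : PiLp (ENNReal.ofReal p) (fun _ : Fin m => Y) := WithLp.toLp _ (fun j => J (e j)) with hx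
  set y := blockCLM (ENNReal.ofReal p) M x with hy
  have hya : ∀ a, y a = ∑ j, M a j (J (e j)) := fun a => blockCLM_apply _ M x a
  have hnx : ‖x‖ ≤ ‖J‖ * (m : ℝ) ^ (1 / p) := by
    rw [PiLp.norm_eq_sum (by rw [hpr]; exact hp0), hpr]
    calc _ ≤ (∑ j : Fin m, ‖J‖ ^ p) ^ (1 / p) := by
          gcongr with j _
          exact (J.le_opNorm _).trans (mul_le_of_le_one_right (norm_nonneg _) (he j))
      _ = _ := by
          rw [Finset.sum_const, Finset.card_univ, Fintype.card_fin, nsmul_eq_mul, mul_comm,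
            Real.mul_rpow (by positivity) (by positivity), one_div,
            Real.rpow_rpow_inv (norm_nonneg _) hp0.ne']
  have hsum : ∑ a, ‖y a‖ ≤ ‖y‖ * (m : ℝ) ^ (1 / q) := by
    have := Real.inner_le_Lp_mul_Lq Finset.univ (fun a => ‖y a‖) (fun _ => (1:ℝ)) hpq
    rw [PiLp.norm_eq_sum (by rw [hpr]; exact hp0), hpr]
    simpa using this
  have hny : ‖y‖ ≤ ‖blockCLM (ENNReal.ofReal p) M‖ * ‖x‖ := ContinuousLinearMap.le_opNorm _ _
  set b := ‖blockCLM (ENNReal.ofReal p) M‖ with hb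
  have hmm : (m : ℝ) ^ (1 / p) * (m : ℝ) ^ (1 / q) = m := by
    rw [← Real.rpow_add hm0, one_div, one_div, hpq.inv_add_inv_eq_one, Real.rpow_one]
  have : s * m ≤ (‖J‖ * ‖Q‖ * b) * m := by
    calc s * m ≤ ∑ a, ‖Q‖ * ‖y a‖ := by
          rw [← hs]
          refine norm_sum_le_of_le _ fun a _ => ?_
          rw [← hya]
          exact (hc _ _).trans (Q.le_opNorm _)
      _ ≤ ‖Q‖ * (‖y‖ * (m : ℝ) ^ (1 / q)) := by rw [← Finset.mul_sum]; gcongr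
      _ ≤ ‖Q‖ * ((b * (‖J‖ * (m : ℝ) ^ (1 / p))) * (m : ℝ) ^ (1 / q)) := by
          gcongr
          exact hny.trans (by gcongr)
      _ = (‖J‖ * ‖Q‖ * b) * ((m : ℝ) ^ (1 / p) * (m : ℝ) ^ (1 / q)) := by ring
      _ = _ := by rw [hmm]
  exact le_of_mul_le_mul_right this hm0

lemma fh_test_entry {n m d : ℕ} (hd : 0 < d) (hd2 : 2 ^ n ≤ d) (D : ℕ → Matrix (Fin m) (Fin m) ℂ)
    (a b : Fin m) :
    (aeval (fhPow n d D 1) (testPoly n D a b)) (Sum.inl (a, ⟨0, hd⟩)) (Sum.inr (b, ⟨0, hd⟩)) =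
      ∑ l ∈ Finset.range n, D l a b * D l a b := by
  simp only [testPoly, map_sum, map_mul, aeval_C, map_pow, aeval_X]
  rw [Matrix.sum_apply]
  refine Finset.sum_congr rfl fun l hl => ?_
  rw [fhPow_pow n d hd2, Algebra.algebraMap_eq_smul_one, smul_mul_assoc, one_mul,
    Matrix.smul_apply, fhPow_corner n d hd D l (Finset.mem_range.1 hl), smul_eq_mul]

theorem main_aux (p : ℝ) (hp : 1 < p) [Fact (1 ≤ ENNReal.ofReal p)] :
    ∃ T : Lp ℂ (ENNReal.ofReal p) (volume : Measure unitInterval) →L[ℂ]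
        Lp ℂ (ENNReal.ofReal p) (volume : Measure unitInterval),
      (∃ C : ℝ, 1 ≤ C ∧ ∀ φ : Polynomial ℂ,
        ‖aeval T φ‖ ≤ C * ‖aeval (shiftOp (ENNReal.ofReal p)) φ‖) ∧
      ¬ (∃ C : ℝ, 1 ≤ C ∧ ∀ (n : ℕ) (φm : Fin n → Fin n → Polynomial ℂ),
          ‖blockCLM (ENNReal.ofReal p) (fun i j => aeval T (φm i j))‖ ≤
            C * ‖blockCLM (ENNReal.ofReal p)
                (fun i j => aeval (shiftOp (ENNReal.ofReal p)) (φm i j))‖) := by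
  classical
  have hpq := Real.HolderConjugate.conjExponent hp
  set q := Real.conjExponent p with hq
  choose D κ hD using exists_car_fin
  let K : ℕ → Type := fun n => (Fin (2 ^ n) × Fin (2 ^ n)) ⊕ (Fin (2 ^ n) × Fin (2 ^ n))
  obtain ⟨T0, hT0, hT0b⟩ := exists_blockDiag (K := K) (fun n => fhPow n (2 ^ n) (D n) 1) 6
    (fun n φ B hB v => fh_mulVec_bound (hD n) (2 ^ n) le_rfl φ B hB v) (by norm_num)
  obtain ⟨J, Q, hQJ⟩ := exists_JQ p hp (Σ n, K n)
  refine ⟨J.comp (T0.comp Q), ⟨1 + 7 * (‖J‖ * ‖Q‖), ?_, fun φ => ?_⟩, ?_⟩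
  · have : 0 ≤ ‖J‖ * ‖Q‖ := by positivity
    linarith
  · exact lift_bound J Q hQJ T0 φ _ (fun z hz => eval_le_shift p hp φ z hz)
      (hT0b φ _ fun z hz => eval_le_shift p hp φ z hz)
  · rintro ⟨C, hC1, hC⟩
    set θ := max (1 / p) (1 / q) with hθ
    have hθ1 : θ < 1 := by
      refine max_lt ?_ ?_
      · rw [div_lt_one hpq.pos]; exact hpq.lt
      · rw [div_lt_one hpq.symm.pos]; exact hpq.symm.lt
    have key : ∀ n : ℕ, 1 ≤ n → (n : ℝ) / 2 ≤ ‖J‖ * ‖Q‖ * (C * (n : ℝ) ^ θ) := by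
      intro n hn
      have hpos : 0 < 2 ^ n := by positivity
      have h1 := lower_bound hpq J Q hpos
        (fun i j => aeval (J.comp (T0.comp Q)) (testPoly n (D n) i j))
        (fun b => lp.single 2 (⟨n, Sum.inr (b, ⟨0, hpos⟩)⟩ : Σ n, K n) (1 : ℂ))
        (fun b => by rw [lp.norm_single (by norm_num)]; simp)
        (fun a h => h ⟨n, Sum.inl (a, ⟨0, hpos⟩)⟩)
        (fun a h => lp.norm_apply_le_norm (by norm_num) h _) ((n : ℝ) / 2) ?_
      · refine h1.trans ?_
        gcongr
        refine (hC _ _).trans ?_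
        gcongr
        exact block_shift_bound p q hpq hn (hD n)
      · have h2 : ∀ a b : Fin (2 ^ n), (aeval T0 (testPoly n (D n) a b)
            (lp.single 2 (⟨n, Sum.inr (b, ⟨0, hpos⟩)⟩ : Σ n, K n) (1 : ℂ)))
            ⟨n, Sum.inl (a, ⟨0, hpos⟩)⟩ = ∑ l ∈ Finset.range n, D n l a b * D n l a b := by
          intro a b
          rw [hT0, ← fh_test_entry hpos le_rfl (D n) a b]
          have : (fun j : K n => (lp.single 2 (⟨n, Sum.inr (b, ⟨0, hpos⟩)⟩ : Σ n, K n) (1 : ℂ) :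
              lp (fun _ : Σ n, K n => ℂ) 2) ⟨n, j⟩) = Pi.single (Sum.inr (b, ⟨0, hpos⟩)) 1 := by
            funext j
            by_cases hj : j = Sum.inr (b, ⟨0, hpos⟩)
            · subst hj
              rw [lp.single_apply_self, Pi.single_eq_same]
            · rw [lp.single_apply_ne, Pi.single_eq_of_ne hj]
              intro h
              exact hj (by simpa using h)
          rw [this, Matrix.mulVec_single_one]
          rfl
        have h3 : ∀ a : Fin (2 ^ n), (Q (∑ b, (aeval (J.comp (T0.comp Q)) (testPoly n (D n) a b))
            (J (lp.single 2 (⟨n, Sum.inr (b, ⟨0, hpos⟩)⟩ : Σ n, K n) (1 : ℂ)))))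
            ⟨n, Sum.inl (a, ⟨0, hpos⟩)⟩ = ∑ b, ∑ l ∈ Finset.range n, D n l a b * D n l a b := by
          intro a
          rw [map_sum, lp.coeFn_sum, Finset.sum_apply]
          refine Finset.sum_congr rfl fun b _ => ?_
          rw [(lift_aeval J Q hQJ T0 _).1, hQJ, h2]
        simp only [h3]
        have h4 : ∑ a, ∑ b, ∑ l ∈ Finset.range n, D n l a b * D n l a b =
            (((n : ℝ) / 2 * ((2 ^ n : ℕ) : ℝ) : ℝ) : ℂ) := by
          have : ∑ a, ∑ b, ∑ l ∈ Finset.range n, D n l a b * D n l a b =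
              ∑ l ∈ Finset.range n, ∑ a, ∑ b, D n l a b * D n l a b := by
            rw [Finset.sum_comm (s := Finset.range n)]
            exact Finset.sum_congr rfl fun a _ => Finset.sum_comm
          rw [this, Finset.sum_congr rfl (fun l hl => show _ = (2:ℂ) ^ n / 2 from by
            rw [← (hD n).sq l (Finset.mem_range.1 hl)]; ring)]
          simp only [Finset.sum_const, Finset.card_range, nsmul_eq_mul]
          push_cast; ring
        rw [h4, Complex.norm_real, Real.norm_of_nonneg (by positivity)]
    have ht : Filter.Tendsto (fun n : ℕ => (n : ℝ) ^ (1 - θ)) Filter.atTop Filter.atTop :=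
      (tendsto_rpow_atTop (sub_pos.2 hθ1)).comp tendsto_natCast_atTop_atTop
    obtain ⟨n, hn1, hn2⟩ := ((ht.eventually_gt_atTop (2 * (‖J‖ * ‖Q‖ * C))).and
      (Filter.eventually_ge_atTop 1)).exists
    have hn0 : (0:ℝ) < n := by exact_mod_cast hn2
    have h5 := key n hn2
    have h6 : (n : ℝ) = (n : ℝ) ^ (1 - θ) * (n : ℝ) ^ θ := by
      rw [← Real.rpow_add hn0]; simp
    have h7 : 2 * (‖J‖ * ‖Q‖ * C) * (n : ℝ) ^ θ < (n : ℝ) ^ (1 - θ) * (n : ℝ) ^ θ := by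
      gcongr
    rw [← h6] at h7
    linarith

/-- for `1 < p < ∞`, there exists a bounded operator `T` on `L^p([0,1])` which
is `p`-polynomially bounded but not `p`-completely polynomially bounded. -/
theorem stmt_15 (p : ℝ) (hp : 1 < p) :
    letI : Fact (1 ≤ ENNReal.ofReal p) :=
      ⟨by rw [← ENNReal.ofReal_one]; exact ENNReal.ofReal_le_ofReal hp.le⟩
    ∃ T : Lp ℂ (ENNReal.ofReal p) (volume : Measure unitInterval) →L[ℂ]
        Lp ℂ (ENNReal.ofReal p) (volume : Measure unitInterval),
      (∃ C : ℝ, 1 ≤ C ∧ ∀ φ : Polynomial ℂ,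
        ‖aeval T φ‖ ≤ C * ‖aeval (shiftOp (ENNReal.ofReal p)) φ‖) ∧
      ¬ (∃ C : ℝ, 1 ≤ C ∧ ∀ (n : ℕ) (φm : Fin n → Fin n → Polynomial ℂ),
          ‖blockCLM (ENNReal.ofReal p) (fun i j => aeval T (φm i j))‖ ≤
            C * ‖blockCLM (ENNReal.ofReal p)
                (fun i j => aeval (shiftOp (ENNReal.ofReal p)) (φm i j))‖) := by
  letI : Fact (1 ≤ ENNReal.ofReal p) :=
    ⟨by rw [← ENNReal.ofReal_one]; exact ENNReal.ofReal_le_ofReal hp.le⟩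
  exact main_aux p hp
end
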